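/- arXiv:0908.4177 — 3 statements merged into one kernel-verified Lean document; each statement's English description precedes it below -/
import Mathlib

section
/- Let k ≥ 0 and n ≥ 2k+2 be integers and let t_1 < t_2 < … < t_{n+1} be distinct real numbers. Then there exists λ₀ ∈ ℝ such that for every λ ≥ λ₀ the polytope P := conv({(t_i, t_i², …, t_i^{2k+2}) : i ∈ [n+1]} ∪ {(t_i, t_i², …, t_i^{2k+1}, λ − t_i^{2k+2}) : i ∈ [n+1]}) ⊆ ℝ^{2k+2} has dimension 2k+2 and is (k,(1,n))-PSN, i.e. the k-skeleton of P is combinatorially equivalent to the k-skeleton of Δ_1 × Δ_n. -/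
open Set

section PolytopeDefs

variable {E : Type*} [AddCommGroup E] [Module ℝ E]
variable {E' : Type*} [AddCommGroup E'] [Module ℝ E']

/-- A polytope: the convex hull of a finite set of points. -/
def IsPolytope (P : Set E) : Prop :=
  ∃ V : Finset E, P = convexHull ℝ (V : Set E)

/-- The dimension of a set of points: the dimension of its affine span. -/
noncomputable def polyDim (P : Set E) : ℕ :=
  Module.finrank ℝ (affineSpan ℝ P).direction

/-- A nonempty exposed face of `P`: a nonempty set of the form
`{x ∈ P | ⟨c,x⟩ = max_{y ∈ P} ⟨c,y⟩}` for a linear functional `c`. -/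
def IsFace (P F : Set E) : Prop :=
  F.Nonempty ∧ ∃ c : E →ₗ[ℝ] ℝ, F = {x ∈ P | ∀ y ∈ P, c y ≤ c x}

/-- The `k`-skeleton of `P`: its nonempty faces of dimension at most `k`. -/
def skel (k : ℕ) (P : Set E) : Set (Set E) :=
  {F | IsFace P F ∧ polyDim F ≤ k}

/-- The set of all nonempty faces of `P`. -/
def facesOf (P : Set E) : Set (Set E) :=
  {F | IsFace P F}

/-- Combinatorial equivalence of `k`-skeletons: the posets of faces of dimension
at most `k`, ordered by inclusion, are order-isomorphic. -/
def SkelEquiv (k : ℕ) (P : Set E) (Q : Set E') : Prop :=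
  Nonempty (skel k P ≃o skel k Q)

end PolytopeDefs

/-- The product of standard simplices `Δ_{n 0} × ⋯ × Δ_{n (r-1)}`. -/
def prodSimplex {r : ℕ} (n : Fin r → ℕ) : Set ((i : Fin r) → Fin (n i + 1) → ℝ) :=
  Set.univ.pi fun i => stdSimplex ℝ (Fin (n i + 1))

/-- `P` is `(k, n̄)`-prodsimplicial-neighborly: it is a polytope whose `k`-skeleton
is combinatorially equivalent to that of the product of simplices `Δ_n̄`. -/
def IsPSN {E : Type*} [AddCommGroup E] [Module ℝ E] (k : ℕ) {r : ℕ} (n : Fin r → ℕ)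
    (P : Set E) : Prop :=
  IsPolytope P ∧ SkelEquiv k P (prodSimplex n)

/-- `P` is `(k, n̄)`-projected-prodsimplicial-neighborly: it is `(k, n̄)`-PSN and moreover
the image under a linear map of a polytope whose poset of all nonempty faces is
order-isomorphic to that of `Δ_n̄`. -/
def IsPPSN {E : Type*} [AddCommGroup E] [Module ℝ E] (k : ℕ) {r : ℕ} (n : Fin r → ℕ)
    (P : Set E) : Prop :=
  IsPSN k n P ∧ ∃ (N : ℕ) (Q : Set (Fin N → ℝ)) (f : (Fin N → ℝ) →ₗ[ℝ] E),
    IsPolytope Q ∧ P = f '' Q ∧ Nonempty (facesOf Q ≃o facesOf (prodSimplex n))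

section PointConfiguration

variable {E ι : Type*} [AddCommGroup E] [Module ℝ E]

/-- The indices of a point configuration at which a linear functional is maximal. -/
def maximizers (v : ι → E) (c : E →ₗ[ℝ] ℝ) : Set ι :=
  {p | ∀ q, c (v q) ≤ c (v p)}

lemma maximizers_nonempty [Finite ι] [Nonempty ι] (v : ι → E) (c : E →ₗ[ℝ] ℝ) :
    (maximizers v c).Nonempty :=
  Finite.exists_max fun p => c (v p)

lemma mem_maximizers_iff {v : ι → E} {c : E →ₗ[ℝ] ℝ} {a : ι} (ha : a ∈ maximizers v c) (p : ι) :
    p ∈ maximizers v c ↔ c (v p) = c (v a) :=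
  ⟨fun hp => le_antisymm (ha p) (hp a), fun hp q => hp ▸ ha q⟩

lemma apply_of_mem_convexHull_maximizers {v : ι → E} {c : E →ₗ[ℝ] ℝ} {a : ι}
    (ha : a ∈ maximizers v c) {x : E} (hx : x ∈ convexHull ℝ (v '' maximizers v c)) :
    c x = c (v a) := by
  have hconv : Convex ℝ {x | c x = c (v a)} := convex_hyperplane c.isLinear _
  refine convexHull_min ?_ hconv hx
  rintro _ ⟨p, hp, rfl⟩
  exact (mem_maximizers_iff ha p).1 hp

lemma apply_le_of_mem_convexHull_range {v : ι → E} {c : E →ₗ[ℝ] ℝ} {a : ι}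
    (ha : a ∈ maximizers v c) {x : E} (hx : x ∈ convexHull ℝ (range v)) :
    c x ≤ c (v a) := by
  refine convexHull_min ?_ (convex_halfSpace_le c.isLinear (c (v a))) hx
  rintro _ ⟨p, rfl⟩
  exact ha p

lemma mem_convexHull_maximizers {v : ι → E} {c : E →ₗ[ℝ] ℝ} {a : ι}
    (ha : a ∈ maximizers v c) {x : E} (hx : x ∈ convexHull ℝ (range v)) (hcx : c x = c (v a)) :
    x ∈ convexHull ℝ (v '' maximizers v c) := by
  have hconv : Convex ℝ {x | c x ≤ c (v a) ∧
      (c x = c (v a) → x ∈ convexHull ℝ (v '' maximizers v c))} := by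
    rw [convex_iff_forall_pos]
    rintro x ⟨hx, hx'⟩ y ⟨hy, hy'⟩ r s hr hs hrs
    have h1 : r * c x ≤ r * c (v a) := by gcongr
    have h2 : s * c y ≤ s * c (v a) := by gcongr
    have h3 : r * c (v a) + s * c (v a) = c (v a) := by rw [← add_mul, hrs, one_mul]
    simp only [mem_ofPred_eq, map_add, map_smul, smul_eq_mul]
    refine ⟨by linarith, fun h => ?_⟩
    refine convex_convexHull ℝ _ (hx' ?_) (hy' ?_) hr.le hs.le hrs
    · exact mul_left_cancel₀ hr.ne' (by linarith)
    · exact mul_left_cancel₀ hs.ne' (by linarith)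
  refine (convexHull_min ?_ hconv hx).2 hcx
  rintro _ ⟨p, rfl⟩
  exact ⟨ha p, fun h => subset_convexHull ℝ _ ⟨p, (mem_maximizers_iff ha p).2 h, rfl⟩⟩

lemma exposed_eq_convexHull_maximizers [Finite ι] [Nonempty ι] (v : ι → E) (c : E →ₗ[ℝ] ℝ) :
    {x ∈ convexHull ℝ (range v) | ∀ y ∈ convexHull ℝ (range v), c y ≤ c x} =
      convexHull ℝ (v '' maximizers v c) := by
  obtain ⟨a, ha⟩ := maximizers_nonempty v c
  ext x
  constructor
  · rintro ⟨hx, hmax⟩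
    exact mem_convexHull_maximizers ha hx
      (le_antisymm (apply_le_of_mem_convexHull_range ha hx)
        (hmax _ (subset_convexHull ℝ _ ⟨a, rfl⟩)))
  · intro hx
    refine ⟨convexHull_mono (image_subset_range _ _) hx, fun y hy => ?_⟩
    rw [apply_of_mem_convexHull_maximizers ha hx]
    exact apply_le_of_mem_convexHull_range ha hy

lemma isFace_convexHull_range_iff [Finite ι] [Nonempty ι] (v : ι → E) (F : Set E) :
    IsFace (convexHull ℝ (range v)) F ↔ ∃ c, F = convexHull ℝ (v '' maximizers v c) := by
  simp only [IsFace, exposed_eq_convexHull_maximizers]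
  refine ⟨fun h => h.2, ?_⟩
  rintro ⟨c, rfl⟩
  exact ⟨((maximizers_nonempty v c).image v).convexHull, c, rfl⟩

lemma apply_mem_convexHull_maximizers_iff [Finite ι] [Nonempty ι] {v : ι → E} {c : E →ₗ[ℝ] ℝ}
    {p : ι} : v p ∈ convexHull ℝ (v '' maximizers v c) ↔ p ∈ maximizers v c := by
  obtain ⟨a, ha⟩ := maximizers_nonempty v c
  exact ⟨fun h => (mem_maximizers_iff ha p).2 (apply_of_mem_convexHull_maximizers ha h),
    fun h => subset_convexHull ℝ _ (mem_image_of_mem v h)⟩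

lemma convexHull_maximizers_subset_iff [Finite ι] [Nonempty ι] {v : ι → E} {c d : E →ₗ[ℝ] ℝ} :
    convexHull ℝ (v '' maximizers v c) ⊆ convexHull ℝ (v '' maximizers v d) ↔
      maximizers v c ⊆ maximizers v d :=
  ⟨fun h _ hp => apply_mem_convexHull_maximizers_iff.1
      (h (apply_mem_convexHull_maximizers_iff.2 hp)),
    fun h => convexHull_mono (image_mono h)⟩

lemma polyDim_convexHull (s : Set E) :
    polyDim (convexHull ℝ s) = Module.finrank ℝ (vectorSpan ℝ s) := by
  rw [polyDim, affineSpan_convexHull, direction_affineSpan]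

/-- If a family of index sets consists exactly of the maximizers of linear functionals that span a
face of dimension at most `k`, then it is order-isomorphic to the `k`-skeleton. -/
lemma nonempty_orderIso_skel [Finite ι] [Nonempty ι] (v : ι → E) (k : ℕ) (𝓕 : Set (Set ι))
    (h : ∀ A, A ∈ 𝓕 ↔ (∃ c, A = maximizers v c) ∧ polyDim (convexHull ℝ (v '' A)) ≤ k) :
    Nonempty (𝓕 ≃o skel k (convexHull ℝ (range v))) := by
  have hface : ∀ A ∈ 𝓕, convexHull ℝ (v '' A) ∈ skel k (convexHull ℝ (range v)) := by
    intro A hA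
    obtain ⟨⟨c, rfl⟩, hdim⟩ := (h A).1 hA
    exact ⟨(isFace_convexHull_range_iff v _).2 ⟨c, rfl⟩, hdim⟩
  let f : 𝓕 → skel k (convexHull ℝ (range v)) := fun A => ⟨convexHull ℝ (v '' A), hface A A.2⟩
  have hf : ∀ A B, f A ≤ f B ↔ A ≤ B := by
    rintro ⟨A, hA⟩ ⟨B, hB⟩
    obtain ⟨⟨c, rfl⟩, -⟩ := (h A).1 hA
    obtain ⟨⟨d, rfl⟩, -⟩ := (h B).1 hB
    exact convexHull_maximizers_subset_iff
  refine ⟨RelIso.ofSurjective (OrderEmbedding.ofMapLEIff f hf) ?_⟩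
  rintro ⟨F, hF, hdim⟩
  obtain ⟨c, rfl⟩ := (isFace_convexHull_range_iff v F).1 hF
  exact ⟨⟨maximizers v c, (h _).2 ⟨⟨c, rfl⟩, hdim⟩⟩, rfl⟩

lemma polyDim_lt_of_maximizers_ssubset [FiniteDimensional ℝ E] [Finite ι] [Nonempty ι]
    {v : ι → E} {c : E →ₗ[ℝ] ℝ} {B : Set ι} (hB : maximizers v c ⊂ B) :
    polyDim (convexHull ℝ (v '' maximizers v c)) < polyDim (convexHull ℝ (v '' B)) := by
  obtain ⟨a, ha⟩ := maximizers_nonempty v c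
  have hsub := hB.subset
  obtain ⟨q, hqB, hq⟩ := (ssubset_iff_of_subset hsub).1 hB
  rw [polyDim_convexHull, polyDim_convexHull]
  refine Submodule.finrank_lt_finrank_of_lt
    ((vectorSpan_mono ℝ (image_mono hsub)).lt_of_ne fun heq => hq ?_)
  have hker : vectorSpan ℝ (v '' maximizers v c) ≤ LinearMap.ker c := by
    rw [vectorSpan_eq_span_vsub_set_right ℝ (mem_image_of_mem v ha), Submodule.span_le]
    rintro _ ⟨_, ⟨p, hp, rfl⟩, rfl⟩
    simp [(mem_maximizers_iff ha p).1 hp]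
  have hmem : v q - v a ∈ vectorSpan ℝ (v '' maximizers v c) :=
    heq ▸ vsub_mem_vectorSpan ℝ (mem_image_of_mem v hqB) (mem_image_of_mem v (hsub ha))
  have := hker hmem
  rw [LinearMap.mem_ker, map_sub, sub_eq_zero] at this
  exact (mem_maximizers_iff ha q).2 this

end PointConfiguration

section Prism

variable {E κ : Type*} [AddCommGroup E] [Module ℝ E]

/-- The vertex sets of the faces of dimension at most `k` of a prism over a simplex. -/
def prismFaces (κ : Type*) (k : ℕ) : Set (Set (Fin 2 × κ)) :=
  {A | ∃ (J : Finset (Fin 2)) (I : Finset κ), J.Nonempty ∧ I.Nonempty ∧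
    J.card + I.card ≤ k + 2 ∧ A = (J : Set (Fin 2)) ×ˢ (I : Set κ)}

lemma Finset.eq_of_nonempty_fin_two :
    ∀ J : Finset (Fin 2), J.Nonempty → J = {0} ∨ J = {1} ∨ J = Finset.univ := by
  decide

lemma exists_maximizers_eq_prod [Finite κ] [Nonempty κ] {v : Fin 2 × κ → E} {w : E} {s : κ → ℝ}
    (hs : ∀ i, 0 < s i) (hv : ∀ i, v (1, i) = v (0, i) + s i • w) (c : E →ₗ[ℝ] ℝ) :
    ∃ (J : Finset (Fin 2)) (I : Finset κ), J.Nonempty ∧ I.Nonempty ∧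
      maximizers v c = (J : Set (Fin 2)) ×ˢ (I : Set κ) := by
  classical
  have := Fintype.ofFinite κ
  have hc : ∀ i, c (v (1, i)) = c (v (0, i)) + s i * c w := fun i => by simp [hv]
  obtain ⟨⟨j₀, i₀⟩, h₀⟩ := maximizers_nonempty v c
  suffices h : ∃ J : Finset (Fin 2), ∀ j i, (j, i) ∈ maximizers v c ↔
      j ∈ J ∧ (j₀, i) ∈ maximizers v c by
    obtain ⟨J, hJ⟩ := h
    refine ⟨J, Finset.univ.filter fun i => (j₀, i) ∈ maximizers v c,
      ⟨j₀, ((hJ _ _).1 h₀).1⟩, ⟨i₀, by simpa using h₀⟩, ?_⟩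
    ext ⟨j, i⟩
    rw [hJ]
    simp
  rcases eq_or_ne (c w) 0 with hw | hw
  · refine ⟨Finset.univ, fun j i => ?_⟩
    have hj : ∀ j, c (v (j, i)) = c (v (0, i)) := by
      intro j
      fin_cases j
      · rfl
      · simp [hc, hw]
    rw [mem_maximizers_iff h₀, mem_maximizers_iff h₀, hj j, hj j₀]
    simp
  · refine ⟨{j₀}, fun j i => ?_⟩
    suffices h : (j, i) ∈ maximizers v c → j = j₀ by
      constructor
      · intro h'
        obtain rfl := h h'
        simpa using h'
      · rintro ⟨hj, h'⟩
        rw [Finset.mem_singleton] at hj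
        rwa [hj]
    intro h
    have h1 := h (1 - j, i)
    have h2 := h₀ (1 - j₀, i₀)
    have e1 := hc i
    have e2 := hc i₀
    rcases lt_or_gt_of_ne hw with hw | hw
    · have := mul_neg_of_pos_of_neg (hs i) hw
      have := mul_neg_of_pos_of_neg (hs i₀) hw
      fin_cases j <;> fin_cases j₀ <;> simp at h1 h2 ⊢ <;> linarith
    · have := mul_pos (hs i) hw
      have := mul_pos (hs i₀) hw
      fin_cases j <;> fin_cases j₀ <;> simp at h1 h2 ⊢ <;> linarith

lemma finrank_vectorSpan_singleton_prod_lt (v : Fin 2 × κ → E) (j : Fin 2)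
    {I : Finset κ} (hI : I.Nonempty) :
    Module.finrank ℝ (vectorSpan ℝ (v '' ((({j} : Finset (Fin 2)) : Set (Fin 2)) ×ˢ (I : Set κ)))) < I.card := by
  classical
  have hcard : I.card = I.card - 1 + 1 := by have := hI.card_pos; omega
  have h := finrank_vectorSpan_image_finset_le ℝ (fun i => v (j, i)) I hcard
  have : v '' ((({j} : Finset (Fin 2)) : Set (Fin 2)) ×ˢ (I : Set κ)) = ↑(I.image fun i => v (j, i)) := by
    rw [Finset.coe_singleton, singleton_prod, image_image, Finset.coe_image]
  rw [this]
  omega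

variable [FiniteDimensional ℝ E]

lemma polyDim_prod_add_two_le {v : Fin 2 × κ → E} {w : E} {s : κ → ℝ}
    (hv : ∀ i, v (1, i) = v (0, i) + s i • w) {J : Finset (Fin 2)} {I : Finset κ}
    (hJ : J.Nonempty) (hI : I.Nonempty) :
    polyDim (convexHull ℝ (v '' ((J : Set (Fin 2)) ×ˢ (I : Set κ)))) + 2 ≤ J.card + I.card := by
  rw [polyDim_convexHull]
  rcases Finset.eq_of_nonempty_fin_two J hJ with rfl | rfl | rfl
  · have := finrank_vectorSpan_singleton_prod_lt v 0 hI
    rw [Finset.card_singleton]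
    omega
  · have := finrank_vectorSpan_singleton_prod_lt v 1 hI
    rw [Finset.card_singleton]
    omega
  · obtain ⟨i₀, hi₀⟩ := hI
    have hle : vectorSpan ℝ (v '' (((Finset.univ : Finset (Fin 2)) : Set (Fin 2)) ×ˢ (I : Set κ))) ≤
        vectorSpan ℝ (v '' ((({0} : Finset (Fin 2)) : Set (Fin 2)) ×ˢ (I : Set κ))) ⊔ Submodule.span ℝ {w} := by
      have hmem : ∀ i ∈ I, v (0, i) - v (0, i₀) ∈
          vectorSpan ℝ (v '' ((({0} : Finset (Fin 2)) : Set (Fin 2)) ×ˢ (I : Set κ))) := fun i hi =>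
        vsub_mem_vectorSpan ℝ ⟨(0, i), by simpa using hi, rfl⟩ ⟨(0, i₀), by simpa using hi₀, rfl⟩
      rw [vectorSpan_eq_span_vsub_set_right ℝ 
          (mem_image_of_mem v (show ((0 : Fin 2), i₀) ∈ _ by simpa using hi₀)),
        Submodule.span_le]
      rintro _ ⟨_, ⟨⟨j, i⟩, hi, rfl⟩, rfl⟩
      replace hi : i ∈ I := hi.2
      fin_cases j
      · exact Submodule.mem_sup_left (hmem i hi)
      · have : v (1, i) - v (0, i₀) = (v (0, i) - v (0, i₀)) + s i • w := by
          rw [hv]; abel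
        simp only [Fin.mk_one, vsub_eq_sub, this]
        exact Submodule.add_mem_sup (hmem i hi)
          (Submodule.smul_mem _ _ (Submodule.mem_span_singleton_self w))
    have h1 := Submodule.finrank_mono hle
    have h2 := Submodule.finrank_add_le_finrank_add_finrank
      (vectorSpan ℝ (v '' ((({0} : Finset (Fin 2)) : Set (Fin 2)) ×ˢ (I : Set κ)))) (Submodule.span ℝ {w})
    have h3 := finrank_vectorSpan_singleton_prod_lt v 0 ⟨i₀, hi₀⟩
    have h4 : Module.finrank ℝ (Submodule.span ℝ {w}) ≤ 1 := by
      simpa using finrank_span_le_card (R := ℝ) ({w} : Set E)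
    simp only [Finset.card_univ, Fintype.card_fin]
    omega

lemma le_polyDim_prod [Finite κ] [Nonempty κ] {v : Fin 2 × κ → E} {k : ℕ}
    (hexp : ∀ A ∈ prismFaces κ k, ∃ c, A = maximizers v c) :
    ∀ m ≤ k + 1, ∀ (J : Finset (Fin 2)) (I : Finset κ), J.Nonempty → m + 2 ≤ J.card + I.card →
      m ≤ polyDim (convexHull ℝ (v '' ((J : Set (Fin 2)) ×ˢ (I : Set κ)))) := by
  intro m
  induction m with
  | zero => simp
  | succ m ih =>
    intro hm J I hJ hcard
    obtain ⟨j, hj⟩ := hJ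
    have hJ2 : J.card ≤ 2 := by simpa using J.card_le_univ
    obtain ⟨I', hI', hcard'⟩ := Finset.exists_subset_card_eq (show m + 1 ≤ I.card by omega)
    have hne : I'.Nonempty := Finset.card_pos.1 (by omega)
    obtain ⟨c, hc⟩ := hexp (((({j} : Finset (Fin 2)) : Set (Fin 2))) ×ˢ (I' : Set κ))
      ⟨{j}, I', by simp, hne, by rw [Finset.card_singleton]; omega, rfl⟩
    have hlt : maximizers v c ⊂ (J : Set (Fin 2)) ×ˢ (I : Set κ) := by
      rw [← hc]
      refine ⟨prod_mono (by simpa using hj) (by simpa using hI'), fun hsub => ?_⟩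
      rcases prod_subset_prod_iff.1 hsub with h | h | h
      · have h1 := Finset.card_le_card (Finset.coe_subset.1 h.1)
        have h2 := Finset.card_le_card (Finset.coe_subset.1 h.2)
        rw [Finset.card_singleton] at h1
        omega
      · simp only [Finset.coe_eq_empty] at h
        simp [h] at hj
      · simp only [Finset.coe_eq_empty] at h
        simp only [h, Finset.card_empty] at hcard
        omega
    have h1 := polyDim_lt_of_maximizers_ssubset hlt
    have h2 := ih (by omega) {j} I' (by simp) (by rw [Finset.card_singleton]; omega)
    rw [hc] at h2
    omega

/-- A configuration consisting of two copies of a point configuration, the second one obtained from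
the first by translating the points by positive multiples of a common vector, has the `k`-skeleton
of a prism over a simplex as soon as all faces of that skeleton are exposed. -/
lemma nonempty_orderIso_skel_prism [Finite κ] [Nonempty κ] {v : Fin 2 × κ → E} {k : ℕ}
    {w : E} {s : κ → ℝ} (hs : ∀ i, 0 < s i) (hv : ∀ i, v (1, i) = v (0, i) + s i • w)
    (hexp : ∀ A ∈ prismFaces κ k, ∃ c, A = maximizers v c) :
    Nonempty (prismFaces κ k ≃o skel k (convexHull ℝ (range v))) := by
  refine nonempty_orderIso_skel v k _ fun A => ⟨fun hA => ⟨hexp A hA, ?_⟩, ?_⟩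
  · obtain ⟨J, I, hJ, hI, hcard, rfl⟩ := hA
    have := polyDim_prod_add_two_le hv hJ hI
    omega
  · rintro ⟨⟨c, rfl⟩, hdim⟩
    obtain ⟨J, I, hJ, hI, h⟩ := exists_maximizers_eq_prod hs hv c
    refine ⟨J, I, hJ, hI, ?_, h⟩
    by_contra! hcard
    rw [h] at hdim
    have := le_polyDim_prod hexp (k + 1) le_rfl J I hJ (by omega)
    omega

end Prism

section ProdSimplex

/-- The ambient space of the product of a segment and an `n`-simplex, as a product of two spaces. -/
def prismEquiv (n : ℕ) :
    ((i : Fin 2) → Fin (![1, n] i + 1) → ℝ) ≃ₗ[ℝ] (Fin 2 → ℝ) × (Fin (n + 1) → ℝ) :=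
  LinearEquiv.piFinTwo ℝ fun i => Fin (![1, n] i + 1) → ℝ

/-- The vertices of the product of a segment and an `n`-simplex. -/
def prismVertex (n : ℕ) (p : Fin 2 × Fin (n + 1)) : (i : Fin 2) → Fin (![1, n] i + 1) → ℝ :=
  (prismEquiv n).symm (Pi.single p.1 1, Pi.single p.2 1)

lemma convexHull_range_prismVertex (n : ℕ) :
    convexHull ℝ (range (prismVertex n)) = prodSimplex ![1, n] := by
  have : range (prismVertex n) = Set.univ.pi fun i : Fin 2 =>
      range fun j : Fin (![1, n] i + 1) => (Pi.single j 1 : Fin (![1, n] i + 1) → ℝ) := by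
    ext x
    simp only [mem_range, Set.mem_univ_pi, Fin.forall_fin_two]
    constructor
    · rintro ⟨⟨j, i⟩, rfl⟩
      exact ⟨⟨j, rfl⟩, ⟨i, rfl⟩⟩
    · rintro ⟨⟨j, hj⟩, ⟨i, hi⟩⟩
      refine ⟨(j, i), ?_⟩
      ext a b
      fin_cases a
      · exact congrFun hj b
      · exact congrFun hi b
  rw [this, convexHull_pi, prodSimplex]
  congr 1
  ext1 i
  exact convexHull_rangle_single_eq_stdSimplex ℝ _

lemma nonempty_orderIso_skel_prodSimplex (k n : ℕ) :
    Nonempty (prismFaces (Fin (n + 1)) k ≃o skel k (prodSimplex ![1, n])) := by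
  rw [← convexHull_range_prismVertex]
  refine nonempty_orderIso_skel_prism (s := fun _ => 1)
    (w := (prismEquiv n).symm (Pi.single 1 1 - Pi.single 0 1, 0)) (by simp) (fun i => ?_) ?_
  · rw [one_smul, prismVertex, prismVertex, ← map_add]
    simp
  · rintro _ ⟨J, I, ⟨j₀, hj₀⟩, ⟨i₀, hi₀⟩, -, rfl⟩
    let c : ((i : Fin 2) → Fin (![1, n] i + 1) → ℝ) →ₗ[ℝ] ℝ :=
      (LinearMap.coprod (∑ j ∈ J, LinearMap.proj j) (∑ i ∈ I, LinearMap.proj i)) ∘ₗ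
        (prismEquiv n).toLinearMap
    have hc : ∀ j i, c (prismVertex n (j, i)) =
        (if j ∈ J then 1 else 0) + (if i ∈ I then 1 else 0) := by
      intro j i
      simp [c, prismVertex, Pi.single_apply]
    have hmax : (j₀, i₀) ∈ maximizers (prismVertex n) c := by
      rintro ⟨j, i⟩
      rw [hc, hc, if_pos hj₀, if_pos hi₀]
      gcongr <;> split_ifs <;> norm_num
    refine ⟨c, ?_⟩
    ext ⟨j, i⟩
    rw [mem_maximizers_iff hmax, hc, hc, if_pos hj₀, if_pos hi₀]
    simp only [mem_prod, Finset.mem_coe]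
    by_cases hj : j ∈ J <;> by_cases hi : i ∈ I <;> norm_num [hj, hi]

end ProdSimplex

section ReflectedCyclic

open Polynomial

/-- The point `(x, x ^ 2, …, x ^ d)` of the moment curve. -/
def momentPoint (d : ℕ) (x : ℝ) : Fin d → ℝ :=
  fun j => x ^ (j.val + 1)

/-- The linear functional whose coefficients are those of a polynomial without constant term. -/
def polyFunctional (d : ℕ) (f : ℝ[X]) : (Fin d → ℝ) →ₗ[ℝ] ℝ :=
  ∑ j : Fin d, f.coeff (j.val + 1) • LinearMap.proj j

lemma polyFunctional_momentPoint {d : ℕ} {f : ℝ[X]} (hf : f.natDegree ≤ d) (x : ℝ) :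
    polyFunctional d f (momentPoint d x) = f.eval x - f.coeff 0 := by
  rw [eval_eq_sum_range' (Nat.lt_succ_of_le hf), Finset.sum_range_succ', Finset.sum_range]
  simp [polyFunctional, momentPoint]

lemma exists_eq_polyFunctional {d : ℕ} (c : (Fin d → ℝ) →ₗ[ℝ] ℝ) :
    ∃ f : ℝ[X], f.natDegree ≤ d ∧ c = polyFunctional d f := by
  refine ⟨∑ j : Fin d, monomial (j.val + 1) (c (Pi.single j 1)), ?_, ?_⟩
  · refine natDegree_sum_le_of_forall_le _ _ fun j _ => (natDegree_monomial_le _).trans j.isLt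
  · ext j
    simp [polyFunctional, coeff_monomial, Fin.val_inj, Pi.single_apply]

/-- More than `d` points of the moment curve affinely span `d`-dimensional space. -/
lemma vectorSpan_momentPoint_eq_top {d n : ℕ} (hd : d ≤ n) {t : Fin (n + 1) → ℝ}
    (ht : Function.Injective t) : vectorSpan ℝ (range fun i => momentPoint d (t i)) = ⊤ := by
  by_contra hne
  obtain ⟨c, hc0, hc⟩ := Submodule.exists_le_ker_of_lt_top _ (lt_top_iff_ne_top.2 hne)
  obtain ⟨f, hf, rfl⟩ := exists_eq_polyFunctional c
  have hval : ∀ i, (f - C (f.eval (t 0))).eval (t i) = 0 := by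
    intro i
    have h := hc (vsub_mem_vectorSpan ℝ (mem_range_self i) (mem_range_self 0))
    rw [LinearMap.mem_ker, vsub_eq_sub, map_sub, polyFunctional_momentPoint hf,
      polyFunctional_momentPoint hf] at h
    simp only [eval_sub, eval_C]
    linarith
  have hzero : f - C (f.eval (t 0)) = 0 := by
    refine eq_zero_of_natDegree_lt_card_of_eval_eq_zero _ ht hval ?_
    rw [natDegree_sub_C, Fintype.card_fin]
    omega
  rw [sub_eq_zero] at hzero
  refine hc0 ?_
  rw [hzero]
  simp [polyFunctional]

/-- The vertices of the convex hull of a cyclic polytope and its reflection. -/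
def reflectVertex (d : ℕ) {n : ℕ} (t : Fin (n + 1) → ℝ) (lam : ℝ) (p : Fin 2 × Fin (n + 1)) :
    Fin (d + 1) → ℝ :=
  momentPoint (d + 1) (t p.2) +
    if p.1 = 0 then 0 else (lam - 2 * t p.2 ^ (d + 1)) • Pi.single (Fin.last d) 1

lemma range_reflectVertex (d : ℕ) {n : ℕ} (t : Fin (n + 1) → ℝ) (lam : ℝ) :
    range (reflectVertex d t lam) =
      (range fun i => fun j : Fin (d + 1) => t i ^ (j.val + 1)) ∪
        range fun i => fun j : Fin (d + 1) =>
          if j.val = d then lam - t i ^ (d + 1) else t i ^ (j.val + 1) := by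
  have h0 : ∀ i, reflectVertex d t lam (0, i) = fun j : Fin (d + 1) => t i ^ (j.val + 1) := by
    intro i
    simp [reflectVertex, momentPoint, funext_iff]
  have h1 : ∀ i, reflectVertex d t lam (1, i) = fun j : Fin (d + 1) =>
      if j.val = d then lam - t i ^ (d + 1) else t i ^ (j.val + 1) := by
    intro i
    ext j
    have hj : j = Fin.last d ↔ j.val = d := by simp [Fin.ext_iff]
    simp only [reflectVertex, momentPoint, Pi.add_apply, Pi.smul_apply, Pi.single_apply, hj,
      one_ne_zero, if_false, smul_eq_mul]
    split_ifs with h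
    · rw [h]; ring
    · ring
  ext x
  simp only [mem_range, mem_union, Prod.exists, Fin.exists_fin_two, h0, h1]

lemma polyFunctional_reflectVertex {d n : ℕ} {t : Fin (n + 1) → ℝ} {lam : ℝ} {f : ℝ[X]}
    (hf : f.natDegree ≤ d + 1) (p : Fin 2 × Fin (n + 1)) :
    polyFunctional (d + 1) f (reflectVertex d t lam p) = f.eval (t p.2) - f.coeff 0 +
      if p.1 = 0 then 0 else (lam - 2 * t p.2 ^ (d + 1)) * f.coeff (d + 1) := by
  rw [reflectVertex, map_add, polyFunctional_momentPoint hf]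
  split_ifs
  · simp
  · simp [polyFunctional, Pi.single_apply]

/-- A product of two index sets is the set of maximizers of a linear functional as soon as there is
a polynomial that, suitably modified on the reflected copy, attains its minimum exactly there. -/
lemma exists_maximizers_reflectVertex {d n : ℕ} {t : Fin (n + 1) → ℝ} {lam : ℝ} {f : ℝ[X]}
    (hf : f.natDegree ≤ d + 1) (m : ℝ) {A : Set (Fin 2 × Fin (n + 1))} (hA : A.Nonempty)
    (hmem : ∀ p ∈ A, f.eval (t p.2) +
      (if p.1 = 0 then 0 else (lam - 2 * t p.2 ^ (d + 1)) * f.coeff (d + 1)) = m)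
    (hnotMem : ∀ p ∉ A, m < f.eval (t p.2) +
      if p.1 = 0 then 0 else (lam - 2 * t p.2 ^ (d + 1)) * f.coeff (d + 1)) :
    ∃ c, A = maximizers (reflectVertex d t lam) c := by
  obtain ⟨a, ha⟩ := hA
  have hval : ∀ p, (-polyFunctional (d + 1) f) (reflectVertex d t lam p) =
      f.coeff 0 - (f.eval (t p.2) +
        if p.1 = 0 then 0 else (lam - 2 * t p.2 ^ (d + 1)) * f.coeff (d + 1)) := by
    intro p
    rw [LinearMap.neg_apply, polyFunctional_reflectVertex hf]
    ring
  have hmax : a ∈ maximizers (reflectVertex d t lam) (-polyFunctional (d + 1) f) := by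
    intro p
    rw [hval, hval, hmem a ha]
    by_cases hp : p ∈ A
    · rw [hmem p hp]
    · linarith [hnotMem p hp]
  refine ⟨-polyFunctional (d + 1) f, Set.ext fun p => ?_⟩
  rw [mem_maximizers_iff hmax, hval, hval, hmem a ha]
  by_cases hp : p ∈ A
  · simp [hp, hmem p hp]
  · simp only [hp, false_iff]
    exact ne_of_lt (by linarith [hnotMem p hp])

/-- A finite set of points is the set of zeros, among given points, of a nonnegative monic
polynomial of any large enough even degree. -/
lemma exists_monic_nonneg {ι : Type*} [Finite ι] {t : ι → ℝ} (ht : Function.Injective t)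
    (I : Finset ι) {k : ℕ} (hI : I.card ≤ k) :
    ∃ f : ℝ[X], f.Monic ∧ f.natDegree = 2 * k ∧ (∀ i ∈ I, f.eval (t i) = 0) ∧
      ∀ i ∉ I, 0 < f.eval (t i) := by
  obtain ⟨s, hs⟩ := (finite_range t).exists_notMem
  have hmonic : (∏ i ∈ I, (X - C (t i))).Monic := monic_prod_X_sub_C _ _
  have hmonic' : ((X - C s) ^ (k - I.card)).Monic := (monic_X_sub_C s).pow _
  refine ⟨((∏ i ∈ I, (X - C (t i))) * (X - C s) ^ (k - I.card)) ^ 2, (hmonic.mul hmonic').pow 2,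
    ?_, fun i hi => ?_, fun i hi => ?_⟩
  · rw [(hmonic.mul hmonic').natDegree_pow, hmonic.natDegree_mul hmonic',
      (monic_X_sub_C s).natDegree_pow, natDegree_prod_of_monic _ _ fun i _ => monic_X_sub_C _]
    simp
    omega
  · rw [eval_pow, eval_mul, eval_prod, Finset.prod_eq_zero hi (by simp)]
    simp
  · rw [eval_pow]
    refine sq_pos_of_ne_zero ?_
    rw [eval_mul, eval_prod, eval_pow]
    refine mul_ne_zero (Finset.prod_ne_zero_iff.2 fun j hj => ?_) (pow_ne_zero _ ?_)
    · rw [eval_sub, eval_X, eval_C, sub_ne_zero]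
      exact fun h => hi (ht h ▸ hj)
    · rw [eval_sub, eval_X, eval_C, sub_ne_zero]
      exact fun h => hs ⟨i, h⟩

lemma exists_eq_maximizers_reflectVertex {k n : ℕ} {t : Fin (n + 1) → ℝ}
    (ht : Function.Injective t) {lam : ℝ} (hlam : ∀ i, 2 * t i ^ (2 * k + 2) < lam) :
    ∀ A ∈ prismFaces (Fin (n + 1)) k, ∃ c, A = maximizers (reflectVertex (2 * k + 1) t lam) c := by
  rintro _ ⟨J, I, hJ, hI, hcard, rfl⟩
  have hne : ((J : Set (Fin 2)) ×ˢ (I : Set (Fin (n + 1)))).Nonempty := Set.Nonempty.prod hJ hI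
  rcases Finset.eq_of_nonempty_fin_two J hJ with rfl | rfl | rfl
  · obtain ⟨f, hmonic, hdeg, hzero, hpos⟩ := exists_monic_nonneg ht I (k := k + 1)
      (by rw [Finset.card_singleton] at hcard; omega)
    have hcoeff : f.coeff (2 * k + 1 + 1) = 1 := by
      rw [← hmonic.coeff_natDegree, hdeg]; rfl
    refine exists_maximizers_reflectVertex (d := 2 * k + 1) (f := f) hdeg.le 0 hne ?_ ?_ <;> rintro ⟨j, i⟩ hp <;>
      have hi := hlam i <;> rw [hcoeff]
    · obtain ⟨hj, hi⟩ : j = 0 ∧ i ∈ I := by simpa using hp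
      simp [hj, hzero i hi]
    · have hp : j = 0 → i ∉ I := by simpa using hp
      by_cases hj : j = 0
      · simpa [hj] using hpos i (hp hj)
      · have : 0 ≤ f.eval (t i) := by
          by_cases hiI : i ∈ I
          · exact (hzero i hiI).ge
          · exact (hpos i hiI).le
        simp only [hj, if_false]
        linarith
  · obtain ⟨f, hmonic, hdeg, hzero, hpos⟩ := exists_monic_nonneg ht I (k := k + 1)
      (by rw [Finset.card_singleton] at hcard; omega)
    have hcoeff : (f - C 2 * X ^ (2 * k + 2)).coeff (2 * k + 1 + 1) = -1 := by
      have : f.coeff (2 * k + 2) = 1 := by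
        rw [← hmonic.coeff_natDegree, hdeg]; rfl
      rw [coeff_sub, coeff_C_mul, coeff_X_pow_self, this]
      norm_num
    have hdeg' : (f - C 2 * X ^ (2 * k + 2)).natDegree ≤ 2 * k + 1 + 1 :=
      
      (natDegree_sub_le_of_le hdeg.le (natDegree_C_mul_X_pow_le _ _)).trans (max_self _).le
    have heval : ∀ i, (f - C 2 * X ^ (2 * k + 2)).eval (t i) =
        f.eval (t i) - 2 * t i ^ (2 * k + 2) := by
      intro i
      simp
    refine exists_maximizers_reflectVertex (d := 2 * k + 1) hdeg' (-lam) hne ?_ ?_ <;> rintro ⟨j, i⟩ hp <;>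
      have hi := hlam i <;> rw [hcoeff, heval]
    · obtain ⟨hj, hi⟩ : j = 1 ∧ i ∈ I := by simpa using hp
      simp only [hj, one_ne_zero, if_false, hzero i hi]
      ring
    · have hp : j = 1 → i ∉ I := by simpa using hp
      by_cases hj : j = 0
      · have : 0 ≤ f.eval (t i) := by
          by_cases hiI : i ∈ I
          · exact (hzero i hiI).ge
          · exact (hpos i hiI).le
        simp only [hj, if_true]
        linarith
      · have := hpos i (hp (by omega))
        simp only [hj, if_false]
        linarith
  · obtain ⟨f, -, hdeg, hzero, hpos⟩ := exists_monic_nonneg ht I (k := k)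
      (by rw [Finset.card_univ, Fintype.card_fin] at hcard; omega)
    have hcoeff : f.coeff (2 * k + 1 + 1) = 0 := coeff_eq_zero_of_natDegree_lt (by omega)
    refine exists_maximizers_reflectVertex (d := 2 * k + 1) (f := f) (by omega) 0 hne ?_ ?_ <;>
      rintro ⟨j, i⟩ hp <;> simp only [hcoeff, mul_zero, ite_self, add_zero]
    · exact hzero i (by simpa using hp)
    · exact hpos i (by simpa using hp)

end ReflectedCyclic

/-- Proposition `reflect`. For `k ≥ 0`, `n ≥ 2k+2` and all sufficiently
large `λ`, the convex hull of the two copies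
`{(t_i, …, t_i^{2k+2})}` and `{(t_i, …, t_i^{2k+1}, λ - t_i^{2k+2})}` of the cyclic polytope
is a `(k,(1,n))`-PSN polytope of dimension `2k+2`. -/
theorem statement0 (k n : ℕ) (hn : 2 * k + 2 ≤ n) (t : Fin (n + 1) → ℝ) (ht : StrictMono t) :
    ∃ lam0 : ℝ, ∀ lam : ℝ, lam0 ≤ lam →
      polyDim (convexHull ℝ
          ((Set.range fun i : Fin (n + 1) => fun j : Fin (2 * k + 2) => t i ^ (j.val + 1)) ∪
           (Set.range fun i : Fin (n + 1) => fun j : Fin (2 * k + 2) =>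
              if j.val = 2 * k + 1 then lam - t i ^ (2 * k + 2) else t i ^ (j.val + 1))))
        = 2 * k + 2 ∧
      IsPSN k ![1, n] (convexHull ℝ
          ((Set.range fun i : Fin (n + 1) => fun j : Fin (2 * k + 2) => t i ^ (j.val + 1)) ∪
           (Set.range fun i : Fin (n + 1) => fun j : Fin (2 * k + 2) =>
              if j.val = 2 * k + 1 then lam - t i ^ (2 * k + 2) else t i ^ (j.val + 1)))) := by
  refine ⟨1 + ∑ i, 2 * t i ^ (2 * k + 2), fun lam hlam => ?_⟩
  have hpos : ∀ i, 2 * t i ^ (2 * k + 2) < lam := by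
    intro i
    have h : ∀ j ∈ Finset.univ, 0 ≤ 2 * t j ^ (2 * k + 2) := fun j _ =>
      mul_nonneg zero_le_two (Even.pow_nonneg ⟨k + 1, by ring⟩ _)
    linarith [Finset.single_le_sum h (Finset.mem_univ i)]
  rw [← range_reflectVertex (2 * k + 1) t lam]
  refine ⟨?_, ⟨(finite_range _).toFinset, by rw [Finite.coe_toFinset]⟩, ?_⟩
  · have htop : vectorSpan ℝ (range (reflectVertex (2 * k + 1) t lam)) = ⊤ := by
      rw [eq_top_iff, ← vectorSpan_momentPoint_eq_top hn ht.injective, range_reflectVertex]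
      exact vectorSpan_mono ℝ subset_union_left
    rw [polyDim_convexHull, htop, finrank_top, Module.finrank_fin_fun]
  · obtain ⟨e⟩ := nonempty_orderIso_skel_prodSimplex k n
    obtain ⟨e'⟩ := nonempty_orderIso_skel_prism (v := reflectVertex (2 * k + 1) t lam)
      (w := Pi.single (Fin.last _) 1) (s := fun i => lam - 2 * t i ^ (2 * k + 2))
      (fun i => sub_pos.2 (hpos i)) (fun i => by simp [reflectVertex])
      (exists_eq_maximizers_reflectVertex ht.injective hpos)
    exact ⟨e'.symm.trans e⟩
end

section
/- Let k ≥ 0, r ≥ 1 and n_1,…,n_r ≥ 1 be integers. Then there exist pairwise disjoint finite sets I_1,…,I_r ⊂ ℝ with |I_i| = n_i + 1 for all i such that the polytope P := conv{w_a : a ∈ I_1×⋯×I_r} ⊆ ℝ^{2k+r+1}, where w_a := (a_1, …, a_r, Σ_{i∈[r]} a_i², Σ_{i∈[r]} a_i³, …, Σ_{i∈[r]} a_i^{2k+2}) for a = (a_1,…,a_r), is (k,n̄)-PPSN for n̄ = (n_1,…,n_r): its k-skeleton is combinatorially equivalent to that of Δ_{n̄} = Δ_{n_1}×⋯×Δ_{n_r},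 and P is the image under a linear map of a polytope whose poset of all nonempty faces is order-isomorphic to that of Δ_{n̄}. -/
open Set

/-- The point `w_a = (a_1, …, a_r, Σ a_i², Σ a_i³, …, Σ a_i^{2k+2}) ∈ ℝ^{2k+r+1}`. -/
noncomputable def wvec (k r : ℕ) (a : Fin r → ℝ) : Fin (2 * k + r + 1) → ℝ :=
  fun j => if h : j.val < r then a ⟨j.val, h⟩ else ∑ i, (a i) ^ (j.val - r + 2)

section RolleCounting

open Polynomial

open Classical in
/-- Rolle's theorem on an order-connected set: the number of roots lying in it, counted with
multiplicity, is at most one more than the number of such roots of the derivative. -/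
theorem card_filter_roots_le_derivative (p : ℝ[X]) {K : Set ℝ} (hK : K.OrdConnected) :
    (p.roots.filter (· ∈ K)).card ≤ (p.derivative.roots.filter (· ∈ K)).card + 1 := by
  rcases eq_or_ne (derivative p) 0 with hp' | hp'
  · rw [eq_C_of_derivative_eq_zero hp']
    simp
  have hp : p ≠ 0 := ne_of_apply_ne derivative (by rwa [derivative_zero])
  set M := p.roots.filter (· ∈ K) with hM
  set M' := p.derivative.roots.filter (· ∈ K) with hM'
  have hdistinct : M.toFinset.card ≤ (M'.toFinset \ M.toFinset).card + 1 := by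
    refine Finset.card_le_sdiff_of_interleaved fun x hx y hy hxy _ => ?_
    rw [Multiset.mem_toFinset, Multiset.mem_filter, mem_roots hp] at hx hy
    obtain ⟨z, hz1, hz2⟩ := exists_deriv_eq_zero hxy p.continuousOn (hx.1.trans hy.1.symm)
    refine ⟨z, ?_, hz1⟩
    rw [Multiset.mem_toFinset, Multiset.mem_filter, mem_roots hp', IsRoot, ← p.deriv]
    exact ⟨hz2, hK.out hx.2 hy.2 (Ioo_subset_Icc_self hz1)⟩
  have hcount : ∀ x ∈ M.toFinset, M.count x ≤ M'.count x + 1 := by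
    intro x hx
    rw [Multiset.mem_toFinset, Multiset.mem_filter] at hx
    have := rootMultiplicity_sub_one_le_derivative_rootMultiplicity p x
    rw [hM, hM', Multiset.count_filter_of_pos (p := (· ∈ K)) hx.2,
      Multiset.count_filter_of_pos (p := (· ∈ K)) hx.2, count_roots, count_roots]
    omega
  calc M.card = ∑ x ∈ M.toFinset, M.count x := (Multiset.toFinset_sum_count_eq _).symm
    _ ≤ ∑ x ∈ M.toFinset, (M'.count x + 1) := Finset.sum_le_sum hcount
    _ = (∑ x ∈ M.toFinset, M'.count x) + M.toFinset.card := by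
      simp [Finset.sum_add_distrib]
    _ ≤ (∑ x ∈ M.toFinset, M'.count x) + ((∑ x ∈ M'.toFinset \ M.toFinset, M'.count x) + 1) := by
      refine Nat.add_le_add_left (hdistinct.trans (Nat.add_le_add_right ?_ 1)) _
      rw [Finset.card_eq_sum_ones]
      refine Finset.sum_le_sum fun x hx => ?_
      rw [Nat.succ_le_iff, Multiset.count_pos, ← Multiset.mem_toFinset]
      exact (Finset.mem_sdiff.1 hx).1
    _ = M'.card + 1 := by
      rw [← add_assoc, ← Finset.sum_union Finset.disjoint_sdiff, Finset.union_sdiff_self_eq_union,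
        ← Multiset.toFinset_sum_count_eq M', ← Finset.sum_subset Finset.subset_union_right]
      intro x _ hx₂
      simpa only [Multiset.mem_toFinset, Multiset.count_eq_zero] using hx₂

open Classical in
theorem card_le_card_filter_roots_derivative_derivative {F : ℝ[X]} {K : Set ℝ}
    (hK : K.OrdConnected) {M : Multiset ℝ} (hM : M ≤ F.roots) (hMK : ∀ a ∈ M, a ∈ K) :
    M.card ≤ (F.derivative.derivative.roots.filter (· ∈ K)).card + 2 := by
  have h1 := card_filter_roots_le_derivative F hK
  have h2 := card_filter_roots_le_derivative F.derivative hK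
  have h3 : M.card ≤ (F.roots.filter (· ∈ K)).card :=
    Multiset.card_le_card (Multiset.le_filter.2 ⟨hM, hMK⟩)
  omega

open Classical in
theorem sum_filter_le {ι α : Type*} [Fintype ι] {K : ι → Set α}
    (hK : Pairwise (Function.onFun Disjoint K)) (M : Multiset α) :
    ∑ i, M.filter (· ∈ K i) ≤ M := by
  rw [Multiset.le_iff_count]
  intro a
  rw [Multiset.count_sum']
  simp only [Multiset.count_filter]
  by_cases h : ∃ i, a ∈ K i
  · obtain ⟨i, hi⟩ := h
    rw [Finset.sum_eq_single i, if_pos hi]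
    · intro j _ hj
      rw [if_neg]
      exact fun hj' => Set.disjoint_left.1 (hK hj) hj' hi
    · simp
  · rw [Finset.sum_eq_zero]
    · exact Nat.zero_le _
    · intro i _
      rw [if_neg]
      exact fun hi => h ⟨i, hi⟩

/-- If an even number of points lie in an interval not containing `x`, then `∏ (x - a)` over these
points is positive. -/
theorem prod_sub_pos_of_even_card {M : Multiset ℝ} {l u x : ℝ} (hM : ∀ a ∈ M, a ∈ Icc l u)
    (hx : x ∉ Icc l u) (hcard : Even M.card) : 0 < (M.map fun a => x - a).prod := by
  rcases lt_or_ge x l with h | h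
  · have : (M.map fun a => x - a) = (M.map fun a => a - x).map Neg.neg := by simp
    rw [this, Multiset.prod_map_neg]
    simp only [Multiset.card_map, hcard.neg_one_pow, one_mul]
    refine Multiset.prod_induction (0 < ·) _ (fun _ _ => mul_pos) one_pos fun y hy => ?_
    obtain ⟨a, ha, rfl⟩ := Multiset.mem_map.1 hy
    linarith [(hM a ha).1]
  · have h' : u < x := by
      by_contra h'
      exact hx ⟨h, not_lt.1 h'⟩
    refine Multiset.prod_induction (0 < ·) _ (fun _ _ => mul_pos) one_pos fun y hy => ?_
    obtain ⟨a, ha, rfl⟩ := Multiset.mem_map.1 hy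
    linarith [(hM a ha).2]

/-- A polynomial with a double zero at `m` and positive second derivative on `(m, b)` is
positive at `b`. -/
theorem eval_pos_of_double_root {G : ℝ[X]} {m b : ℝ} (hmb : m < b) (h0 : G.eval m = 0)
    (h1 : G.derivative.eval m = 0)
    (h2 : ∀ x ∈ Ioo m b, 0 < G.derivative.derivative.eval x) : 0 < G.eval b := by
  have hG' : StrictMonoOn (fun x => G.derivative.eval x) (Icc m b) :=
    strictMonoOn_of_deriv_pos (convex_Icc m b) G.derivative.continuousOn fun x hx => by
      rw [Polynomial.deriv]
      exact h2 x (by rwa [interior_Icc] at hx)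
  have hG : StrictMonoOn (fun x => G.eval x) (Icc m b) :=
    strictMonoOn_of_deriv_pos (convex_Icc m b) G.continuousOn fun x hx => by
      rw [interior_Icc] at hx
      rw [Polynomial.deriv, ← h1]
      exact hG' (left_mem_Icc.2 hmb.le) (Ioo_subset_Icc_self hx) hx.1
  simpa [h0] using hG (left_mem_Icc.2 hmb.le) (right_mem_Icc.2 hmb.le) hmb

/-- A nonzero polynomial vanishing doubly on a finite set `S` has `S`, with every
element repeated twice, among its roots. -/
theorem two_nsmul_val_le_roots {F : ℝ[X]} (hF : F ≠ 0) {S : Finset ℝ}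
    (h0 : ∀ a ∈ S, F.eval a = 0) (h1 : ∀ a ∈ S, F.derivative.eval a = 0) :
    2 • S.val ≤ F.roots := by
  classical
  rw [Multiset.le_iff_count]
  intro a
  rw [Multiset.count_nsmul, count_roots]
  by_cases ha : a ∈ S
  · have := (one_lt_rootMultiplicity_iff_isRoot hF).2 ⟨h0 a ha, h1 a ha⟩
    have := Multiset.nodup_iff_count_le_one.1 S.nodup a
    omega
  · rw [Multiset.count_eq_zero_of_notMem (by simpa using ha)]
    simp


/-- There are more coefficients in a family `X² u + α_i X + c_i` with `deg u ≤ 2k` than there are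
conditions in prescribing double zeros at `k + r` points. -/
theorem exists_double_zeros {ι : Type*} [Fintype ι] {k : ℕ} {S : ι → Finset ℝ}
    (hcard : ∑ i, (S i).card = k + Fintype.card ι) :
    ∃ (u : ℝ[X]) (α c : ι → ℝ), u.natDegree ≤ 2 * k ∧ (u ≠ 0 ∨ α ≠ 0 ∨ c ≠ 0) ∧
      ∀ i, ∀ a ∈ S i, (X ^ 2 * u + C (α i) * X + C (c i)).eval a = 0 ∧
        (X ^ 2 * u + C (α i) * X + C (c i)).derivative.eval a = 0 := by
  let T : (degreeLT ℝ (2 * k + 1) × (ι → ℝ) × (ι → ℝ)) →ₗ[ℝ] ((i : ι) → S i → ℝ × ℝ) :=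
    { toFun := fun w i a =>
        ((X ^ 2 * (w.1 : ℝ[X]) + C (w.2.1 i) * X + C (w.2.2 i)).eval a.1,
          (X ^ 2 * (w.1 : ℝ[X]) + C (w.2.1 i) * X + C (w.2.2 i)).derivative.eval a.1)
      map_add' := fun v w => by
        ext i a <;> simp <;> ring
      map_smul' := fun t w => by
        ext i a <;> simp <;> ring }
  have : FiniteDimensional ℝ (degreeLT ℝ (2 * k + 1)) :=
    (degreeLTEquiv ℝ (2 * k + 1)).symm.finiteDimensional
  have hT : LinearMap.ker T ≠ ⊥ := by
    apply LinearMap.ker_ne_bot_of_finrank_lt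
    simp only [Module.finrank_pi_fintype, Module.finrank_prod, Module.finrank_self,
      (degreeLTEquiv ℝ (2 * k + 1)).finrank_eq, Finset.sum_const, Finset.card_univ,
      Fintype.card_coe, Fintype.card_fin, smul_eq_mul, ← Finset.sum_mul, hcard]
    omega
  obtain ⟨⟨u, α, c⟩, hw, hne⟩ := (Submodule.ne_bot_iff _).1 hT
  refine ⟨u, α, c, ?_, ?_, fun i a ha => ?_⟩
  · exact natDegree_le_iff_degree_le.2 (Order.le_of_lt_succ (mem_degreeLT.1 u.2))
  · by_contra! h
    exact hne (by ext1; exacts [Subtype.ext h.1, by ext1; exacts [h.2.1, h.2.2]])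
  · have := congrFun (congrFun (LinearMap.mem_ker.1 hw) i) ⟨a, ha⟩
    exact Prod.ext_iff.1 this

theorem eq_zero_of_derivative_derivative_X_sq_mul {u : ℝ[X]}
    (h : (X ^ 2 * u).derivative.derivative = 0) : u = 0 := by
  ext n
  have := congrArg (fun p => coeff p n) h
  simp only [coeff_derivative, coeff_zero] at this
  rw [show n + 1 + 1 = n + 2 from rfl, coeff_X_pow_mul] at this
  have h1 : (n : ℝ) + 1 + 1 ≠ 0 := by positivity
  have h2 : (n : ℝ) + 1 ≠ 0 := by positivity
  simpa [h1, h2] using this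

theorem natDegree_derivative_derivative_X_sq_mul_le {u : ℝ[X]} {d : ℕ} (hu : u.natDegree ≤ d) :
    (X ^ 2 * u).derivative.derivative.natDegree ≤ d := by
  have h1 := natDegree_derivative_le (X ^ 2 * u).derivative
  have h2 := natDegree_derivative_le (X ^ 2 * u)
  have h3 : (X ^ 2 * u).natDegree ≤ 2 + u.natDegree := 
    natDegree_mul_le_of_le (natDegree_X_pow_le 2) le_rfl
  omega

/-- Outside of the intervals `[l_i, m_i]`, a polynomial which has an even number of roots in each
of them, and no further complex root, has the sign of its leading coefficient. -/
theorem leadingCoeff_mul_eval_pos {ι : Type*} [Fintype ι] {p : ℝ[X]} (hp : p ≠ 0)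
    {l m : ι → ℝ} {M : ι → Multiset ℝ} (hroots : p.roots = ∑ i, M i)
    (hdeg : p.roots.card = p.natDegree) (hM : ∀ i, ∀ a ∈ M i, a ∈ Icc (l i) (m i))
    (heven : ∀ i, Even (M i).card) {x : ℝ} (hx : ∀ i, x ∉ Icc (l i) (m i)) :
    0 < p.leadingCoeff * p.eval x := by
  have heval : p.eval x = p.leadingCoeff * (p.roots.map fun a => x - a).prod := by
    conv_lhs => rw [← C_leadingCoeff_mul_prod_multiset_X_sub_C hdeg]
    simp [eval_mul, eval_multiset_prod, Multiset.map_map]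
  have hprod : 0 < (p.roots.map fun a => x - a).prod := by
    rw [hroots, show ((∑ i, M i).map fun a => x - a) = ∑ i, (M i).map fun a => x - a from
      map_sum (Multiset.mapAddMonoidHom fun a => x - a) _ _, Multiset.prod_sum]
    exact Finset.prod_pos fun i _ => prod_sub_pos_of_even_card (hM i) (hx i) (heven i)
  rw [heval, ← mul_assoc]
  exact mul_pos (mul_self_pos.2 (leadingCoeff_ne_zero.2 hp)) hprod

/-- Let `F` vanish doubly on `S ⊆ J` and nowhere else in the order-connected set `J`. If `F` is
positive somewhere on `J`, it is positive on `J \ S`. -/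
theorem eval_pos_of_roots_eq {F : ℝ[X]} {J : Set ℝ} (hJ : J.OrdConnected) {S : Finset ℝ}
    (hF : F ≠ 0) (hS : 2 • S.val ≤ F.roots) (hmax : ∀ y ∈ J, ¬ y ::ₘ (2 • S.val) ≤ F.roots)
    {s b x : ℝ} (hb : b ∈ J) (hbS : b ∉ S) (hFb : 0 < s * F.eval b) (hx : x ∈ J) (hxS : x ∉ S) :
    0 < s * F.eval x := by
  obtain ⟨g, hg⟩ := (Multiset.prod_X_sub_C_dvd_iff_le_roots hF _).2 hS
  have hsq : ∀ y, F.eval y = (∏ a ∈ S, (y - a)) ^ 2 * g.eval y := by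
    intro y
    conv_lhs => rw [hg]
    simp [eval_mul, Multiset.map_nsmul, Multiset.prod_nsmul, eval_prod]
  have hpos : ∀ y, y ∉ S → 0 < (∏ a ∈ S, (y - a)) ^ 2 := by
    intro y hy
    refine sq_pos_iff.2 (Finset.prod_ne_zero_iff.2 fun a ha => ?_)
    rw [sub_ne_zero]
    rintro rfl
    exact hy ha
  have hsF : ∀ y, s * F.eval y = (∏ a ∈ S, (y - a)) ^ 2 * (s * g.eval y) := by
    intro y; rw [hsq]; ring
  rw [hsF] at hFb ⊢
  have hgb := (mul_pos_iff_of_pos_left (hpos b hbS)).1 hFb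
  refine mul_pos (hpos x hxS) ?_
  by_contra! hgx
  have hcont : ContinuousOn (fun y => s * g.eval y) (uIcc x b) :=
    (continuous_const.mul g.continuous).continuousOn
  obtain ⟨y, hy, hgy⟩ := intermediate_value_uIcc hcont
    (Icc_subset_uIcc (α := ℝ) ⟨hgx, hgb.le⟩)
  have hs : s ≠ 0 := left_ne_zero_of_mul hgb.ne'
  have hgy0 : g.IsRoot y := by simpa [hs] using hgy
  refine hmax y (hJ.uIcc_subset hx hb hy) ((Multiset.prod_X_sub_C_dvd_iff_le_roots hF _).1 ?_)
  rw [Multiset.map_cons, Multiset.prod_cons, hg, mul_comm]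
  exact mul_dvd_mul_left _ (dvd_iff_isRoot.2 hgy0)

/-- Given finite sets `S_i` in disjoint order-connected sets `J_i`, with `∑ |S_i| = k + r`, there
are polynomials of degree at most `2k + 2`, differing from each other by affine functions only,
such that the `i`-th one is nonnegative on `J_i` and vanishes there exactly on `S_i`. -/
theorem exists_supporting_polynomials {ι : Type*} [Fintype ι] {k : ℕ} {J : ι → Set ℝ}
    (hJ : ∀ i, (J i).OrdConnected) (hdisj : Pairwise (Function.onFun Disjoint J))
    {S : ι → Finset ℝ} (hne : ∀ i, (S i).Nonempty) (hSJ : ∀ i, ∀ a ∈ S i, a ∈ J i)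
    {b : ι → ℝ} (hb : ∀ i, b i ∈ J i) (hbS : ∀ i, ∀ a ∈ S i, a < b i)
    (hcard : ∑ i, (S i).card = k + Fintype.card ι) :
    ∃ (u : ℝ[X]) (α c : ι → ℝ), u.natDegree ≤ 2 * k ∧
      ∀ i, (∀ x ∈ S i, (X ^ 2 * u + C (α i) * X + C (c i)).eval x = 0) ∧
        ∀ x ∈ J i, x ∉ S i → 0 < (X ^ 2 * u + C (α i) * X + C (c i)).eval x := by
  classical
  obtain ⟨u, α, c, hu, hnz, hzero⟩ := exists_double_zeros hcard
  set F : ι → ℝ[X] := fun i => X ^ 2 * u + C (α i) * X + C (c i) with hF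
  set p : ℝ[X] := (X ^ 2 * u).derivative.derivative with hp
  have hFp : ∀ i, (F i).derivative.derivative = p := by
    intro i; simp [hF, hp]
  have hp0 : p ≠ 0 := by
    intro hp0
    have hu0 := eq_zero_of_derivative_derivative_X_sq_mul hp0
    have hα : α = 0 := by
      ext i
      obtain ⟨a, ha⟩ := hne i
      simpa [hu0] using (hzero i a ha).2
    have hc : c = 0 := by
      ext i
      obtain ⟨a, ha⟩ := hne i
      simpa [hu0, hα] using (hzero i a ha).1
    simp [hu0, hα, hc] at hnz
  have hF0 : ∀ i, F i ≠ 0 := by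
    intro i h
    apply hp0
    rw [← hFp i, h]
    simp
  have hSroots : ∀ i, 2 • (S i).val ≤ (F i).roots := fun i =>
    two_nsmul_val_le_roots (hF0 i) (fun a ha => (hzero i a ha).1) fun a ha => (hzero i a ha).2
  have hcount : ∀ i (K : Set ℝ), K.OrdConnected → (∀ a ∈ S i, a ∈ K) →
      2 * (S i).card ≤ (p.roots.filter (· ∈ K)).card + 2 := by
    intro i K hK hSK
    have := card_le_card_filter_roots_derivative_derivative hK (hSroots i)
      (fun a ha => hSK a (by simpa using ha))
    simpa [hFp i] using this
  have hdeg : p.roots.card ≤ p.natDegree := p.card_roots'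
  have hdeg2 : p.natDegree ≤ 2 * k := natDegree_derivative_derivative_X_sq_mul_le hu
  have hcard2 : ∑ i, 2 * (S i).card = 2 * k + 2 * Fintype.card ι := by
    rw [← Finset.mul_sum, hcard]; ring
  have htotal : ∀ K : ι → Set ℝ, ∑ i, ((p.roots.filter (· ∈ K i)).card + 2) =
      (∑ i, p.roots.filter (· ∈ K i)).card + 2 * Fintype.card ι := by
    intro K
    simp [Finset.sum_add_distrib, mul_comm]
  have hlarge : ∀ K : ι → Set ℝ, (∀ i, (K i).OrdConnected) →
      Pairwise (Function.onFun Disjoint K) → (∀ i, ∀ a ∈ S i, a ∈ K i) →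
      p.roots = ∑ i, p.roots.filter (· ∈ K i) ∧ p.roots.card = p.natDegree ∧
        ∀ i, (p.roots.filter (· ∈ K i)).card + 2 = 2 * (S i).card := by
    intro K hK hKd hSK
    have hle := sum_filter_le hKd p.roots
    have hle' := Multiset.card_le_card hle
    have hsum := Finset.sum_le_sum fun i (_ : i ∈ Finset.univ) => hcount i (K i) (hK i) (hSK i)
    rw [htotal, hcard2] at hsum
    refine ⟨(Multiset.eq_of_le_of_card_le hle (by omega)).symm, by omega, fun i => ?_⟩
    refine ((Finset.sum_eq_sum_iff_of_le fun i _ => hcount i (K i) (hK i) (hSK i)).1 ?_ i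
      (Finset.mem_univ i)).symm
    rw [htotal, hcard2]
    omega
  set l : ι → ℝ := fun i => (S i).min' (hne i)
  set m : ι → ℝ := fun i => (S i).max' (hne i)
  obtain ⟨K, hK⟩ : ∃ K : ι → Set ℝ, ∀ i, K i = Icc (l i) (m i) := ⟨_, fun _ => rfl⟩
  have hKJ : ∀ i, K i ⊆ J i := fun i => hK i ▸
    (hJ i).out (hSJ i _ (Finset.min'_mem _ _)) (hSJ i _ (Finset.max'_mem _ _))
  obtain ⟨hroots, hpdeg, hKcard⟩ := hlarge K (fun i => hK i ▸ ordConnected_Icc)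
    (fun i j hij => (hdisj hij).mono (hKJ i) (hKJ j))
    (fun i a ha => hK i ▸ ⟨Finset.min'_le _ _ ha, Finset.le_max' _ _ ha⟩)
  obtain ⟨-, -, hJcard⟩ := hlarge J hJ hdisj hSJ
  set s := p.leadingCoeff
  have hsign : ∀ i, ∀ x ∈ J i, m i < x → 0 < s * p.eval x := by
    intro i x hx hmx
    refine leadingCoeff_mul_eval_pos hp0 hroots hpdeg
      (fun i a ha => hK i ▸ (Multiset.mem_filter.1 ha).2) (fun i => ?_) fun j hj => ?_
    · have := hKcard i
      exact ⟨(S i).card - 1, by omega⟩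
    · rcases eq_or_ne i j with rfl | hij
      · exact absurd hj.2 (not_le.2 hmx)
      · exact Set.disjoint_left.1 (hdisj hij) hx (hKJ j (hK j ▸ hj))
  have hbpos : ∀ i, 0 < s * (F i).eval (b i) := by
    intro i
    have hm : m i ∈ S i := Finset.max'_mem _ _
    have := eval_pos_of_double_root (G := C s * F i) (hbS i _ hm)
      (by rw [eval_mul, (hzero i _ hm).1, mul_zero])
      (by rw [derivative_C_mul, eval_mul, (hzero i _ hm).2, mul_zero])
      (fun x hx => by
        rw [derivative_C_mul, derivative_C_mul, hFp, eval_mul, eval_C]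
        exact hsign i x ((hJ i).out (hSJ i _ hm) (hb i) (Ioo_subset_Icc_self hx)) hx.1)
    simpa using this
  refine ⟨C s * u, fun i => s * α i, fun i => s * c i, (natDegree_C_mul_le _ _).trans hu,
    fun i => ?_⟩
  have hscale : ∀ x, (X ^ 2 * (C s * u) + C (s * α i) * X + C (s * c i)).eval x =
      s * (F i).eval x := by
    intro x; simp [hF]; ring
  simp only [hscale]
  refine ⟨fun x hx => by rw [(hzero i x hx).1, mul_zero], fun x hx hxS => ?_⟩
  refine eval_pos_of_roots_eq (hJ i) (hF0 i) (hSroots i) (fun y hy hle => ?_) (hb i)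
    (fun h => lt_irrefl _ (hbS i _ h)) (hbpos i) hx hxS
  have h1 := card_le_card_filter_roots_derivative_derivative (hJ i) hle fun a ha => by
    rcases Multiset.mem_cons.1 ha with rfl | ha
    · exact hy
    · exact hSJ i a (by simpa using ha)
  have h2 := hJcard i
  rw [hFp] at h1
  simp only [Multiset.card_cons, Multiset.card_nsmul, Finset.card_val] at h1
  omega

end RolleCounting

section Dimension

variable {E : Type*} [AddCommGroup E] [Module ℝ E] [FiniteDimensional ℝ E]
variable {E' : Type*} [AddCommGroup E'] [Module ℝ E']

theorem polyDim_mono {A B : Set E} (h : A ⊆ B) : polyDim A ≤ polyDim B :=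
  Submodule.finrank_mono (AffineSubspace.direction_le (affineSpan_mono ℝ h))

theorem polyDim_image_le (f : E →ₗ[ℝ] E') (A : Set E) : polyDim (f '' A) ≤ polyDim A := by
  unfold polyDim
  rw [direction_affineSpan, direction_affineSpan,
    show vectorSpan ℝ (f '' A) = (vectorSpan ℝ A).map f from
      (AffineMap.map_vectorSpan f.toAffineMap).symm]
  exact Submodule.finrank_map_le f _

/-- The dimension of a proper exposed face is smaller than that of any larger subset of the
polytope. -/
theorem polyDim_lt_of_isFace {P A B : Set E} (hA : IsFace P A) (hAB : A ⊂ B) (hBP : B ⊆ P) :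
    polyDim A < polyDim B := by
  obtain ⟨⟨x, hx⟩, c, hc⟩ := hA
  obtain ⟨z, hzB, hzA⟩ := Set.exists_of_ssubset hAB
  unfold polyDim
  rw [direction_affineSpan, direction_affineSpan]
  have hker : vectorSpan ℝ A ≤ LinearMap.ker c := by
    refine Submodule.span_le.2 ?_
    rintro _ ⟨y, hy, w, hw, rfl⟩
    rw [hc] at hy hw
    simpa [sub_eq_zero] using le_antisymm (hw.2 y hy.1) (hy.2 w hw.1)
  refine Submodule.finrank_lt_finrank_of_lt
    (lt_of_le_of_ne (vectorSpan_mono ℝ hAB.subset) fun heq => hzA ?_)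
  have hzx : z -ᵥ x ∈ vectorSpan ℝ A := heq ▸ vsub_mem_vectorSpan ℝ hzB (hAB.subset hx)
  have hcz : c z = c x := by simpa [sub_eq_zero] using hker hzx
  rw [hc] at hx ⊢
  exact ⟨hBP hzB, fun y hy => hcz ▸ hx.2 y hy⟩

end Dimension

section LinearEquivalence

variable {E : Type*} [AddCommGroup E] [Module ℝ E]
variable {E' : Type*} [AddCommGroup E'] [Module ℝ E']

theorem IsFace.image_linearEquiv {P F : Set E} (h : IsFace P F) (e : E ≃ₗ[ℝ] E') :
    IsFace (e '' P) (e '' F) := by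
  obtain ⟨hne, c, rfl⟩ := h
  refine ⟨hne.image e, c ∘ₗ e.symm.toLinearMap, ?_⟩
  ext z
  constructor
  · rintro ⟨x, ⟨hx, hmax⟩, rfl⟩
    refine ⟨mem_image_of_mem e hx, ?_⟩
    rintro _ ⟨y, hy, rfl⟩
    simpa using hmax y hy
  · rintro ⟨⟨x, hx, rfl⟩, hmax⟩
    refine mem_image_of_mem e ⟨hx, fun y hy => ?_⟩
    simpa using hmax _ (mem_image_of_mem e hy)

/-- A linear equivalence induces an isomorphism of face posets. -/
def facesOfImageOrderIso (e : E ≃ₗ[ℝ] E') (P : Set E) : facesOf (e '' P) ≃o facesOf P where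
  toFun F := ⟨e.symm '' F.1, by
    have h := IsFace.image_linearEquiv F.2 e.symm
    rwa [← image_comp, show e.symm ∘ e = id from funext e.symm_apply_apply, image_id] at h⟩
  invFun F := ⟨e '' F.1, IsFace.image_linearEquiv F.2 e⟩
  left_inv F := Subtype.ext <| by
    change e '' (e.symm '' F.1) = F.1
    rw [← image_comp, show e ∘ e.symm = id from funext e.apply_symm_apply, image_id]
  right_inv F := Subtype.ext <| by
    change e.symm '' (e '' F.1) = F.1
    rw [← image_comp, show e.symm ∘ e = id from funext e.symm_apply_apply, image_id]
  map_rel_iff' {F G} := image_subset_image_iff e.symm.injective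

end LinearEquivalence

section ProductOfSimplices

variable {r : ℕ} {n : Fin r → ℕ}

/-- The product of the faces of the simplices `Δ_{n i}` spanned by the vertices in `S i`. -/
def prodFace (S : (i : Fin r) → Finset (Fin (n i + 1))) :
    Set ((i : Fin r) → Fin (n i + 1) → ℝ) :=
  {x ∈ prodSimplex n | ∀ i, ∀ j ∉ S i, x i j = 0}

/-- The vertex of the product of simplices given by a choice of a vertex of each factor. -/
def prodVertex (a : (i : Fin r) → Fin (n i + 1)) : (i : Fin r) → Fin (n i + 1) → ℝ :=
  fun i => Pi.single (a i) 1

theorem prodVertex_mem (a : (i : Fin r) → Fin (n i + 1)) : prodVertex a ∈ prodSimplex n :=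
  fun i _ => single_mem_stdSimplex ℝ (a i)

theorem prodVertex_mem_prodFace {a : (i : Fin r) → Fin (n i + 1)}
    {S : (i : Fin r) → Finset (Fin (n i + 1))} : prodVertex a ∈ prodFace S ↔ ∀ i, a i ∈ S i := by
  refine ⟨fun h i => ?_, fun h => ⟨prodVertex_mem a, fun i j hj => ?_⟩⟩
  · by_contra hi
    simpa [prodVertex] using h.2 i _ hi
  · exact Pi.single_eq_of_ne (by rintro rfl; exact hj (h i)) _

theorem prodFace_nonempty {S : (i : Fin r) → Finset (Fin (n i + 1))}
    (hS : ∀ i, (S i).Nonempty) : (prodFace S).Nonempty := by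
  choose a ha using hS
  exact ⟨prodVertex a, prodVertex_mem_prodFace.2 ha⟩

theorem prodSimplex_eq_convexHull (n : Fin r → ℕ) :
    prodSimplex n = convexHull ℝ (range (prodVertex (n := n))) := by
  have : range (prodVertex (n := n)) =
      Set.univ.pi fun i => range fun j : Fin (n i + 1) => (Pi.single j 1 : Fin (n i + 1) → ℝ) := by
    ext x
    simp only [mem_range, mem_univ_pi]
    constructor
    · rintro ⟨a, rfl⟩ i
      exact ⟨a i, rfl⟩
    · intro h
      choose a ha using h
      exact ⟨a, funext ha⟩
  rw [this, convexHull_pi]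
  simp only [convexHull_rangle_single_eq_stdSimplex]
  rfl

theorem image_prodSimplex {E : Type*} [AddCommGroup E] [Module ℝ E]
    (f : ((i : Fin r) → Fin (n i + 1) → ℝ) →ₗ[ℝ] E) :
    f '' prodSimplex n = convexHull ℝ (range (f ∘ prodVertex)) := by
  rw [prodSimplex_eq_convexHull, LinearMap.image_convexHull, range_comp]

theorem isPolytope_image_prodSimplex {E : Type*} [AddCommGroup E] [Module ℝ E]
    (f : ((i : Fin r) → Fin (n i + 1) → ℝ) →ₗ[ℝ] E) : IsPolytope (f '' prodSimplex n) := by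
  classical
  refine ⟨Finset.univ.image (f ∘ prodVertex), ?_⟩
  rw [image_prodSimplex, Finset.coe_image, Finset.coe_univ, image_univ]

theorem linearMap_apply_eq_sum {E : Type*} [AddCommGroup E] [Module ℝ E]
    (f : ((i : Fin r) → Fin (n i + 1) → ℝ) →ₗ[ℝ] E) (x : (i : Fin r) → Fin (n i + 1) → ℝ) :
    f x = ∑ i, ∑ j, x i j • f (Pi.single i (Pi.single j 1)) := by
  have hx : x = ∑ i, ∑ j, x i j • (Pi.single i (Pi.single j (1 : ℝ)) :
      (i : Fin r) → Fin (n i + 1) → ℝ) := by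
    conv_lhs => rw [← Finset.univ_sum_single x]
    refine Finset.sum_congr rfl fun i _ => ?_
    conv_lhs => rw [← Finset.univ_sum_single (x i)]
    rw [← LinearMap.coe_single ℝ, map_sum]
    refine Finset.sum_congr rfl fun j _ => ?_
    rw [← map_smul, ← Pi.single_smul, smul_eq_mul, mul_one]
  conv_lhs => rw [hx]
  simp only [map_sum, map_smul]

/-- If the values of a functional at the vertices of each factor are maximal exactly on `S i`,
the face where it is maximal is the product of the faces spanned by the `S i`. -/
theorem maximal_face_eq_prodFace (c : ((i : Fin r) → Fin (n i + 1) → ℝ) →ₗ[ℝ] ℝ)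
    {S : (i : Fin r) → Finset (Fin (n i + 1))} (hS : ∀ i, (S i).Nonempty) {m : Fin r → ℝ}
    (hle : ∀ i j, c (Pi.single i (Pi.single j 1)) ≤ m i)
    (heq : ∀ i j, c (Pi.single i (Pi.single j 1)) = m i ↔ j ∈ S i) :
    {x ∈ prodSimplex n | ∀ y ∈ prodSimplex n, c y ≤ c x} = prodFace S := by
  have hgap : ∀ x ∈ prodSimplex n, ∑ i, m i - c x =
      ∑ i, ∑ j, x i j * (m i - c (Pi.single i (Pi.single j 1))) := by
    intro x hx
    rw [linearMap_apply_eq_sum c x, ← Finset.sum_sub_distrib]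
    refine Finset.sum_congr rfl fun i _ => ?_
    simp only [mul_sub, Finset.sum_sub_distrib, ← Finset.sum_mul, (hx i trivial).2, one_mul,
      smul_eq_mul]
  have hterm : ∀ x ∈ prodSimplex n, ∀ i j,
      0 ≤ x i j * (m i - c (Pi.single i (Pi.single j 1))) := fun x hx i j =>
    mul_nonneg ((hx i trivial).1 j) (sub_nonneg.2 (hle i j))
  have hmax : ∀ x ∈ prodSimplex n, c x ≤ ∑ i, m i := by
    intro x hx
    rw [← sub_nonneg, hgap x hx]
    exact Finset.sum_nonneg fun i _ => Finset.sum_nonneg fun j _ => hterm x hx i j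
  have hface : ∀ x ∈ prodFace S, c x = ∑ i, m i := by
    intro x hx
    rw [eq_comm, ← sub_eq_zero, hgap x hx.1]
    refine Finset.sum_eq_zero fun i _ => Finset.sum_eq_zero fun j _ => ?_
    by_cases hj : j ∈ S i
    · rw [(heq i j).2 hj, sub_self, mul_zero]
    · rw [hx.2 i j hj, zero_mul]
  ext x
  constructor
  · rintro ⟨hx, hxmax⟩
    refine ⟨hx, fun i j hj => ?_⟩
    obtain ⟨v, hv⟩ := prodFace_nonempty hS
    have hcx : ∑ i, m i - c x = 0 :=
      sub_eq_zero.2 (le_antisymm (hface v hv ▸ hxmax v hv.1) (hmax x hx))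
    rw [hgap x hx] at hcx
    have h1 := (Finset.sum_eq_zero_iff_of_nonneg fun i _ =>
      Finset.sum_nonneg fun j _ => hterm x hx i j).1 hcx i (Finset.mem_univ i)
    have h2 := (Finset.sum_eq_zero_iff_of_nonneg fun j _ => hterm x hx i j).1 h1 j
      (Finset.mem_univ j)
    refine (mul_eq_zero.1 h2).resolve_right fun h => hj ((heq i j).1 (sub_eq_zero.1 h).symm)
  · intro hx
    exact ⟨hx.1, fun y hy => hface x hx ▸ hmax y hy⟩

/-- Every nonempty face of a product of simplices is a product of nonempty faces. -/
theorem IsFace.exists_eq_prodFace {F : Set ((i : Fin r) → Fin (n i + 1) → ℝ)}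
    (hF : IsFace (prodSimplex n) F) :
    ∃ S : (i : Fin r) → Finset (Fin (n i + 1)), (∀ i, (S i).Nonempty) ∧ F = prodFace S := by
  obtain ⟨-, c, rfl⟩ := hF
  have hmax : ∀ i, ∃ j₀ : Fin (n i + 1), ∀ j,
      c (Pi.single i (Pi.single j 1)) ≤ c (Pi.single i (Pi.single j₀ 1)) := fun i =>
    Finite.exists_max _
  choose a ha using hmax
  refine ⟨fun i => {j | c (Pi.single i (Pi.single j 1)) = c (Pi.single i (Pi.single (a i) 1))},
    fun i => ⟨a i, by simp⟩, maximal_face_eq_prodFace c (fun i => ⟨a i, by simp⟩) ha ?_⟩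
  simp

theorem polyDim_prodFace_le {S : (i : Fin r) → Finset (Fin (n i + 1))}
    (hS : ∀ i, (S i).Nonempty) : polyDim (prodFace S) + r ≤ ∑ i, (S i).card := by
  classical
  choose a ha using hS
  let e : (i : Fin r) → Fin (n i + 1) → ((i : Fin r) → Fin (n i + 1) → ℝ) :=
    fun i j => Pi.single i (Pi.single j 1)
  let B : Finset ((i : Fin r) → Fin (n i + 1) → ℝ) :=
    (Finset.univ.sigma fun i => (S i).erase (a i)).image fun q => e q.1 q.2 - e q.1 (a q.1)
  have hspan : vectorSpan ℝ (prodFace S) ≤ Submodule.span ℝ (B : Set _) := by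
    refine Submodule.span_le.2 ?_
    rintro _ ⟨x, hx, y, hy, rfl⟩
    have hxy : x - y = ∑ i, ∑ j, (x i j - y i j) • (e i j - e i (a i)) := by
      have h := linearMap_apply_eq_sum LinearMap.id (x - y)
      simp only [LinearMap.id_apply] at h
      rw [h]
      refine Finset.sum_congr rfl fun i _ => ?_
      simp only [smul_sub, Finset.sum_sub_distrib, ← Finset.sum_smul, (hx.1 i trivial).2,
        (hy.1 i trivial).2, sub_self, zero_smul, sub_zero]
      rfl
    simp only [vsub_eq_sub]
    rw [hxy]
    refine Submodule.sum_mem _ fun i _ => Submodule.sum_mem _ fun j _ => ?_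
    by_cases hj : j ∈ S i
    · by_cases hja : j = a i
      · simp [hja]
      · refine Submodule.smul_mem _ _ (Submodule.subset_span ?_)
        exact Finset.mem_image.2 ⟨⟨i, j⟩, by simp [hj, hja], rfl⟩
    · simp [hx.2 i j hj, hy.2 i j hj]
  have h1 : polyDim (prodFace S) ≤ ∑ i, ((S i).erase (a i)).card := by
    unfold polyDim
    rw [direction_affineSpan]
    calc _ ≤ _ := Submodule.finrank_mono hspan
      _ ≤ B.card := finrank_span_finset_le_card B
      _ ≤ _ := Finset.card_image_le
      _ = _ := by simp
  have h2 : ∑ i, (S i).card = ∑ i, (((S i).erase (a i)).card + 1) :=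
    Finset.sum_congr rfl fun i _ => (Finset.card_erase_add_one (ha i)).symm
  rw [h2, Finset.sum_add_distrib]
  simpa using h1

theorem exists_prodFace_ssubset {S : (i : Fin r) → Finset (Fin (n i + 1))}
    (hS : ∀ i, (S i).Nonempty) {N : ℕ} (hcard : ∑ i, (S i).card = N + 1 + r) :
    ∃ S' : (i : Fin r) → Finset (Fin (n i + 1)), (∀ i, (S' i).Nonempty) ∧
      ∑ i, (S' i).card = N + r ∧ prodFace S' ⊂ prodFace S := by
  classical
  obtain ⟨i, hi⟩ : ∃ i, 1 < (S i).card := by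
    by_contra! h
    have := Finset.sum_le_sum fun i (_ : i ∈ Finset.univ) => h i
    simp [hcard] at this
  choose a ha using hS
  have hsub : ∀ l, Function.update S i ((S i).erase (a i)) l ⊆ S l := by
    intro l
    rcases eq_or_ne l i with rfl | hl
    · simpa using Finset.erase_subset _ _
    · simp [hl]
  refine ⟨Function.update S i ((S i).erase (a i)), fun l => ?_, ?_,
    fun x hx => ⟨hx.1, fun l j hj => hx.2 l j fun h => hj (hsub l h)⟩, fun h => ?_⟩
  · rcases eq_or_ne l i with rfl | hl
    · rw [Function.update_self, ← Finset.card_pos, Finset.card_erase_of_mem (ha l)]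
      omega
    · rw [Function.update_of_ne hl]
      exact ⟨a l, ha l⟩
  · have h1 := Finset.add_sum_erase Finset.univ (fun l => (S l).card) (Finset.mem_univ i)
    have h2 := Finset.add_sum_erase Finset.univ
      (fun l => (Function.update S i ((S i).erase (a i)) l).card) (Finset.mem_univ i)
    have h3 : ∑ l ∈ Finset.univ.erase i, (Function.update S i ((S i).erase (a i)) l).card =
        ∑ l ∈ Finset.univ.erase i, (S l).card :=
      Finset.sum_congr rfl fun l hl => by rw [Function.update_of_ne (Finset.ne_of_mem_erase hl)]
    simp only [Function.update_self, Finset.card_erase_of_mem (ha i)] at h1 h2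
    omega
  · have := prodVertex_mem_prodFace.1 (h (prodVertex_mem_prodFace.2 ha)) i
    simp at this

end ProductOfSimplices

section Projection

variable {r : ℕ} {n : Fin r → ℕ} {E : Type*} [AddCommGroup E] [Module ℝ E]

/-- A face of the product of simplices is strictly preserved by the linear map `π` if it is exposed
by a functional that factors through `π`. -/
def StrictlyPreserved (π : ((i : Fin r) → Fin (n i + 1) → ℝ) →ₗ[ℝ] E)
    (G : Set ((i : Fin r) → Fin (n i + 1) → ℝ)) : Prop :=
  ∃ c : E →ₗ[ℝ] ℝ, {x ∈ prodSimplex n | ∀ y ∈ prodSimplex n, c (π y) ≤ c (π x)} = G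

variable {π : ((i : Fin r) → Fin (n i + 1) → ℝ) →ₗ[ℝ] E}
variable {G : Set ((i : Fin r) → Fin (n i + 1) → ℝ)}

theorem StrictlyPreserved.isFace_image (h : StrictlyPreserved π G) (hG : G.Nonempty) :
    IsFace (π '' prodSimplex n) (π '' G) := by
  obtain ⟨c, rfl⟩ := h
  refine ⟨hG.image π, c, ?_⟩
  ext z
  constructor
  · rintro ⟨x, ⟨hx, hmax⟩, rfl⟩
    refine ⟨mem_image_of_mem π hx, ?_⟩
    rintro _ ⟨y, hy, rfl⟩
    exact hmax y hy
  · rintro ⟨⟨x, hx, rfl⟩, hmax⟩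
    exact mem_image_of_mem π ⟨hx, fun y hy => hmax _ (mem_image_of_mem π hy)⟩

theorem StrictlyPreserved.mem_of_apply_mem (h : StrictlyPreserved π G)
    {x : (i : Fin r) → Fin (n i + 1) → ℝ} (hx : x ∈ prodSimplex n) (hπx : π x ∈ π '' G) :
    x ∈ G := by
  obtain ⟨c, rfl⟩ := h
  obtain ⟨y, hy, hyx⟩ := hπx
  exact ⟨hx, fun z hz => hyx ▸ hy.2 z hz⟩

theorem IsFace.inter_preimage {F : Set E} (hF : IsFace (π '' prodSimplex n) F) :
    IsFace (prodSimplex n) (prodSimplex n ∩ π ⁻¹' F) := by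
  obtain ⟨⟨z, hz⟩, c, rfl⟩ := hF
  obtain ⟨x, hx, rfl⟩ := hz.1
  refine ⟨⟨x, hx, hz⟩, c ∘ₗ π, ?_⟩
  ext y
  constructor
  · rintro ⟨hy, -, hmax⟩
    exact ⟨hy, fun w hw => hmax _ (mem_image_of_mem π hw)⟩
  · rintro ⟨hy, hmax⟩
    refine ⟨hy, mem_image_of_mem π hy, ?_⟩
    rintro _ ⟨w, hw, rfl⟩
    exact hmax w hw

theorem IsFace.image_inter_preimage {F : Set E} (hF : IsFace (π '' prodSimplex n) F) :
    π '' (prodSimplex n ∩ π ⁻¹' F) = F := by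
  rw [Set.image_inter_preimage, inter_eq_right]
  obtain ⟨-, c, rfl⟩ := hF
  exact fun z hz => hz.1

variable [FiniteDimensional ℝ E] {k : ℕ}

/-- If `π` strictly preserves the faces of dimension at most `k`, the dimension of a face is
preserved by `π` as long as it is at most `k + 1`. -/
theorem min_le_polyDim_image_prodFace
    (hπ : ∀ S : (i : Fin r) → Finset (Fin (n i + 1)), (∀ i, (S i).Nonempty) →
      ∑ i, (S i).card ≤ k + r → StrictlyPreserved π (prodFace S))
    (N : ℕ) {S : (i : Fin r) → Finset (Fin (n i + 1))} (hS : ∀ i, (S i).Nonempty)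
    (hcard : ∑ i, (S i).card = N + r) : min N (k + 1) ≤ polyDim (π '' prodFace S) := by
  induction N generalizing S with
  | zero => simp
  | succ N ih =>
    obtain ⟨S', hS', hcard', hss⟩ := exists_prodFace_ssubset hS hcard
    have hN := ih hS' hcard'
    rcases le_or_gt N k with hNk | hNk
    · have hpres := hπ S' hS' (by omega)
      have hlt : polyDim (π '' prodFace S') < polyDim (π '' prodFace S) :=
        polyDim_lt_of_isFace (hpres.isFace_image (prodFace_nonempty hS'))
          ⟨image_mono hss.subset, fun h => hss.2 fun x hx =>
            hpres.mem_of_apply_mem hx.1 (h (mem_image_of_mem π hx))⟩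
          (image_mono fun x hx => hx.1)
      omega
    · have := polyDim_mono (image_mono (f := π) hss.subset)
      omega

/-- A projection that strictly preserves all faces of dimension at most `k` preserves
the `k`-skeleton. -/
theorem skelEquiv_image_of_strictlyPreserved
    (hπ : ∀ S : (i : Fin r) → Finset (Fin (n i + 1)), (∀ i, (S i).Nonempty) →
      ∑ i, (S i).card ≤ k + r → StrictlyPreserved π (prodFace S)) :
    SkelEquiv k (π '' prodSimplex n) (prodSimplex n) := by
  have hdim : ∀ S : (i : Fin r) → Finset (Fin (n i + 1)), (∀ i, (S i).Nonempty) →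
      polyDim (π '' prodFace S) ≤ k → ∑ i, (S i).card ≤ k + r := by
    intro S hS hk
    have hr : r ≤ ∑ i, (S i).card := le_trans (Nat.le_add_left _ _) (polyDim_prodFace_le hS)
    obtain ⟨N, hN⟩ := Nat.exists_eq_add_of_le' hr
    have := min_le_polyDim_image_prodFace hπ N hS hN
    omega
  have hpres : ∀ G ∈ skel k (prodSimplex n), StrictlyPreserved π G := by
    rintro G ⟨hG, hGk⟩
    obtain ⟨S, hS, rfl⟩ := hG.exists_eq_prodFace
    exact hπ S hS (hdim S hS ((polyDim_image_le π _).trans hGk))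
  have himage : ∀ G ∈ skel k (prodSimplex n), π '' G ∈ skel k (π '' prodSimplex n) :=
    fun G hG => ⟨(hpres G hG).isFace_image hG.1.1, (polyDim_image_le π _).trans hG.2⟩
  have hpreimage : ∀ F ∈ skel k (π '' prodSimplex n),
      prodSimplex n ∩ π ⁻¹' F ∈ skel k (prodSimplex n) := by
    rintro F ⟨hF, hFk⟩
    refine ⟨hF.inter_preimage, ?_⟩
    obtain ⟨S, hS, hFS⟩ := hF.inter_preimage.exists_eq_prodFace
    rw [hFS]
    have h1 := hdim S hS (by rwa [← hFS, hF.image_inter_preimage])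
    have h2 := polyDim_prodFace_le hS
    omega
  exact ⟨{
    toFun := fun F => ⟨prodSimplex n ∩ π ⁻¹' F.1, hpreimage F.1 F.2⟩
    invFun := fun G => ⟨π '' G.1, himage G.1 G.2⟩
    left_inv := fun F => Subtype.ext F.2.1.image_inter_preimage
    right_inv := fun G => Subtype.ext <| by
      obtain ⟨G, hG⟩ := G
      obtain ⟨-, c, hc⟩ := hG.1
      ext x
      refine ⟨fun hx => (hpres G hG).mem_of_apply_mem hx.1 hx.2,
        fun hx => ⟨?_, mem_image_of_mem π hx⟩⟩
      exact (hc.subset hx).1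
    map_rel_iff' := fun {F F'} => by
      change prodSimplex n ∩ π ⁻¹' F.1 ⊆ prodSimplex n ∩ π ⁻¹' F'.1 ↔ F.1 ⊆ F'.1
      refine ⟨fun h => ?_, fun h => inter_subset_inter_right _ (preimage_mono h)⟩
      rw [← F.2.1.image_inter_preimage, ← F'.2.1.image_inter_preimage]
      exact image_mono h }⟩

/-- A projection of a product of simplices that strictly preserves all faces of dimension at most
`k` is `(k, n̄)`-PPSN. -/
theorem isPPSN_image_of_strictlyPreserved
    (hπ : ∀ S : (i : Fin r) → Finset (Fin (n i + 1)), (∀ i, (S i).Nonempty) →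
      ∑ i, (S i).card ≤ k + r → StrictlyPreserved π (prodFace S)) :
    IsPPSN k n (π '' prodSimplex n) := by
  let e := LinearEquiv.ofFinrankEq ((i : Fin r) → Fin (n i + 1) → ℝ)
    (Fin (Module.finrank ℝ ((i : Fin r) → Fin (n i + 1) → ℝ)) → ℝ)
    (Module.finrank_fin_fun ℝ).symm
  refine ⟨⟨isPolytope_image_prodSimplex π, skelEquiv_image_of_strictlyPreserved hπ⟩, _,
    e '' prodSimplex n, π ∘ₗ e.symm.toLinearMap, isPolytope_image_prodSimplex e.toLinearMap, ?_,
    ⟨facesOfImageOrderIso e _⟩⟩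
  rw [← image_comp]
  congr 1
  funext x
  exact congrArg π (e.symm_apply_apply x).symm

end Projection

section MomentProjection

open Polynomial

variable {r : ℕ} {n : Fin r → ℕ}

/-- The linear map sending the vertex of `Δ_n̄` with coordinates `(l_1, …, l_r)` to `w_a`, where
`a = (t_1(l_1), …, t_r(l_r))`. -/
noncomputable def momentProj (k : ℕ) (t : (i : Fin r) → Fin (n i + 1) → ℝ) :
    ((i : Fin r) → Fin (n i + 1) → ℝ) →ₗ[ℝ] (Fin (2 * k + r + 1) → ℝ) where
  toFun x j := if h : j.val < r then ∑ l, x ⟨j.val, h⟩ l * t ⟨j.val, h⟩ l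
    else ∑ i, ∑ l, x i l * t i l ^ (j.val - r + 2)
  map_add' x y := by
    ext j
    simp only [Pi.add_apply]
    split_ifs <;> simp only [add_mul, Finset.sum_add_distrib]
  map_smul' s x := by
    ext j
    simp only [Pi.smul_apply, RingHom.id_apply, smul_eq_mul]
    split_ifs <;> simp only [mul_assoc, ← Finset.mul_sum]

theorem momentProj_apply_of_lt {k : ℕ} {t : (i : Fin r) → Fin (n i + 1) → ℝ}
    (x : (i : Fin r) → Fin (n i + 1) → ℝ) {j : Fin (2 * k + r + 1)} (h : j.val < r) :
    momentProj k t x j = ∑ l, x ⟨j.val, h⟩ l * t ⟨j.val, h⟩ l :=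
  dif_pos h

theorem momentProj_apply_of_not_lt {k : ℕ} {t : (i : Fin r) → Fin (n i + 1) → ℝ}
    (x : (i : Fin r) → Fin (n i + 1) → ℝ) {j : Fin (2 * k + r + 1)} (h : ¬ j.val < r) :
    momentProj k t x j = ∑ i, ∑ l, x i l * t i l ^ (j.val - r + 2) :=
  dif_neg h

theorem momentProj_prodVertex (k : ℕ) (t : (i : Fin r) → Fin (n i + 1) → ℝ)
    (a : (i : Fin r) → Fin (n i + 1)) :
    momentProj k t (prodVertex a) = wvec k r fun i => t i (a i) := by
  ext j
  by_cases h : j.val < r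
  · rw [momentProj_apply_of_lt _ h]
    simp [wvec, h, prodVertex, Pi.single_apply]
  · rw [momentProj_apply_of_not_lt _ h]
    simp [wvec, h, prodVertex, Pi.single_apply]

/-- The linear functional with coefficients `α` on the first `r` coordinates and those
of `u` on the remaining ones. -/
noncomputable def momentFunctional (k r : ℕ) (u : ℝ[X]) (α : Fin r → ℝ) :
    (Fin (2 * k + r + 1) → ℝ) →ₗ[ℝ] ℝ :=
  ∑ i : Fin r, α i • LinearMap.proj ⟨i, by omega⟩ +
    ∑ s : Fin (2 * k + 1), u.coeff s • LinearMap.proj ⟨r + s, by omega⟩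

theorem momentFunctional_momentProj_single {k : ℕ} (t : (i : Fin r) → Fin (n i + 1) → ℝ)
    {u : ℝ[X]} (hu : u.natDegree ≤ 2 * k) (α c : Fin r → ℝ) (i : Fin r) (l : Fin (n i + 1)) :
    momentFunctional k r u α (momentProj k t (Pi.single i (Pi.single l 1))) =
      (X ^ 2 * u + C (α i) * X + C (c i)).eval (t i l) - c i := by
  have h1 : ∀ i' : Fin r, momentProj k t (Pi.single i (Pi.single l 1)) ⟨i', by omega⟩ =
      if i' = i then t i l else 0 := by
    intro i'
    rw [momentProj_apply_of_lt _ i'.2]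
    split_ifs with h
    · subst h
      simp [Pi.single_apply]
    · simp [Pi.single_eq_of_ne h]
  have h2 : ∀ s : Fin (2 * k + 1),
      momentProj k t (Pi.single i (Pi.single l 1)) ⟨r + s, by omega⟩ = t i l ^ (s.val + 2) := by
    intro s
    rw [momentProj_apply_of_not_lt _ (by simp), Finset.sum_eq_single i, Finset.sum_eq_single l]
    · simp
    · intro l' _ hl'
      simp [hl']
    · simp
    · intro i' _ hi'
      simp [Pi.single_eq_of_ne hi']
    · simp
  simp only [momentFunctional, LinearMap.add_apply, LinearMap.sum_apply, LinearMap.smul_apply,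
    LinearMap.proj_apply, h1, h2, smul_eq_mul, mul_ite, mul_zero, Finset.sum_ite_eq',
    Finset.mem_univ, if_true, eval_add, eval_mul, eval_pow, eval_X, eval_C]
  rw [eval_eq_sum_range' (Nat.lt_succ_of_le hu), Finset.mul_sum,
    ← Fin.sum_univ_eq_sum_range fun s => t i l ^ 2 * (u.coeff s * t i l ^ s)]
  have h3 : ∀ s : Fin (2 * k + 1), u.coeff s * t i l ^ (s.val + 2) =
      t i l ^ 2 * (u.coeff s * t i l ^ s.val) := fun s => by ring
  simp only [h3]
  ring

/-- If the nodes `t_i(l)` lie in disjoint intervals, the faces of `Δ_n̄` of dimension at most `k`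
are strictly preserved by `momentProj`. -/
theorem strictlyPreserved_momentProj {k : ℕ} {t : (i : Fin r) → Fin (n i + 1) → ℝ}
    (ht : ∀ i, Function.Injective (t i)) {J : Fin r → Set ℝ} (hJ : ∀ i, (J i).OrdConnected)
    (hdisj : Pairwise (Function.onFun Disjoint J)) (htJ : ∀ i l, t i l ∈ J i)
    {b : Fin r → ℝ} (hb : ∀ i, b i ∈ J i) (htb : ∀ i l, t i l < b i)
    {S : (i : Fin r) → Finset (Fin (n i + 1))} (hS : ∀ i, (S i).Nonempty)
    (hcard : ∑ i, (S i).card ≤ k + r) : StrictlyPreserved (momentProj k t) (prodFace S) := by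
  have hr : r ≤ ∑ i, (S i).card := le_trans (Nat.le_add_left _ _) (polyDim_prodFace_le hS)
  obtain ⟨k', hk'⟩ := Nat.exists_eq_add_of_le' hr
  obtain ⟨u, α, c, hu, hF⟩ := exists_supporting_polynomials (k := k')
    (S := fun i => (S i).map ⟨t i, ht i⟩) hJ hdisj (fun i => (hS i).map)
    (by simp [htJ]) hb (by simp [htb]) (by simpa using hk')
  have hval := momentFunctional_momentProj_single t (k := k) (hu.trans (by omega)) α c
  have hzero : ∀ i, ∀ l ∈ S i, (X ^ 2 * u + C (α i) * X + C (c i)).eval (t i l) = 0 :=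
    fun i l hl => (hF i).1 _ (Finset.mem_map_of_mem ⟨t i, ht i⟩ hl)
  have hpos : ∀ i, ∀ l ∉ S i, 0 < (X ^ 2 * u + C (α i) * X + C (c i)).eval (t i l) :=
    fun i l hl => (hF i).2 _ (htJ i l) fun h => hl ((Finset.mem_map' ⟨t i, ht i⟩).1 h)
  refine ⟨-momentFunctional k r u α, maximal_face_eq_prodFace
    ((-momentFunctional k r u α) ∘ₗ momentProj k t) hS (m := c) (fun i l => ?_) fun i l => ?_⟩
  · rw [LinearMap.comp_apply, LinearMap.neg_apply, hval]
    by_cases hl : l ∈ S i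
    · linarith [hzero i l hl]
    · linarith [hpos i l hl]
  · rw [LinearMap.comp_apply, LinearMap.neg_apply, hval]
    by_cases hl : l ∈ S i
    · simp [hl, hzero i l hl]
    · simp only [hl, iff_false]
      linarith [hpos i l hl]

end MomentProjection

/-- Theorem `UBminkowskiCyclic`. There are pairwise disjoint index sets
`I_1, …, I_r ⊆ ℝ` with `|I_i| = n_i + 1` such that
`P = conv{w_a : a ∈ I_1 × ⋯ × I_r} ⊆ ℝ^{2k+r+1}` is `(k, n̄)`-PPSN. -/
theorem statement3 (k r : ℕ) (hr : 1 ≤ r) (n : Fin r → ℕ) (hn : ∀ i, 1 ≤ n i) :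
    ∃ I : Fin r → Finset ℝ,
      (∀ i j, i ≠ j → Disjoint (I i) (I j)) ∧
      (∀ i, (I i).card = n i + 1) ∧
      IsPPSN k n (convexHull ℝ
        {x : Fin (2 * k + r + 1) → ℝ |
          ∃ a : Fin r → ℝ, (∀ i, a i ∈ I i) ∧ x = wvec k r a}) := by
  set M : ℝ := ∑ i, (n i : ℝ) + 2
  have hnM : ∀ i, (n i : ℝ) + 1 < M := by
    intro i
    have := Finset.single_le_sum (f := fun i => (n i : ℝ)) (fun i _ => Nat.cast_nonneg _)
      (Finset.mem_univ i)
    simp only [M]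
    linarith
  have hM : 0 < M := lt_trans (by positivity) (hnM ⟨0, hr⟩)
  let t : (i : Fin r) → Fin (n i + 1) → ℝ := fun i l => i.val * M + l.val
  have ht : ∀ i, Function.Injective (t i) := by
    intro i l l' h
    simpa [t, Fin.ext_iff] using h
  let J : Fin r → Set ℝ := fun i => Ico (i.val * M) ((i.val + 1) * M)
  have hlt : ∀ i j : Fin r, i < j → Disjoint (J i) (J j) := by
    intro i j hij
    refine Set.disjoint_left.2 fun x hx hx' => ?_
    have h1 : ((i.val : ℝ) + 1) ≤ j.val := by exact_mod_cast hij
    have := mul_le_mul_of_nonneg_right h1 hM.le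
    linarith [hx.2, hx'.1]
  have hdisj : Pairwise (Function.onFun Disjoint J) := by
    intro i j hij
    rcases lt_or_gt_of_ne hij with h | h
    · exact hlt i j h
    · exact (hlt j i h).symm
  have hlb : ∀ i (l : Fin (n i + 1)), (l.val : ℝ) < n i + 1 := fun i l => by exact_mod_cast l.2
  have htJ : ∀ i l, t i l ∈ J i := by
    intro i l
    refine ⟨le_add_of_nonneg_right (Nat.cast_nonneg _), ?_⟩
    simp only [t]
    linarith [hlb i l, hnM i]
  refine ⟨fun i => Finset.univ.map ⟨t i, ht i⟩, fun i j hij => ?_, by simp, ?_⟩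
  · refine Finset.disjoint_left.2 fun x hx hx' => ?_
    obtain ⟨l, -, rfl⟩ := Finset.mem_map.1 hx
    obtain ⟨l', -, hl'⟩ := Finset.mem_map.1 hx'
    have hl'' : t j l' = t i l := hl'
    exact Set.disjoint_left.1 (hdisj hij) (htJ i l) (hl'' ▸ htJ j l')
  · have hset : {x : Fin (2 * k + r + 1) → ℝ | ∃ a : Fin r → ℝ,
        (∀ i, a i ∈ Finset.univ.map ⟨t i, ht i⟩) ∧ x = wvec k r a} =
        range (momentProj k t ∘ prodVertex) := by
      ext x
      simp only [mem_ofPred_eq, mem_range, Function.comp_apply, momentProj_prodVertex]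
      constructor
      · rintro ⟨a, ha, rfl⟩
        choose l _ hl using fun i => Finset.mem_map.1 (ha i)
        exact ⟨l, congrArg (wvec k r) (funext hl)⟩
      · rintro ⟨l, rfl⟩
        exact ⟨_, fun i => Finset.mem_map_of_mem ⟨t i, ht i⟩ (Finset.mem_univ (l i)), rfl⟩
    rw [hset, ← image_prodSimplex]
    refine isPPSN_image_of_strictlyPreserved fun S hS hcard =>
      strictlyPreserved_momentProj ht (fun i => ordConnected_Ico) hdisj htJ
        (b := fun i => i.val * M + (n i + 1)) (fun i => ⟨?_, ?_⟩) (fun i l => ?_) hS hcard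
    · exact le_add_of_nonneg_right (by positivity)
    · linarith [hnM i]
    · simp only [t]
      linarith [hlb i l]
end

section
/- Let k ≥ 0 and n̄ = (n_1,…,n_r) with 1 = n_1 = ⋯ = n_s < n_{s+1} ≤ ⋯ ≤ n_r (so s is the number of indices with n_i = 1), and set n := Σ_{i∈[r]} n_i. Then: (1) for every integer d with 0 ≤ d ≤ s − 1, there exists a d-dimensional (k,n̄)-PPSN polytope provided k ≤ ⌊d/2⌋ − r + s − 1; and (2) for every integer d with s ≤ d ≤ n, there exists a d-dimensional (k,n̄)-PPSN polytope provided k ≤ ⌊(d + t − s)/2⌋ − r + s, where t ∈ {s,…,r} is the maximal integer such that Σ_{i=1}^t n_i ≤ d. -/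
open Set

section SlackPolytope

open scoped Matrix Topology

variable {T : Type*} [Fintype T] {r : ℕ}

/-- The slice of the nonnegative orthant cut out by the equations `ℓ i ⬝ᵥ z = 1`. -/
def slackPolytope (ℓ : Fin r → T → ℝ) : Set (T → ℝ) :=
  {z | (∀ s, 0 ≤ z s) ∧ ∀ i, ℓ i ⬝ᵥ z = 1}

/-- The points of the slack polytope supported on `J`. -/
def faceOn (ℓ : Fin r → T → ℝ) (J : Finset T) : Set (T → ℝ) :=
  {z ∈ slackPolytope ℓ | ∀ s ∉ J, z s = 0}

/-- `J` contains an element of every block of `β`. -/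
def MeetsBlocks (β : T → Fin r) (J : Finset T) : Prop := ∀ i, ∃ s ∈ J, β s = i

/-- `ℓ` is block triangular with respect to `β`, with positive diagonal blocks. -/
structure IsTriangular (β : T → Fin r) (ℓ : Fin r → T → ℝ) : Prop where
  zero : ∀ i s, β s < i → ℓ i s = 0
  pos : ∀ i s, β s = i → 0 < ℓ i s

/-- Block triangularity with nonpositive off-diagonal entries; this makes the slack polytope
a combinatorial product of simplices. -/
structure IsSignedTriangular (β : T → Fin r) (ℓ : Fin r → T → ℝ) : Prop
    extends IsTriangular β ℓ where
  nonpos : ∀ i s, i < β s → ℓ i s ≤ 0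

/-- The directions supported on `J` along which all `ℓ i` are constant. -/
def dirOn (ℓ : Fin r → T → ℝ) (J : Finset T) : Submodule ℝ (T → ℝ) where
  carrier := {x | (∀ s ∉ J, x s = 0) ∧ ∀ i, ℓ i ⬝ᵥ x = 0}
  add_mem' := by
    rintro a b ⟨h1, h2⟩ ⟨h3, h4⟩
    exact ⟨fun s hs => by simp [h1 s hs, h3 s hs], fun i => by simp [dotProduct_add, h2, h4]⟩
  zero_mem' := by simp
  smul_mem' := by
    rintro c a ⟨h1, h2⟩
    exact ⟨fun s hs => by simp [h1 s hs], fun i => by simp [h2]⟩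

variable {β : T → Fin r} {ℓ : Fin r → T → ℝ}

theorem convex_slackPolytope : Convex ℝ (slackPolytope ℓ) := by
  rintro x ⟨hx, hx'⟩ y ⟨hy, hy'⟩ a b ha hb hab
  refine ⟨fun s => ?_, fun i => ?_⟩
  · have := hx s; have := hy s
    simp only [Pi.add_apply, Pi.smul_apply, smul_eq_mul]; positivity
  · simp [dotProduct_add, hx', hy', hab]

theorem isClosed_slackPolytope : IsClosed (slackPolytope ℓ) := by
  have : slackPolytope ℓ = (⋂ s, {z | 0 ≤ z s}) ∩ ⋂ i, {z | ℓ i ⬝ᵥ z = 1} := by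
    ext z; simp [slackPolytope]
  rw [this]
  refine (isClosed_iInter fun s => isClosed_le continuous_const (continuous_apply s)).inter
    (isClosed_iInter fun i => isClosed_eq ?_ continuous_const)
  unfold dotProduct
  fun_prop

/-- A point can be moved a little in both directions along any vector of `dirOn ℓ J` if its
coordinates in `J` are positive. -/
theorem exists_add_sub_mem {z x : T → ℝ} {J : Finset T} (hz : z ∈ slackPolytope ℓ)
    (hpos : ∀ s ∈ J, 0 < z s) (hx : x ∈ dirOn ℓ J) :
    ∃ ε : ℝ, 0 < ε ∧ z + ε • x ∈ slackPolytope ℓ ∧ z - ε • x ∈ slackPolytope ℓ := by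
  have h : ∀ᶠ ε in 𝓝[>] (0 : ℝ), ∀ s, ε * |x s| ≤ z s := by
    rw [Filter.eventually_all]
    intro s
    by_cases hs : s ∈ J
    · have : Filter.Tendsto (fun ε : ℝ => ε * |x s|) (𝓝[>] 0) (𝓝 0) := by
        have : Filter.Tendsto (fun ε : ℝ => ε * |x s|) (𝓝 0) (𝓝 (0 * |x s|)) :=
          (continuous_id.mul continuous_const).tendsto 0
        rw [zero_mul] at this
        exact this.mono_left nhdsWithin_le_nhds
      exact (this.eventually (gt_mem_nhds (hpos s hs))).mono fun _ h => h.le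
    · refine Filter.Eventually.of_forall fun ε => ?_
      simpa [hx.1 s hs] using hz.1 s
  obtain ⟨ε, hε, hε0⟩ := (h.and self_mem_nhdsWithin).exists
  refine ⟨ε, hε0, ⟨fun s => ?_, fun i => ?_⟩, ⟨fun s => ?_, fun i => ?_⟩⟩
  · have := hε s
    have h1 := mul_le_mul_of_nonneg_left (neg_abs_le (x s)) (le_of_lt hε0)
    simp only [Pi.add_apply, Pi.smul_apply, smul_eq_mul]; linarith
  · simp [dotProduct_add, hz.2, hx.2]
  · have := hε s
    have h1 := mul_le_mul_of_nonneg_left (le_abs_self (x s)) (le_of_lt hε0)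
    simp only [Pi.sub_apply, Pi.smul_apply, smul_eq_mul]; linarith
  · simp [dotProduct_sub, hz.2, hx.2]

theorem IsSignedTriangular.exists_pos (h : IsSignedTriangular β ℓ) {z : T → ℝ}
    (hz : z ∈ slackPolytope ℓ) (i : Fin r) : ∃ s, β s = i ∧ 0 < z s := by
  by_contra! hcon
  have : ℓ i ⬝ᵥ z ≤ 0 := by
    refine Finset.sum_nonpos fun s _ => ?_
    rcases lt_trichotomy (β s) i with hs | hs | hs
    · simp [h.zero i s hs]
    · exact mul_nonpos_of_nonneg_of_nonpos (h.pos i s hs).le (hcon s hs)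
    · exact mul_nonpos_of_nonpos_of_nonneg (h.nonpos i s hs) (hz.1 s)
  rw [hz.2 i] at this
  linarith

/-- Every `J` meeting all blocks is the exact support of some point. -/
theorem IsSignedTriangular.exists_support (h : IsSignedTriangular β ℓ) {J : Finset T}
    (hJ : MeetsBlocks β J) :
    ∃ z ∈ slackPolytope ℓ, (∀ s ∈ J, 0 < z s) ∧ ∀ s ∉ J, z s = 0 := by
  classical
  let a : Fin r → ℝ := fun i => ∑ s ∈ J with β s = i, ℓ i s
  have ha : ∀ i, 0 < a i := fun i => by
    refine Finset.sum_pos (fun s hs => h.pos i s (Finset.mem_filter.1 hs).2) ?_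
    obtain ⟨s, hs, hs'⟩ := hJ i
    exact ⟨s, Finset.mem_filter.2 ⟨hs, hs'⟩⟩
  let F : (i : Fin r) → ((i' : Fin r) → i' > i → ℝ) → ℝ := fun i rec =>
    (1 - ∑ s ∈ J, if hs : β s > i then ℓ i s * rec (β s) hs else 0) / a i
  have wf : WellFounded (fun x y : Fin r => x > y) := wellFounded_gt
  let y : Fin r → ℝ := wf.fix F
  have hy : ∀ i, y i = (1 - ∑ s ∈ J, if β s > i then ℓ i s * y (β s) else 0) / a i := fun i => by
    change wf.fix F i = _
    rw [wf.fix_eq]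
    simp only [F, y, dite_eq_ite]
  have ypos : ∀ i, 0 < y i := fun i => by
    induction i using wf.induction with
    | _ i ih =>
      rw [hy i]
      refine div_pos ?_ (ha i)
      have : ∑ s ∈ J, (if β s > i then ℓ i s * y (β s) else 0) ≤ 0 := by
        refine Finset.sum_nonpos fun s _ => ?_
        split_ifs with hs
        · exact mul_nonpos_of_nonpos_of_nonneg (h.nonpos i s hs) (ih _ hs).le
        · exact le_rfl
      linarith
  refine ⟨fun s => if s ∈ J then y (β s) else 0, ⟨fun s => ?_, fun i => ?_⟩, fun s hs => ?_,
    fun s hs => by simp [hs]⟩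
  · dsimp only; split_ifs
    exacts [(ypos _).le, le_rfl]
  · have h1 : a i * y i = ∑ s ∈ J, if β s = i then ℓ i s * y (β s) else 0 := by
      rw [Finset.sum_mul, Finset.sum_filter]
      refine Finset.sum_congr rfl fun s _ => ?_
      split_ifs with hs
      · rw [hs]
      · rfl
    have h2 : a i * y i = 1 - ∑ s ∈ J, if β s > i then ℓ i s * y (β s) else 0 := by
      have := (ha i).ne'
      nth_rw 1 [hy i]
      field_simp
    have h3 : (ℓ i ⬝ᵥ fun s => if s ∈ J then y (β s) else 0) =
        ∑ s ∈ J, ((if β s = i then ℓ i s * y (β s) else 0) +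
          if β s > i then ℓ i s * y (β s) else 0) := by
      simp only [dotProduct, mul_ite, mul_zero, Finset.sum_ite_mem, Finset.univ_inter]
      refine Finset.sum_congr rfl fun s _ => ?_
      rcases lt_trichotomy (β s) i with hs | hs | hs
      · simp [h.zero i s hs]
      · simp [hs]
      · simp [hs, hs.ne']
    rw [h3, Finset.sum_add_distrib, ← h1, h2]
    ring
  · simp only [hs, if_true]; exact ypos _

theorem IsSignedTriangular.isBounded (h : IsSignedTriangular β ℓ) :
    Bornology.IsBounded (slackPolytope ℓ) := by
  have wf : WellFounded (fun x y : Fin r => x > y) := wellFounded_gt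
  have key : ∀ i : Fin r, ∃ C : ℝ, ∀ z ∈ slackPolytope ℓ, ∀ s, β s = i → z s ≤ C := fun i => by
    induction i using wf.induction with
    | _ i ih =>
      choose! C hC using ih
      have hsum : ∀ z ∈ slackPolytope ℓ, ∀ s, β s = i →
          z s ≤ (1 + ∑ s', |ℓ i s'| * |C (β s')|) / ℓ i s := by
        intro z hz s hs
        rw [le_div_iff₀ (h.pos i s hs)]
        have h1 : ℓ i ⬝ᵥ z + ∑ s', |ℓ i s'| * |C (β s')| ≥ ℓ i s * z s := by
          rw [dotProduct, ← Finset.sum_add_distrib]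
          have hnn : ∀ s', β s' ≠ i → 0 ≤ ℓ i s' * z s' + |ℓ i s'| * |C (β s')| := by
            intro s' hs'
            rcases lt_or_gt_of_ne hs' with hlt | hgt
            · simp [h.zero i s' hlt]
            · have h2 := (hC _ hgt z hz s' rfl).trans (le_abs_self _)
              rw [abs_of_nonpos (h.nonpos i s' hgt)]
              nlinarith [h.nonpos i s' hgt]
          have hnn' : ∀ s', 0 ≤ ℓ i s' * z s' + |ℓ i s'| * |C (β s')| := by
            intro s'
            by_cases hs' : β s' = i
            · have := mul_nonneg (h.pos i s' hs').le (hz.1 s')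
              positivity
            · exact hnn s' hs'
          refine le_trans ?_ (Finset.single_le_sum (fun s' _ => hnn' s') (Finset.mem_univ s))
          have : 0 ≤ |ℓ i s| * |C (β s)| := by positivity
          linarith
        rw [hz.2 i] at h1
        linarith
      refine ⟨∑ s, |(1 + ∑ s', |ℓ i s'| * |C (β s')|) / ℓ i s|, fun z hz s hs => ?_⟩
      refine (hsum z hz s hs).trans ((le_abs_self _).trans ?_)
      exact Finset.single_le_sum
        (f := fun s => |(1 + ∑ s', |ℓ i s'| * |C (β s')|) / ℓ i s|)
        (fun _ _ => abs_nonneg _) (Finset.mem_univ s)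
  choose C hC using key
  refine (Metric.isBounded_Icc (0 : T → ℝ) (fun s => C (β s))).subset fun z hz => ?_
  exact ⟨fun s => hz.1 s, fun s => hC _ z hz s rfl⟩

theorem IsSignedTriangular.isPolytope (h : IsSignedTriangular β ℓ) :
    IsPolytope (slackPolytope ℓ) := by
  classical
  have hfin : ((slackPolytope ℓ).extremePoints ℝ).Finite := by
    refine Set.Finite.of_injOn (f := fun z : T → ℝ => Finset.univ.filter fun s => 0 < z s)
      (t := Set.univ) (fun _ _ => Set.mem_univ _) ?_ Set.finite_univ
    intro z hz z' hz' hzz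
    have hsupp : ∀ s, 0 < z s ↔ 0 < z' s := fun s => by
      have := congrArg (fun J => s ∈ J) hzz
      simpa using this
    by_contra hne
    have hx : z' - z ∈ dirOn ℓ (Finset.univ.filter fun s => 0 < z s) := by
      refine ⟨fun s hs => ?_, fun i => ?_⟩
      · have h1 : ¬ 0 < z s := by simpa using hs
        have h2 : ¬ 0 < z' s := by rwa [← hsupp]
        have := hz.1.1 s
        have := hz'.1.1 s
        simp only [Pi.sub_apply]; linarith
      · rw [dotProduct_sub, hz.1.2, hz'.1.2, sub_self]
    obtain ⟨ε, hε, h1, h2⟩ := exists_add_sub_mem hz.1 (by simp) hx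
    have hmem : z ∈ openSegment ℝ (z + ε • (z' - z)) (z - ε • (z' - z)) := by
      refine ⟨1 / 2, 1 / 2, by norm_num, by norm_num, by norm_num, ?_⟩
      module
    have := hz.2 h1 h2 hmem
    have h0 : ε • (z' - z) = 0 := by simpa using this
    rcases smul_eq_zero.1 h0 with h0 | h0
    · exact hε.ne' h0
    · exact hne (sub_eq_zero.1 h0).symm
  refine ⟨hfin.toFinset, ?_⟩
  rw [hfin.coe_toFinset]
  have hc : IsCompact (slackPolytope ℓ) :=
    Metric.isCompact_of_isClosed_isBounded isClosed_slackPolytope h.isBounded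
  rw [← (hfin.isClosed_convexHull ℝ).closure_eq]
  exact (closure_convexHull_extremePoints hc convex_slackPolytope).symm

/-- Every nonempty face of the slack polytope is of the form `faceOn ℓ J`. -/
theorem IsSignedTriangular.exists_faceOn (h : IsSignedTriangular β ℓ) {F : Set (T → ℝ)}
    (hF : IsFace (slackPolytope ℓ) F) : ∃ J, MeetsBlocks β J ∧ F = faceOn ℓ J := by
  classical
  obtain ⟨hne, c, rfl⟩ := hF
  set F := {x ∈ slackPolytope ℓ | ∀ y ∈ slackPolytope ℓ, c y ≤ c x} with hFdef
  have hconv : Convex ℝ F := by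
    rintro x ⟨hx, hx'⟩ y ⟨hy, hy'⟩ a b ha hb hab
    refine ⟨convex_slackPolytope hx hy ha hb hab, fun w hw => ?_⟩
    have h1 := mul_le_mul_of_nonneg_left (hx' w hw) ha
    have h2 := mul_le_mul_of_nonneg_left (hy' w hw) hb
    simp only [map_add, map_smul, smul_eq_mul]
    calc c w = a * c w + b * c w := by rw [← add_mul, hab, one_mul]
      _ ≤ _ := by linarith
  let J : Finset T := Finset.univ.filter fun s => ∃ z ∈ F, 0 < z s
  have hstar : ∀ K : Finset T, K ⊆ J → ∃ z ∈ F, ∀ s ∈ K, 0 < z s := by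
    intro K
    induction K using Finset.induction_on with
    | empty => exact fun _ => ⟨hne.some, hne.some_mem, by simp⟩
    | insert a K _ ih =>
      intro hK
      obtain ⟨z, hz, hz'⟩ := ih fun s hs => hK (Finset.mem_insert_of_mem hs)
      obtain ⟨w, hw, hw'⟩ := (Finset.mem_filter.1 (hK (Finset.mem_insert_self a K))).2
      refine ⟨(1 / 2 : ℝ) • z + (1 / 2 : ℝ) • w,
        hconv hz hw (by norm_num) (by norm_num) (by norm_num), fun s hs => ?_⟩
      have h1 := hz.1.1 s
      have h2 := hw.1.1 s
      simp only [Pi.add_apply, Pi.smul_apply, smul_eq_mul]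
      rcases Finset.mem_insert.1 hs with rfl | hs
      · linarith
      · linarith [hz' s hs]
  obtain ⟨z, hz, hzpos⟩ := hstar J subset_rfl
  have hsupp : ∀ w ∈ F, ∀ s ∉ J, w s = 0 := by
    intro w hw s hs
    by_contra hcon
    exact hs (Finset.mem_filter.2 ⟨Finset.mem_univ s, w, hw,
      lt_of_le_of_ne (hw.1.1 s) (Ne.symm hcon)⟩)
  refine ⟨J, fun i => ?_, Set.Subset.antisymm (fun w hw => ⟨hw.1, hsupp w hw⟩) ?_⟩
  · obtain ⟨s, hs, hs'⟩ := h.exists_pos hz.1 i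
    exact ⟨s, Finset.mem_filter.2 ⟨Finset.mem_univ s, z, hz, hs'⟩, hs⟩
  · rintro w ⟨hw, hwJ⟩
    have hx : w - z ∈ dirOn ℓ J :=
      ⟨fun s hs => by simp [hwJ s hs, hsupp z hz s hs],
        fun i => by rw [dotProduct_sub, hw.2, hz.1.2, sub_self]⟩
    obtain ⟨ε, hε, -, h2⟩ := exists_add_sub_mem hz.1 hzpos hx
    have h3 := hz.2 _ h2
    simp only [map_sub, map_smul, smul_eq_mul] at h3
    have h4 : 0 ≤ c w - c z := by
      by_contra hcon
      nlinarith
    exact ⟨hw, fun y hy => (hz.2 y hy).trans (by linarith)⟩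

/-- A vector with `ℓ i ⬝ᵥ x = 0` for all `i` and at most one nonzero entry per block vanishes. -/
theorem IsTriangular.eq_zero_of_transversal (h : IsTriangular β ℓ) {τ : Fin r → T}
    {x : T → ℝ} (hx : ∀ i, ℓ i ⬝ᵥ x = 0) (hsupp : ∀ s, s ≠ τ (β s) → x s = 0) : x = 0 := by
  have wf : WellFounded (fun x y : Fin r => x > y) := wellFounded_gt
  have key : ∀ i : Fin r, ∀ s, β s = i → x s = 0 := fun i => by
    induction i using wf.induction with
    | _ i ih =>
      intro s hs
      by_cases hτ : s = τ (β s)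
      · have h1 := hx i
        rw [dotProduct, Finset.sum_eq_single s] at h1
        · exact (mul_eq_zero.1 h1).resolve_left (h.pos i s hs).ne'
        · intro s' _ hne
          rcases lt_trichotomy (β s') i with hs' | hs' | hs'
          · simp [h.zero i s' hs']
          · rw [hsupp s', mul_zero]
            rw [hs', ← hs, ← hτ]; exact hne
          · rw [ih _ hs' s' rfl, mul_zero]
        · simp
      · exact hsupp s hτ
  exact funext fun s => key _ s rfl

theorem IsTriangular.finrank_dirOn_le (h : IsTriangular β ℓ) {J : Finset T}
    (hJ : MeetsBlocks β J) : Module.finrank ℝ (dirOn ℓ J) + r ≤ J.card := by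
  classical
  choose τ hτJ hτ using hJ
  let K : Finset T := J \ Finset.univ.image τ
  let f : dirOn ℓ J →ₗ[ℝ] (K → ℝ) :=
    (LinearMap.funLeft ℝ ℝ (Subtype.val : K → T)).comp (dirOn ℓ J).subtype
  have hf : Function.Injective f := by
    rw [← LinearMap.ker_eq_bot, LinearMap.ker_eq_bot']
    rintro ⟨x, hx⟩ hfx
    refine Subtype.ext (h.eq_zero_of_transversal (τ := τ) hx.2 fun s hs => ?_)
    by_cases hsJ : s ∈ J
    · have hsK : s ∈ K := by
        refine Finset.mem_sdiff.2 ⟨hsJ, fun hcon => ?_⟩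
        obtain ⟨i, -, rfl⟩ := Finset.mem_image.1 hcon
        exact hs (by rw [hτ])
      exact congrFun hfx ⟨s, hsK⟩
    · exact hx.1 s hsJ
  have h1 := LinearMap.finrank_le_finrank_of_injective hf
  rw [Module.finrank_fintype_fun_eq_card, Fintype.card_coe] at h1
  have hinj : Function.Injective τ := fun i i' hii => by rw [← hτ i, hii, hτ]
  have hsub : Finset.univ.image τ ⊆ J := by
    intro s hs
    obtain ⟨i, -, rfl⟩ := Finset.mem_image.1 hs
    exact hτJ i
  have h2 := Finset.card_sdiff_add_card_eq_card hsub
  rw [Finset.card_image_of_injective _ hinj, Finset.card_univ, Fintype.card_fin] at h2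
  change _ ≤ (J \ Finset.univ.image τ).card at h1
  omega

theorem card_le_finrank_dirOn (ℓ : Fin r → T → ℝ) (J : Finset T) :
    J.card ≤ Module.finrank ℝ (dirOn ℓ J) + r := by
  classical
  let g : (J → ℝ) →ₗ[ℝ] (T → ℝ) :=
    LinearMap.pi fun s => if hs : s ∈ J then LinearMap.proj ⟨s, hs⟩ else 0
  have hg : ∀ y s, g y s = if hs : s ∈ J then y ⟨s, hs⟩ else 0 := by
    intro y s
    simp only [g, LinearMap.pi_apply]
    split_ifs <;> rfl
  let f : (J → ℝ) →ₗ[ℝ] (Fin r → ℝ) := (Matrix.mulVecLin (Matrix.of ℓ)).comp g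
  have h1 := LinearMap.finrank_range_add_finrank_ker f
  have h2 : Module.finrank ℝ f.range ≤ r := by
    simpa using Submodule.finrank_le f.range
  have h3 : Module.finrank ℝ f.ker ≤ Module.finrank ℝ (dirOn ℓ J) := by
    let φ : f.ker →ₗ[ℝ] dirOn ℓ J := (g.comp f.ker.subtype).codRestrict _ fun y =>
      ⟨fun s hs => by simp [hg, hs], fun i => congrFun (LinearMap.mem_ker.1 y.2) i⟩
    refine LinearMap.finrank_le_finrank_of_injective (f := φ) fun y y' hyy => ?_
    ext ⟨s, hs⟩
    have := congrFun (congrArg Subtype.val hyy) s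
    change g y s = g y' s at this
    simpa [hg, hs] using this
  rw [Module.finrank_fintype_fun_eq_card, Fintype.card_coe] at h1
  omega

/-- The linear map `f` exposes the face `J`: up to the equations defining the slack polytope, some
functional factoring through `f` vanishes on `J` and is negative elsewhere. -/
def Exposes {E : Type*} [AddCommGroup E] [Module ℝ E] (ℓ : Fin r → T → ℝ)
    (f : (T → ℝ) →ₗ[ℝ] E) (J : Finset T) : Prop :=
  ∃ (c : E →ₗ[ℝ] ℝ) (u : T → ℝ) (μ : Fin r → ℝ),
    (∀ z, c (f z) + u ⬝ᵥ z = ∑ i, μ i * (ℓ i ⬝ᵥ z)) ∧ (∀ s ∈ J, u s = 0) ∧ ∀ s ∉ J, 0 < u s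

section Projection

variable {E : Type*} [AddCommGroup E] [Module ℝ E] {f : (T → ℝ) →ₗ[ℝ] E}

theorem map_dirOn_le_direction {J : Finset T} {z : T → ℝ} (hz : z ∈ faceOn ℓ J)
    (hpos : ∀ s ∈ J, 0 < z s) :
    (dirOn ℓ J).map f ≤ (affineSpan ℝ (f '' faceOn ℓ J)).direction := by
  rintro _ ⟨x, hx, rfl⟩
  obtain ⟨ε, hε, h1, -⟩ := exists_add_sub_mem hz.1 hpos hx
  have h2 : z + ε • x ∈ faceOn ℓ J := ⟨h1, fun s hs => by simp [hz.2 s hs, hx.1 s hs]⟩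
  have h3 := AffineSubspace.vsub_mem_direction
    (subset_affineSpan ℝ _ (Set.mem_image_of_mem f h2))
    (subset_affineSpan ℝ _ (Set.mem_image_of_mem f hz))
  simp only [map_add, map_smul, vsub_eq_sub, add_sub_cancel_left] at h3
  simpa [smul_smul, inv_mul_cancel₀ hε.ne'] using Submodule.smul_mem _ ε⁻¹ h3

theorem direction_le_map_dirOn (f : (T → ℝ) →ₗ[ℝ] E) (J : Finset T) :
    (affineSpan ℝ (f '' faceOn ℓ J)).direction ≤ (dirOn ℓ J).map f := by
  rw [direction_affineSpan, vectorSpan_def, Submodule.span_le]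
  rintro _ ⟨_, ⟨z, hz, rfl⟩, _, ⟨w, hw, rfl⟩, rfl⟩
  refine ⟨z - w, ⟨fun s hs => by simp [hz.2 s hs, hw.2 s hs], fun i => ?_⟩, by simp⟩
  rw [dotProduct_sub, hz.1.2, hw.1.2, sub_self]

theorem polyDim_image_faceOn_le (h : IsTriangular β ℓ) (f : (T → ℝ) →ₗ[ℝ] E) {J : Finset T}
    (hJ : MeetsBlocks β J) : polyDim (f '' faceOn ℓ J) + r ≤ J.card := by
  refine le_trans (Nat.add_le_add_right ?_ r) (h.finrank_dirOn_le hJ)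
  exact (Submodule.finrank_mono (direction_le_map_dirOn f J)).trans
    (Submodule.finrank_map_le f _)

theorem Exposes.mem_faceOn_iff {J : Finset T} (h : Exposes ℓ f J)
    (hne : (faceOn ℓ J).Nonempty) :
    ∃ c : E →ₗ[ℝ] ℝ, ∀ z ∈ slackPolytope ℓ,
      z ∈ faceOn ℓ J ↔ ∀ w ∈ slackPolytope ℓ, c (f w) ≤ c (f z) := by
  obtain ⟨c, u, μ, hc, hu0, hu⟩ := h
  have hu' : ∀ s, 0 ≤ u s := fun s => by
    by_cases hs : s ∈ J
    exacts [(hu0 s hs).ge, (hu s hs).le]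
  have hval : ∀ z ∈ slackPolytope ℓ, c (f z) = ∑ i, μ i - u ⬝ᵥ z := fun z hz => by
    have := hc z
    simp only [hz.2, mul_one] at this
    linarith
  have hnonneg : ∀ z ∈ slackPolytope ℓ, 0 ≤ u ⬝ᵥ z := fun z hz =>
    Finset.sum_nonneg fun s _ => mul_nonneg (hu' s) (hz.1 s)
  have hzero : ∀ z ∈ slackPolytope ℓ, z ∈ faceOn ℓ J ↔ u ⬝ᵥ z = 0 := fun z hz => by
    rw [dotProduct, Finset.sum_eq_zero_iff_of_nonneg fun s _ => mul_nonneg (hu' s) (hz.1 s)]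
    refine ⟨fun h s _ => ?_, fun h => ⟨hz, fun s hs => ?_⟩⟩
    · by_cases hs : s ∈ J
      · simp [hu0 s hs]
      · simp [h.2 s hs]
    · exact (mul_eq_zero.1 (h s (Finset.mem_univ s))).resolve_left (hu s hs).ne'
  refine ⟨c, fun z hz => ?_⟩
  rw [hzero z hz]
  refine ⟨fun h w hw => ?_, fun h => ?_⟩
  · rw [hval z hz, hval w hw, h]
    linarith [hnonneg w hw]
  · obtain ⟨w, hw⟩ := hne
    have h1 := h w hw.1
    rw [hval z hz, hval w hw.1, (hzero w hw.1).1 hw] at h1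
    linarith [hnonneg z hz]

theorem Exposes.isFace {J : Finset T} (h : Exposes ℓ f J) (hne : (faceOn ℓ J).Nonempty) :
    IsFace (f '' slackPolytope ℓ) (f '' faceOn ℓ J) := by
  obtain ⟨c, hc⟩ := h.mem_faceOn_iff hne
  refine ⟨hne.image f, c, ?_⟩
  ext y
  constructor
  · rintro ⟨z, hz, rfl⟩
    refine ⟨⟨z, hz.1, rfl⟩, ?_⟩
    rintro _ ⟨w, hw, rfl⟩
    exact (hc z hz.1).1 hz w hw
  · rintro ⟨⟨z, hz, rfl⟩, h⟩
    exact ⟨z, (hc z hz).2 fun w hw => h _ ⟨w, hw, rfl⟩, rfl⟩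

theorem IsSignedTriangular.image_subset_image_iff (h : IsSignedTriangular β ℓ) {J K : Finset T}
    (hJ : MeetsBlocks β J) (hK : MeetsBlocks β K) (hexp : Exposes ℓ f K) :
    f '' faceOn ℓ J ⊆ f '' faceOn ℓ K ↔ J ⊆ K := by
  constructor
  · intro hsub s hs
    obtain ⟨z, hz, hpos, hzero⟩ := h.exists_support hJ
    obtain ⟨w, hw, -, hwzero⟩ := h.exists_support hK
    obtain ⟨c, hc⟩ := hexp.mem_faceOn_iff ⟨w, hw, hwzero⟩
    obtain ⟨v, hv, hvz⟩ := hsub ⟨z, ⟨hz, hzero⟩, rfl⟩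
    have hzK : z ∈ faceOn ℓ K := (hc z hz).2 fun y hy => hvz ▸ (hc v hv.1).1 hv y hy
    by_contra hcon
    exact (hpos s hs).ne' (hzK.2 s hcon)
  · intro hsub
    exact Set.image_mono fun z hz => ⟨hz.1, fun s hs => hz.2 s fun h => hs (hsub h)⟩

theorem exists_card_eq_meetsBlocks {T : Type*} {β : T → Fin r} {J : Finset T}
    (hJ : MeetsBlocks β J) {m : ℕ} (hrm : r ≤ m)
    (hm : m ≤ J.card) : ∃ K ⊆ J, MeetsBlocks β K ∧ K.card = m := by
  classical
  choose τ hτJ hτ using hJ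
  have hinj : Function.Injective τ := fun i i' hii => by rw [← hτ i, hii, hτ]
  have hsub : Finset.univ.image τ ⊆ J := by
    intro s hs
    obtain ⟨i, -, rfl⟩ := Finset.mem_image.1 hs
    exact hτJ i
  obtain ⟨K, h1, h2, h3⟩ := Finset.exists_subsuperset_card_eq hsub
    (by rwa [Finset.card_image_of_injective _ hinj, Finset.card_univ, Fintype.card_fin]) hm
  exact ⟨K, h2, fun i => ⟨τ i, h1 (Finset.mem_image_of_mem τ (Finset.mem_univ i)), hτ i⟩, h3⟩

/-- If `f` exposes all faces `J` with at most `m` elements, then it is injective on the directions of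
the faces with at most `m + 1` elements. -/
theorem IsTriangular.disjoint_ker_dirOn (h : IsTriangular β ℓ) {m : ℕ}
    (hexp : ∀ J, MeetsBlocks β J → J.card ≤ m → Exposes ℓ f J) {J : Finset T}
    (hJ : MeetsBlocks β J) (hm : J.card ≤ m + 1) {x : T → ℝ} (hx : x ∈ dirOn ℓ J)
    (hfx : f x = 0) : x = 0 := by
  classical
  choose τ hτJ hτ using hJ
  refine h.eq_zero_of_transversal (τ := τ) hx.2 fun s hs => ?_
  by_cases hsJ : s ∈ J
  · have hmeets : MeetsBlocks β (J.erase s) := fun i => by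
      refine ⟨τ i, Finset.mem_erase.2 ⟨fun hcon => hs ?_, hτJ i⟩, hτ i⟩
      rw [← hcon, hτ]
    obtain ⟨c, u, μ, hc, hu0, hu⟩ := hexp _ hmeets (by rw [Finset.card_erase_of_mem hsJ]; omega)
    have h1 := hc x
    simp only [hfx, map_zero, hx.2, mul_zero, Finset.sum_const_zero, zero_add] at h1
    rw [dotProduct, Finset.sum_eq_single s] at h1
    · exact (mul_eq_zero.1 h1).resolve_left (hu s (Finset.notMem_erase s J)).ne'
    · intro s' _ hne
      by_cases hs' : s' ∈ J
      · rw [hu0 s' (Finset.mem_erase.2 ⟨hne, hs'⟩), zero_mul]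
      · rw [hx.1 s' hs', mul_zero]
    · simp
  · exact hx.1 s hsJ

/-- The `k`-skeleton of a projection that exposes all faces of dimension at most `k`. -/
theorem IsSignedTriangular.skel_image (h : IsSignedTriangular β ℓ) [Module.Finite ℝ E] (k : ℕ)
    (hexp : ∀ J, MeetsBlocks β J → J.card ≤ k + r → Exposes ℓ f J) :
    Nonempty (skel k (f '' slackPolytope ℓ) ≃o
      {J : Finset T // MeetsBlocks β J ∧ J.card ≤ k + r}) := by
  have hne : ∀ J : Finset T, MeetsBlocks β J → (faceOn ℓ J).Nonempty := fun J hJ => by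
    obtain ⟨z, hz, -, hz'⟩ := h.exists_support hJ
    exact ⟨z, hz, hz'⟩
  let φ : {J : Finset T // MeetsBlocks β J ∧ J.card ≤ k + r} ↪o
      skel k (f '' slackPolytope ℓ) :=
    OrderEmbedding.ofMapLEIff
      (fun J => ⟨f '' faceOn ℓ J.1, (hexp J.1 J.2.1 J.2.2).isFace (hne _ J.2.1), by
        have := polyDim_image_faceOn_le h.toIsTriangular f J.2.1
        have := J.2.2
        omega⟩)
      fun J K => h.image_subset_image_iff J.2.1 K.2.1 (hexp K.1 K.2.1 K.2.2)
  refine ⟨(RelIso.ofSurjective φ ?_).symm⟩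
  rintro ⟨G, ⟨hGne, g, hG⟩, hGdim⟩
  set F := {z ∈ slackPolytope ℓ | ∀ w ∈ slackPolytope ℓ, (g.comp f) w ≤ (g.comp f) z} with hF
  have hGF : G = f '' F := by
    rw [hG]
    ext y
    constructor
    · rintro ⟨⟨z, hz, rfl⟩, hmax⟩
      exact ⟨z, ⟨hz, fun w hw => hmax _ ⟨w, hw, rfl⟩⟩, rfl⟩
    · rintro ⟨z, ⟨hz, hmax⟩, rfl⟩
      refine ⟨⟨z, hz, rfl⟩, ?_⟩
      rintro _ ⟨w, hw, rfl⟩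
      exact hmax w hw
  have hFface : IsFace (slackPolytope ℓ) F := by
    refine ⟨?_, g.comp f, rfl⟩
    rw [hGF] at hGne
    exact hGne.of_image
  obtain ⟨J, hJ, hFJ⟩ := h.exists_faceOn hFface
  rw [hFJ] at hGF
  have hcard : J.card ≤ k + r := by
    by_contra! hcon
    obtain ⟨K, hKJ, hK, hKcard⟩ := exists_card_eq_meetsBlocks hJ (m := k + r + 1) (by omega) hcon
    obtain ⟨z, hz, hpos, hzero⟩ := h.exists_support hJ
    have h1 : (dirOn ℓ K).map f ≤ (affineSpan ℝ G).direction := by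
      rw [hGF]
      refine le_trans (Submodule.map_mono fun x hx => ?_)
        (map_dirOn_le_direction ⟨hz, hzero⟩ hpos)
      exact ⟨fun s hs => hx.1 s fun h => hs (hKJ h), hx.2⟩
    have h2 := Submodule.finrank_mono h1
    have hinj : Function.Injective (f.domRestrict (dirOn ℓ K)) := by
      rw [← LinearMap.ker_eq_bot, LinearMap.ker_eq_bot']
      exact fun x hx => Subtype.ext
        (h.toIsTriangular.disjoint_ker_dirOn hexp hK hKcard.le x.2 hx)
    have h3 := LinearMap.finrank_range_of_inj hinj
    rw [LinearMap.range_domRestrict] at h3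
    have h4 := card_le_finrank_dirOn ℓ K
    have h5 : Module.finrank ℝ (affineSpan ℝ G).direction ≤ k := hGdim
    omega
  exact ⟨⟨J, hJ, hcard⟩, Subtype.ext hGF.symm⟩

theorem IsSignedTriangular.facesOf_image (h : IsSignedTriangular β ℓ) [Module.Finite ℝ E]
    (hexp : ∀ J, MeetsBlocks β J → Exposes ℓ f J) :
    Nonempty (facesOf (f '' slackPolytope ℓ) ≃o {J : Finset T // MeetsBlocks β J}) := by
  set k := Module.finrank ℝ E + Fintype.card T
  obtain ⟨e⟩ := h.skel_image k fun J hJ _ => hexp J hJ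
  have h1 : facesOf (f '' slackPolytope ℓ) = skel k (f '' slackPolytope ℓ) := by
    ext F
    refine ⟨fun hF => ⟨hF, (Submodule.finrank_le _).trans (by omega)⟩, fun hF => hF.1⟩
  have h2 : ∀ J : Finset T, J.card ≤ k + r := fun J => J.card_le_univ.trans (by omega)
  have h3 : (fun J : Finset T => MeetsBlocks β J) =
      fun J => MeetsBlocks β J ∧ J.card ≤ k + r := by
    funext J
    simp [h2 J]
  rw [h1]
  refine ⟨e.trans ?_⟩
  change {J // (fun J : Finset T => MeetsBlocks β J ∧ J.card ≤ k + r) J} ≃o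
    {J // (fun J : Finset T => MeetsBlocks β J) J}
  rw [h3]

theorem exposes_of_injective (hf : Function.Injective f) (J : Finset T) : Exposes ℓ f J := by
  classical
  obtain ⟨g, hg⟩ := f.exists_leftInverse_of_injective (LinearMap.ker_eq_bot.2 hf)
  refine ⟨-(∑ s, if s ∈ J then 0 else (LinearMap.proj s).comp g),
    fun s => if s ∈ J then 0 else 1, 0, fun z => ?_, fun s hs => by simp [hs],
    fun s hs => by simp [hs]⟩
  have hgz : g (f z) = z := LinearMap.congr_fun hg z
  simp only [LinearMap.neg_apply, LinearMap.sum_apply, dotProduct, Pi.zero_apply, zero_mul,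
    Finset.sum_const_zero, neg_add_eq_zero]
  refine Finset.sum_congr rfl fun s _ => ?_
  split_ifs <;> simp [hgz]

end Projection

end SlackPolytope

section Construction

open scoped Matrix

theorem IsTriangular.exists_isSignedTriangular {T : Type*} [Finite T] {r : ℕ} {β : T → Fin r}
    {ℓ : Fin r → T → ℝ} (h : IsTriangular β ℓ) :
    ∃ ℓ' : Fin r → T → ℝ, IsSignedTriangular β ℓ' ∧
      ∀ i, ℓ' i ∈ Submodule.span ℝ (Set.range ℓ) := by
  cases nonempty_fintype T
  set C : ℝ := ∑ i, ∑ s, |ℓ i s| with hC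
  have hC0 : 0 ≤ C := Finset.sum_nonneg fun i _ => Finset.sum_nonneg fun s _ => abs_nonneg _
  have hle : ∀ i s, |ℓ i s| ≤ C := fun i s =>
    (Finset.single_le_sum (f := fun s => |ℓ i s|) (fun _ _ => abs_nonneg _)
      (Finset.mem_univ s)).trans
    (Finset.single_le_sum (f := fun i => ∑ s, |ℓ i s|)
      (fun _ _ => Finset.sum_nonneg fun _ _ => abs_nonneg _) (Finset.mem_univ i))
  obtain ⟨K, hK, hK1⟩ : ∃ K : ℝ, (∀ s, (r + 1) * C ≤ K * ℓ (β s) s) ∧ 1 ≤ K := by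
    refine Filter.Eventually.exists (f := Filter.atTop) (Filter.Eventually.and ?_
      (Filter.eventually_ge_atTop 1))
    rw [Filter.eventually_all]
    exact fun s => (Filter.tendsto_id.atTop_mul_const (h.pos _ s rfl)).eventually_ge_atTop _
  refine ⟨fun i => ℓ i - ∑ i' with i < i', K ^ (i' : ℕ) • ℓ i', ⟨⟨fun i s hs => ?_,
    fun i s hs => ?_⟩, fun i s hs => ?_⟩, fun i => ?_⟩
  · simp only [Pi.sub_apply, Finset.sum_apply, Pi.smul_apply, smul_eq_mul]
    rw [h.zero i s hs, Finset.sum_eq_zero, sub_zero]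
    intro i' hi'
    rw [h.zero i' s (hs.trans (Finset.mem_filter.1 hi').2), mul_zero]
  · simp only [Pi.sub_apply, Finset.sum_apply, Pi.smul_apply, smul_eq_mul]
    rw [Finset.sum_eq_zero, sub_zero]
    · exact h.pos i s hs
    · intro i' hi'
      rw [h.zero i' s (hs ▸ (Finset.mem_filter.1 hi').2), mul_zero]
  · simp only [Pi.sub_apply, Finset.sum_apply, Pi.smul_apply, smul_eq_mul]
    have hβ : (0 : ℕ) < β s := lt_of_le_of_lt (Nat.zero_le _) hs
    have hpow : K ^ (β s : ℕ) = K ^ ((β s : ℕ) - 1) * K := by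
      rw [← pow_succ, Nat.sub_add_cancel hβ]
    have hP : 1 ≤ K ^ ((β s : ℕ) - 1) := one_le_pow₀ hK1
    rw [← Finset.add_sum_erase _ _ (Finset.mem_filter.2 ⟨Finset.mem_univ (β s), hs⟩)]
    have hsum : -(r * (K ^ ((β s : ℕ) - 1) * C)) ≤
        ∑ x ∈ (Finset.univ.filter fun i' => i < i').erase (β s), K ^ (x : ℕ) * ℓ x s := by
      have hterm : ∀ x ∈ (Finset.univ.filter fun i' => i < i').erase (β s),
          -(K ^ ((β s : ℕ) - 1) * C) ≤ K ^ (x : ℕ) * ℓ x s := by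
        intro x hx
        rcases lt_or_gt_of_ne (Finset.ne_of_mem_erase hx) with hlt | hgt
        · have h1 : K ^ (x : ℕ) ≤ K ^ ((β s : ℕ) - 1) :=
            pow_le_pow_right₀ hK1 (by have : (x : ℕ) < β s := hlt; omega)
          have h2 : K ^ (x : ℕ) * -ℓ x s ≤ K ^ ((β s : ℕ) - 1) * C :=
            (mul_le_mul_of_nonneg_left ((neg_le_abs _).trans (hle x s)) (by positivity)).trans
              (mul_le_mul_of_nonneg_right h1 hC0)
          linarith
        · rw [h.zero x s hgt, mul_zero]
          have : 0 ≤ K ^ ((β s : ℕ) - 1) * C := by positivity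
          linarith
      have h1 := Finset.card_nsmul_le_sum _ _ _ hterm
      have h2 : (((Finset.univ.filter fun i' => i < i').erase (β s)).card : ℝ) ≤ r := by
        have := Finset.card_le_univ ((Finset.univ.filter fun i' => i < i').erase (β s))
        rw [Fintype.card_fin] at this
        exact_mod_cast this
      rw [nsmul_eq_mul] at h1
      have h3 : 0 ≤ K ^ ((β s : ℕ) - 1) * C := by positivity
      nlinarith
    have h1 : ℓ i s ≤ K ^ ((β s : ℕ) - 1) * C :=
      ((le_abs_self _).trans (hle i s)).trans (le_mul_of_one_le_left hC0 hP)
    have h2 := mul_le_mul_of_nonneg_left (hK s) (zero_le_one.trans hP)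
    rw [hpow]
    linarith
  · refine Submodule.sub_mem _ (Submodule.subset_span ⟨i, rfl⟩)
      (Submodule.sum_mem _ fun i' _ => Submodule.smul_mem _ _ (Submodule.subset_span ⟨i', rfl⟩))

theorem IsTriangular.linearIndependent {T : Type*} {r : ℕ} {β : T → Fin r}
    (hβ : Function.Surjective β) {ℓ : Fin r → T → ℝ} (h : IsTriangular β ℓ) :
    LinearIndependent ℝ ℓ := by
  rw [Fintype.linearIndependent_iff]
  intro g hg i
  induction i using WellFoundedLT.induction with
  | _ i ih =>
    obtain ⟨s, hs⟩ := hβ i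
    have h1 := congrFun hg s
    rw [Finset.sum_apply, Finset.sum_eq_single i] at h1
    · exact (mul_eq_zero.1 h1).resolve_right (h.pos i s hs).ne'
    · intro j _ hj
      rcases lt_or_gt_of_ne hj with hlt | hgt
      · simp [ih j hlt]
      · simp [h.zero j s (hs ▸ hgt)]
    · simp

theorem exists_linearIndependent_sumElim {E : Type*} [AddCommGroup E] [Module ℝ E]
    [FiniteDimensional ℝ E] {r d : ℕ} {ℓ : Fin r → E} (hℓ : LinearIndependent ℝ ℓ)
    (U : Submodule ℝ E) (hmem : ∀ i, ℓ i ∈ U) (hU : Module.finrank ℝ U ≤ d + r)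
    (hd : d + r ≤ Module.finrank ℝ E) :
    ∃ w : Fin d → E, LinearIndependent ℝ (Sum.elim ℓ w) ∧
      U ≤ Submodule.span ℝ (Set.range (Sum.elim ℓ w)) := by
  classical
  have hs : LinearIndepOn ℝ id (Set.range ℓ) := hℓ.linearIndepOn_id
  obtain ⟨b₁, hb₁U, hℓb₁, hUb₁, hb₁⟩ :=
    exists_linearIndepOn_id_extension hs (t := (U : Set E)) (by rintro _ ⟨i, rfl⟩; exact hmem i)
  obtain ⟨b₂, -, hb₁₂, hb₂span, hb₂⟩ := exists_linearIndepOn_id_extension hb₁ (Set.subset_univ _)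
  have hfin₂ : b₂.Finite := hb₂.linearIndependent.setFinite
  have hfin₁ : b₁.Finite := hfin₂.subset hb₁₂
  lift b₂ to Finset E using hfin₂
  lift b₁ to Finset E using hfin₁
  have hc₁ : b₁.card ≤ d + r := by
    rw [← finrank_span_finset_eq_card hb₁]
    exact (Submodule.finrank_mono (Submodule.span_le.2 hb₁U)).trans hU
  have hc₂ : d + r ≤ b₂.card := by
    rw [← finrank_span_finset_eq_card hb₂,
      (Submodule.eq_top_iff'.2 fun x => hb₂span (Set.mem_univ x)), finrank_top]
    exact hd
  obtain ⟨b₃, h13, h32, hc₃⟩ :=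
    Finset.exists_subsuperset_card_eq (Finset.coe_subset.1 hb₁₂) hc₁ hc₂
  have himg : Finset.univ.image ℓ ⊆ b₃ := by
    intro x hx
    obtain ⟨i, -, rfl⟩ := Finset.mem_image.1 hx
    exact h13 (hℓb₁ ⟨i, rfl⟩)
  have hcard : (b₃ \ Finset.univ.image ℓ).card = d := by
    have := Finset.card_sdiff_add_card_eq_card himg
    rw [Finset.card_image_of_injective _ hℓ.injective, Finset.card_univ, Fintype.card_fin] at this
    omega
  let e := (Finset.equivFinOfCardEq hcard).symm
  have hrange : Set.range (Sum.elim ℓ fun i => (e i : E)) = b₃ := by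
    ext x
    simp only [Set.Sum.elim_range, Set.mem_union, Set.mem_range, Finset.mem_coe]
    constructor
    · rintro (⟨i, rfl⟩ | ⟨i, rfl⟩)
      · exact himg (Finset.mem_image_of_mem _ (Finset.mem_univ i))
      · exact (Finset.mem_sdiff.1 (e i).2).1
    · intro hx
      by_cases hx' : x ∈ Finset.univ.image ℓ
      · obtain ⟨i, -, hi⟩ := Finset.mem_image.1 hx'
        exact Or.inl ⟨i, hi⟩
      · exact Or.inr ⟨e.symm ⟨x, Finset.mem_sdiff.2 ⟨hx, hx'⟩⟩, by simp⟩
  have hinj : Function.Injective (Sum.elim ℓ fun i => (e i : E)) := by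
    refine hℓ.injective.sumElim (Subtype.val_injective.comp e.injective) fun i j hij => ?_
    exact (Finset.mem_sdiff.1 (e j).2).2
      (hij ▸ Finset.mem_image_of_mem _ (Finset.mem_univ i))
  refine ⟨fun i => e i, ?_, ?_⟩
  · rw [← linearIndepOn_id_range_iff hinj, hrange]
    exact hb₂.mono (Finset.coe_subset.2 h32)
  · rw [hrange]
    exact fun x hx => Submodule.span_mono (Finset.coe_subset.2 h13) (hUb₁ hx)

theorem polyDim_image_eq_of_surjective {T : Type*} [Fintype T] {r d : ℕ} {β : T → Fin r}
    {ℓ : Fin r → T → ℝ} (h : IsSignedTriangular β ℓ) (hβ : Function.Surjective β)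
    {w : Fin d → T → ℝ} (hw : LinearIndependent ℝ (Sum.elim ℓ w)) :
    polyDim ((Matrix.of w).mulVecLin '' slackPolytope ℓ) = d := by
  have htop : (dirOn ℓ Finset.univ).map (Matrix.of w).mulVecLin = ⊤ := by
    rw [eq_top_iff]
    rintro y -
    have hsurj : LinearMap.range (Matrix.of (Sum.elim ℓ w)).mulVecLin = ⊤ := by
      apply Submodule.eq_top_of_finrank_eq
      rw [← Matrix.rank, Module.finrank_fintype_fun_eq_card]
      exact LinearIndependent.rank_matrix hw
    obtain ⟨x, hx⟩ := LinearMap.range_eq_top.1 hsurj (Sum.elim 0 y)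
    refine ⟨x, ⟨by simp, fun i => congrFun hx (Sum.inl i)⟩, ?_⟩
    ext i
    exact congrFun hx (Sum.inr i)
  obtain ⟨z, hz, hpos, hzero⟩ := h.exists_support (J := Finset.univ)
    fun i => (hβ i).imp fun s hs => ⟨Finset.mem_univ s, hs⟩
  have h1 := map_dirOn_le_direction (f := (Matrix.of w).mulVecLin) (ℓ := ℓ) ⟨hz, hzero⟩ hpos
  have h2 : faceOn ℓ Finset.univ = slackPolytope ℓ := by
    ext z; simp [faceOn]
  rw [htop, h2, top_le_iff] at h1
  rw [polyDim, h1, finrank_top, Module.finrank_fintype_fun_eq_card, Fintype.card_fin]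

/-- The equations of the product of standard simplices. -/
def blockIndicator {r : ℕ} (n : Fin r → ℕ) (i : Fin r) (s : (i : Fin r) × Fin (n i + 1)) : ℝ :=
  if s.1 = i then 1 else 0

theorem isSignedTriangular_blockIndicator {r : ℕ} (n : Fin r → ℕ) :
    IsSignedTriangular Sigma.fst (blockIndicator n) where
  zero i s hs := if_neg hs.ne
  pos i s hs := by simp [blockIndicator, hs]
  nonpos i s hs := (if_neg hs.ne').le

/-- Currying, as a linear map. -/
def sigmaCurry {r : ℕ} (n : Fin r → ℕ) :
    ((i : Fin r) × Fin (n i + 1) → ℝ) →ₗ[ℝ] ((i : Fin r) → Fin (n i + 1) → ℝ) where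
  toFun z i j := z ⟨i, j⟩
  map_add' _ _ := rfl
  map_smul' _ _ := rfl

theorem sigmaCurry_injective {r : ℕ} (n : Fin r → ℕ) : Function.Injective (sigmaCurry n) := by
  intro z w h
  ext ⟨i, j⟩
  exact congrFun (congrFun h i) j

theorem image_sigmaCurry {r : ℕ} (n : Fin r → ℕ) :
    sigmaCurry n '' slackPolytope (blockIndicator n) = prodSimplex n := by
  have hdot : ∀ z i, blockIndicator n i ⬝ᵥ z = ∑ j, z ⟨i, j⟩ := fun z i => by
    rw [dotProduct, Fintype.sum_sigma, Finset.sum_eq_single i]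
    · simp [blockIndicator]
    · intro i' _ hne
      simp [blockIndicator, hne]
    · simp
  ext x
  simp only [prodSimplex, Set.mem_univ_pi, stdSimplex, Set.mem_ofPred_eq]
  constructor
  · rintro ⟨z, hz, rfl⟩ i
    exact ⟨fun j => hz.1 ⟨i, j⟩, (hdot z i).symm.trans (hz.2 i)⟩
  · intro hx
    exact ⟨fun s => x s.1 s.2, ⟨fun s => (hx s.1).1 s.2,
      fun i => (hdot _ i).trans (hx i).2⟩, rfl⟩

/-- A space `U` of functionals containing a block triangular family and exposing all small faces
yields a projected prodsimplicial-neighborly polytope. -/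
theorem exists_isPPSN_of_submodule {r k d : ℕ} (n : Fin r → ℕ) (hd : d ≤ ∑ i, n i)
    (U : Submodule ℝ ((i : Fin r) × Fin (n i + 1) → ℝ)) (hU : Module.finrank ℝ U ≤ d + r)
    {ℓ : Fin r → (i : Fin r) × Fin (n i + 1) → ℝ} (hℓ : IsTriangular Sigma.fst ℓ)
    (hmem : ∀ i, ℓ i ∈ U)
    (hexp : ∀ J : Finset ((i : Fin r) × Fin (n i + 1)), MeetsBlocks Sigma.fst J →
      J.card ≤ k + r → ∃ u ∈ U, (∀ s ∈ J, u s = 0) ∧ ∀ s ∉ J, 0 < u s) :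
    ∃ P : Set (Fin d → ℝ), IsPPSN k n P ∧ polyDim P = d := by
  obtain ⟨ℓ', hℓ', hspan⟩ := hℓ.exists_isSignedTriangular
  have hsurj : Function.Surjective
      (Sigma.fst : (i : Fin r) × Fin (n i + 1) → Fin r) := fun i => ⟨⟨i, 0⟩, rfl⟩
  obtain ⟨w, hw, hUw⟩ := exists_linearIndependent_sumElim
    (hℓ'.toIsTriangular.linearIndependent hsurj) U
    (fun i => Submodule.span_le.2 (by rintro _ ⟨j, rfl⟩; exact hmem j) (hspan i)) hU
    (by
      rw [Module.finrank_fintype_fun_eq_card, Fintype.card_sigma]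
      simp only [Fintype.card_fin, Finset.sum_add_distrib, Finset.sum_const, Finset.card_univ,
        smul_eq_mul, mul_one]
      omega)
  set f := (Matrix.of w).mulVecLin with hf
  have hexp' : ∀ J, MeetsBlocks Sigma.fst J → J.card ≤ k + r → Exposes ℓ' f J := by
    intro J hJ hcard
    obtain ⟨u, hu, hu0, hupos⟩ := hexp J hJ hcard
    obtain ⟨a, ha⟩ := (Submodule.mem_span_range_iff_exists_fun ℝ).1 (hUw hu)
    rw [Fintype.sum_sum_type] at ha
    refine ⟨-∑ m, a (Sum.inr m) • LinearMap.proj m, u, fun i => a (Sum.inl i),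
      fun z => ?_, hu0, hupos⟩
    rw [← ha]
    simp [add_dotProduct, sum_dotProduct, hf, Matrix.mulVec]
  let e := Fintype.equivFin ((i : Fin r) × Fin (n i + 1))
  let g : ((i : Fin r) × Fin (n i + 1) → ℝ) ≃ₗ[ℝ] (Fin _ → ℝ) :=
    LinearEquiv.funCongrLeft ℝ ℝ e.symm
  have himg : ∀ {A B : Type} [AddCommGroup A] [Module ℝ A] [AddCommGroup B] [Module ℝ B]
      (φ : A →ₗ[ℝ] B) {P : Set A}, IsPolytope P → IsPolytope (φ '' P) := by
    classical
    rintro A B _ _ _ _ φ _ ⟨V, rfl⟩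
    exact ⟨V.image φ, by rw [Finset.coe_image, φ.image_convexHull]⟩
  have hstd := exposes_of_injective (ℓ := blockIndicator n) (sigmaCurry_injective n)
  obtain ⟨e₁⟩ := hℓ'.skel_image k hexp'
  obtain ⟨e₂⟩ := (isSignedTriangular_blockIndicator n).skel_image k fun J _ _ => hstd J
  obtain ⟨e₃⟩ := hℓ'.facesOf_image (f := g.toLinearMap) fun J _ =>
    exposes_of_injective g.injective J
  obtain ⟨e₄⟩ := (isSignedTriangular_blockIndicator n).facesOf_image fun J _ => hstd J
  rw [image_sigmaCurry] at e₂ e₄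
  refine ⟨f '' slackPolytope ℓ', ⟨⟨himg f hℓ'.isPolytope, ⟨e₁.trans e₂.symm⟩⟩,
    _, g '' slackPolytope ℓ', f.comp g.symm.toLinearMap, himg g.toLinearMap hℓ'.isPolytope, ?_,
    ⟨e₃.trans e₄.symm⟩⟩, polyDim_image_eq_of_surjective hℓ' hsurj hw⟩
  rw [← Set.image_comp]
  congr 1
  ext z : 1
  simp

end Construction

section Perturbation

open scoped Topology

variable {T : Type*} [DecidableEq T]

/-- Exposing functionals for all subsets of `J` survive, for `J`, small perturbations of the
spanning family. -/
theorem eventually_exists_vanishing [Fintype T] {κ : Type*} [Fintype κ] {b : ℝ → κ → T → ℝ}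
    (hb : ∀ j s, Continuous fun ε => b ε j s) {J : Finset T}
    (h : ∀ K ⊆ J, ∃ u ∈ Submodule.span ℝ (Set.range (b 0)),
      (∀ s ∈ K, u s = 0) ∧ ∀ s ∉ K, 0 < u s) :
    ∀ᶠ ε in 𝓝 0, ∃ u ∈ Submodule.span ℝ (Set.range (b ε)),
      (∀ s ∈ J, u s = 0) ∧ ∀ s ∉ J, 0 < u s := by
  have h' : ∀ K : Finset T, ∃ a : κ → ℝ, K ⊆ J → (∀ s ∈ K, (∑ j, a j • b 0 j) s = 0) ∧
      ∀ s ∉ K, 0 < (∑ j, a j • b 0 j) s := fun K => by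
    by_cases hK : K ⊆ J
    · obtain ⟨u, hu, hu'⟩ := h K hK
      obtain ⟨a, rfl⟩ := (Submodule.mem_span_range_iff_exists_fun ℝ).1 hu
      exact ⟨a, fun _ => hu'⟩
    · exact ⟨0, fun h => absurd h hK⟩
  choose a ha using h'
  let v : Finset T → ℝ → T → ℝ := fun K ε => ∑ j, a K j • b ε j
  have hv : ∀ K s, Continuous fun ε => v K ε s := fun K s => by
    simp only [v, Finset.sum_apply, Pi.smul_apply, smul_eq_mul]
    exact continuous_finsetSum _ fun j _ => continuous_const.mul (hb j s)
  have hvmem : ∀ K ε, v K ε ∈ Submodule.span ℝ (Set.range (b ε)) := fun K ε =>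
    Submodule.sum_mem _ fun j _ => Submodule.smul_mem _ _ (Submodule.subset_span ⟨j, rfl⟩)
  let M : ℝ → Matrix J J ℝ := fun ε => Matrix.of fun s' s => v (J.erase s) ε s'
  let x : ℝ → J → ℝ := fun ε => (M ε).cramer fun s => v J ε s
  let u : ℝ → T → ℝ := fun ε => (M ε).det • v J ε - ∑ s, x ε s • v (J.erase s) ε
  have hM : Continuous M := continuous_matrix fun s' s => hv _ _
  have hx : Continuous x := hM.matrix_cramer (continuous_pi fun s => hv _ _)
  have hu : ∀ t, Continuous fun ε => u ε t := fun t => by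
    simp only [u, Pi.sub_apply, Finset.sum_apply, Pi.smul_apply, smul_eq_mul]
    exact (hM.matrix_det.mul (hv _ _)).sub
      (continuous_finsetSum _ fun s _ => ((continuous_apply s).comp hx).mul (hv _ _))
  have hx0 : x 0 = 0 := by
    have : (fun s : J => v J 0 s) = 0 := funext fun s => (ha J subset_rfl).1 s s.2
    simp only [x, this, map_zero]
  have hdet : 0 < (M 0).det := by
    have hdiag : M 0 = Matrix.diagonal fun s : J => v (J.erase s) 0 s := by
      ext s' s
      by_cases hss : s' = s
      · subst hss; simp [M]
      · rw [Matrix.diagonal_apply_ne _ hss]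
        exact (ha _ (Finset.erase_subset _ _)).1 _
          (Finset.mem_erase.2 ⟨fun h => hss (Subtype.ext h), s'.2⟩)
    rw [hdiag, Matrix.det_diagonal]
    exact Finset.prod_pos fun s _ =>
      (ha _ (Finset.erase_subset _ _)).2 _ (Finset.notMem_erase _ _)
  have hpos : ∀ᶠ ε in 𝓝 (0 : ℝ), ∀ t, t ∉ J → 0 < u ε t := by
    rw [Filter.eventually_all]
    intro t
    by_cases ht : t ∈ J
    · exact Filter.Eventually.of_forall fun _ h => absurd ht h
    · have h0 : 0 < u 0 t := by
        simp only [u, hx0, Pi.zero_apply, zero_smul, Finset.sum_const_zero, sub_zero,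
          Pi.smul_apply, smul_eq_mul]
        exact mul_pos hdet ((ha J subset_rfl).2 t ht)
      exact ((hu t).tendsto 0 |>.eventually (lt_mem_nhds h0)).mono fun _ h _ => h
  refine hpos.mono fun ε hε => ⟨u ε, Submodule.sub_mem _ (Submodule.smul_mem _ _ (hvmem _ _))
    (Submodule.sum_mem _ fun s _ => Submodule.smul_mem _ _ (hvmem _ _)), fun t ht => ?_, hε⟩
  have h1 := congrFun (Matrix.mulVec_cramer (M ε) fun s => v J ε s) ⟨t, ht⟩
  simp only [Matrix.mulVec, dotProduct, M, Matrix.of_apply, Pi.smul_apply, smul_eq_mul] at h1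
  simp only [u, Pi.sub_apply, Finset.sum_apply, Pi.smul_apply, smul_eq_mul]
  rw [← h1, sub_eq_zero]
  exact Finset.sum_congr rfl fun s _ => mul_comm _ _

/-- The values of a polynomial at the points `p s`, for `s ∈ W`. -/
noncomputable def evalVec (W : Finset T) (p : T → ℝ) : Polynomial ℝ →ₗ[ℝ] (T → ℝ) where
  toFun g s := if s ∈ W then g.eval (p s) else 0
  map_add' g g' := by ext s; by_cases h : s ∈ W <;> simp [h]
  map_smul' c g := by ext s; by_cases h : s ∈ W <;> simp [h]

theorem evalVec_apply (W : Finset T) (p : T → ℝ) (g : Polynomial ℝ) (s : T) :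
    evalVec W p g s = if s ∈ W then g.eval (p s) else 0 := rfl

theorem evalVec_eq_sum (W : Finset T) (p : T → ℝ) {g : Polynomial ℝ} {N : ℕ}
    (hg : g.natDegree < N) :
    evalVec W p g = ∑ m ∈ Finset.range N, g.coeff m • evalVec W p (Polynomial.X ^ m) := by
  conv_lhs => rw [g.as_sum_range' N hg]
  rw [map_sum]
  refine Finset.sum_congr rfl fun m _ => ?_
  rw [← map_smul, Polynomial.smul_X_eq_monomial]

theorem evalVec_mem {U : Submodule ℝ (T → ℝ)} {W : Finset T} {p : T → ℝ} {N : ℕ}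
    (hU : ∀ m < N, evalVec W p (Polynomial.X ^ m) ∈ U) {g : Polynomial ℝ}
    (hg : g.natDegree < N) : evalVec W p g ∈ U := by
  rw [evalVec_eq_sum W p hg]
  exact Submodule.sum_mem _ fun m hm => Submodule.smul_mem _ _ (hU m (Finset.mem_range.1 hm))

/-- The unperturbed space of functionals: it contains the values of all polynomials of degree less
than `N` at the points `p s`, `s ∈ W`; elements of `A` are twins of elements of `W`, and the
remaining coordinates are free. -/
structure IsCyclicSpace (W A : Finset T) (σ : T → T) (p : T → ℝ) (N : ℕ)
    (U : Submodule ℝ (T → ℝ)) : Prop where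
  inj : Function.Injective p
  pow_mem : ∀ m < N, evalVec W p (Polynomial.X ^ m) ∈ U
  notMem : ∀ a ∈ A, a ∉ W
  twin_mem : ∀ a ∈ A, σ a ∈ W
  injOn : Set.InjOn σ A
  sub_mem : ∀ a ∈ A, Pi.single (σ a) 1 - Pi.single a 1 ∈ U
  single_mem : ∀ s, s ∉ W → s ∉ A → Pi.single s 1 ∈ U

/-- The points of `J ∩ W` at which an exposing polynomial has to vanish. -/
def rootsOn (W A : Finset T) (σ : T → T) (J : Finset T) : Finset T :=
  J.filter fun s => s ∈ W ∧ ∀ a ∈ A, σ a = s → a ∈ J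

theorem mem_rootsOn {W A : Finset T} {σ : T → T} {J : Finset T} {s : T} :
    s ∈ rootsOn W A σ J ↔ s ∈ J ∧ s ∈ W ∧ ∀ a ∈ A, σ a = s → a ∈ J :=
  Finset.mem_filter

theorem rootsOn_mono {W A : Finset T} {σ : T → T} {J K : Finset T} (h : K ⊆ J) :
    rootsOn W A σ K ⊆ rootsOn W A σ J := fun s hs => by
  rw [mem_rootsOn] at hs ⊢
  exact ⟨h hs.1, hs.2.1, fun a ha has => h (hs.2.2 a ha has)⟩

theorem IsCyclicSpace.exists_vanishing [Fintype T] {W A : Finset T} {σ : T → T} {p : T → ℝ} {N : ℕ}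
    {U : Submodule ℝ (T → ℝ)} (h : IsCyclicSpace W A σ p N U) {J : Finset T}
    (hJ : 2 * (rootsOn W A σ J).card < N) :
    ∃ u ∈ U, (∀ s ∈ J, u s = 0) ∧ ∀ s ∉ J, 0 < u s := by
  set R := rootsOn W A σ J with hR
  let g : Polynomial ℝ := ∏ x ∈ R, (Polynomial.X - Polynomial.C (p x)) ^ 2
  have hdeg : g.natDegree < N := by
    refine lt_of_le_of_lt ((Polynomial.natDegree_prod_le _ _).trans ?_) hJ
    refine (Finset.sum_le_card_nsmul _ _ 2 fun x _ => ?_).trans (by rw [smul_eq_mul, mul_comm])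
    exact Polynomial.natDegree_pow_le.trans (by rw [Polynomial.natDegree_X_sub_C])
  have hzero : ∀ s ∈ R, g.eval (p s) = 0 := fun s hs => by
    rw [Polynomial.eval_prod]
    exact Finset.prod_eq_zero hs (by simp)
  have hpos : ∀ s ∉ R, 0 < g.eval (p s) := fun s hs => by
    rw [Polynomial.eval_prod]
    refine Finset.prod_pos fun x hx => ?_
    have : p s - p x ≠ 0 := sub_ne_zero.2 fun hps => hs (h.inj hps ▸ hx)
    simp only [Polynomial.eval_pow, Polynomial.eval_sub, Polynomial.eval_X, Polynomial.eval_C]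
    positivity
  have hnotR : ∀ a ∈ A, a ∉ J → σ a ∉ R := fun a ha haJ hcon =>
    haJ ((mem_rootsOn.1 hcon).2.2 a ha rfl)
  let c : T → ℝ := fun a => if σ a ∈ J then g.eval (p (σ a)) else g.eval (p (σ a)) / 2
  let v : T → T → ℝ := fun a => c a • (Pi.single (σ a) 1 - Pi.single a 1)
  let u : T → ℝ := evalVec W p g - ∑ a ∈ A \ J, v a +
    ∑ s ∈ Finset.univ \ (J ∪ A ∪ W), Pi.single s 1
  have hu : ∀ t, u t = (if t ∈ W then g.eval (p t) else 0) - ∑ a ∈ A \ J, v a t +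
      if t ∉ J ∪ A ∪ W then 1 else 0 := fun t => by
    simp only [u, Pi.add_apply, Pi.sub_apply, Finset.sum_apply, evalVec_apply]
    congr 1
    rw [Finset.sum_pi_single]
    simp
  have hv : ∀ a t, v a t = c a * ((if t = σ a then 1 else 0) - if t = a then 1 else 0) :=
    fun a t => by simp [v, Pi.single_apply]
  have hval : ∀ t, (t ∈ J → u t = 0) ∧ (t ∉ J → 0 < u t) := by
    intro t
    rw [hu]
    by_cases htW : t ∈ W
    · have hne : ∀ a ∈ A, t ≠ a := fun a ha hta => h.notMem a ha (hta ▸ htW)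
      rw [if_pos htW, if_neg (by simp [htW]), add_zero]
      by_cases hex : ∃ a ∈ A \ J, σ a = t
      · obtain ⟨a, ha, rfl⟩ := hex
        have haA := (Finset.mem_sdiff.1 ha).1
        have haR := hpos _ (hnotR a haA (Finset.mem_sdiff.1 ha).2)
        rw [Finset.sum_eq_single_of_mem a ha, hv, if_pos rfl, if_neg (hne a haA)]
        · refine ⟨fun ht => by simp [c, ht], fun ht => ?_⟩
          simp only [c, ht, if_false]
          linarith
        · intro a' ha' hne'
          have ha'A := (Finset.mem_sdiff.1 ha').1
          rw [hv, if_neg (hne a' ha'A), if_neg fun he => hne' (h.injOn ha'A haA he.symm)]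
          simp
      · push Not at hex
        rw [Finset.sum_eq_zero, sub_zero]
        · refine ⟨fun ht => hzero t (mem_rootsOn.2 ⟨ht, htW, fun a ha hat => ?_⟩),
            fun ht => hpos t fun hcon => ht (mem_rootsOn.1 hcon).1⟩
          by_contra haJ
          exact hex a (Finset.mem_sdiff.2 ⟨ha, haJ⟩) hat
        · intro a ha
          rw [hv, if_neg (hne a (Finset.mem_sdiff.1 ha).1), if_neg (hex a ha).symm]
          simp
    · have hne : ∀ a ∈ A, t ≠ σ a := fun a ha hta => htW (hta ▸ h.twin_mem a ha)
      rw [if_neg htW, zero_sub]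
      by_cases htAJ : t ∈ A \ J
      · have htA := (Finset.mem_sdiff.1 htAJ).1
        have htJ := (Finset.mem_sdiff.1 htAJ).2
        have htR := hpos _ (hnotR t htA htJ)
        refine ⟨fun ht => absurd ht htJ, fun _ => ?_⟩
        rw [Finset.sum_eq_single_of_mem t htAJ, hv, if_pos rfl, if_neg (hne t htA),
          if_neg (by simp [htA])]
        · simp only [c]
          split_ifs <;> linarith
        · intro a ha hat
          rw [hv, if_neg (hne a (Finset.mem_sdiff.1 ha).1), if_neg hat.symm]
          simp
      · rw [Finset.sum_eq_zero, neg_zero, zero_add]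
        · refine ⟨fun ht => if_neg (by simp [ht]), fun ht => ?_⟩
          rw [if_pos]
          · exact one_pos
          · simp only [Finset.mem_sdiff, not_and_not_right] at htAJ
            simp only [Finset.mem_union, not_or]
            exact ⟨⟨ht, fun hA => ht (htAJ hA)⟩, htW⟩
        · intro a ha
          rw [hv, if_neg (hne a (Finset.mem_sdiff.1 ha).1),
            if_neg fun hta : t = a => htAJ (hta ▸ ha)]
          simp
  refine ⟨u, ?_, fun s => (hval s).1, fun s => (hval s).2⟩
  refine Submodule.add_mem _ (Submodule.sub_mem _ (evalVec_mem h.pow_mem hdeg)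
    (Submodule.sum_mem _ fun a ha => Submodule.smul_mem _ _ (h.sub_mem a ?_)))
    (Submodule.sum_mem _ fun s hs => ?_)
  · exact (Finset.mem_sdiff.1 ha).1
  · simp only [Finset.mem_sdiff, Finset.mem_union, not_or] at hs
    exact h.single_mem s hs.2.2 hs.2.1.2

theorem IsCyclicSpace.exists_pos_forall_vanishing [Fintype T] {κ : Type*} [Fintype κ]
    {b : ℝ → κ → T → ℝ} (hb : ∀ j s, Continuous fun ε => b ε j s)
    {W A : Finset T} {σ : T → T} {p : T → ℝ} {N : ℕ}
    (h : IsCyclicSpace W A σ p N (Submodule.span ℝ (Set.range (b 0)))) :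
    ∃ ε : ℝ, 0 < ε ∧ ∀ J : Finset T, 2 * (rootsOn W A σ J).card < N →
      ∃ u ∈ Submodule.span ℝ (Set.range (b ε)), (∀ s ∈ J, u s = 0) ∧ ∀ s ∉ J, 0 < u s := by
  have hev : ∀ᶠ ε in 𝓝 (0 : ℝ), ∀ J : Finset T, 2 * (rootsOn W A σ J).card < N →
      ∃ u ∈ Submodule.span ℝ (Set.range (b ε)), (∀ s ∈ J, u s = 0) ∧ ∀ s ∉ J, 0 < u s := by
    rw [Filter.eventually_all]
    intro J
    by_cases hJ : 2 * (rootsOn W A σ J).card < N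
    · refine (eventually_exists_vanishing hb fun K hK => h.exists_vanishing ?_).mono
        fun _ h _ => h
      exact lt_of_le_of_lt (Nat.mul_le_mul_left 2 (Finset.card_le_card (rootsOn_mono hK))) hJ
    · exact Filter.Eventually.of_forall fun _ h => absurd h hJ
  obtain ⟨ε, hε, hε0⟩ :=
    ((hev.filter_mono nhdsWithin_le_nhds).and (self_mem_nhdsWithin (s := Set.Ioi 0))).exists
  exact ⟨ε, hε0, hε⟩

end Perturbation

section Families

variable {r : ℕ} (n : Fin r → ℕ)

/-- Points on the line, increasing from block to block. -/
def linePoint (s : (i : Fin r) × Fin (n i + 1)) : ℝ :=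
  ((s.1.val * (∑ i, n i + 1) + s.2.val : ℕ) : ℝ)

theorem linePoint_lt {s s' : (i : Fin r) × Fin (n i + 1)} (h : s.1 < s'.1) :
    linePoint n s < linePoint n s' := by
  have h1 : s.2.val < ∑ i, n i + 1 := s.2.isLt.trans_le
    (Nat.succ_le_succ (Finset.single_le_sum (fun _ _ => Nat.zero_le _) (Finset.mem_univ s.1)))
  have h2 : (s.1.val + 1) * (∑ i, n i + 1) ≤ s'.1.val * (∑ i, n i + 1) :=
    Nat.mul_le_mul_right _ h
  rw [linePoint, linePoint, Nat.cast_lt]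
  linarith

theorem linePoint_injective : Function.Injective (linePoint n) := by
  rintro ⟨i, j⟩ ⟨i', j'⟩ h
  rcases lt_trichotomy i i' with hi | rfl | hi
  · exact absurd h (linePoint_lt n (s := ⟨i, j⟩) (s' := ⟨i', j'⟩) hi).ne
  · simp only [linePoint, Nat.cast_inj, add_right_inj] at h
    rw [Fin.ext h]
  · exact absurd h (linePoint_lt n (s := ⟨i', j'⟩) (s' := ⟨i, j⟩) hi).ne'

/-- The other endpoint of a vertex of a segment. -/
def lastVertex (s : (i : Fin r) × Fin (n i + 1)) : (i : Fin r) × Fin (n i + 1) :=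
  ⟨s.1, Fin.last _⟩

/-- The difference of the two coordinates of a segment. -/
def segVec (i : Fin r) (s : (i : Fin r) × Fin (n i + 1)) : ℝ :=
  if s.1 = i then if s.2 = 0 then -1 else 1 else 0

/-- Weight `1` on the first vertex of block `i` and `ε` on its other vertices. -/
def coneVec (ε : ℝ) (i : Fin r) (s : (i : Fin r) × Fin (n i + 1)) : ℝ :=
  if s.1 = i then if s.2 = 0 then 1 else ε else 0

variable {n}

theorem eq_lastVertex {s : (i : Fin r) × Fin (n i + 1)} (hn : n s.1 = 1) (hs : s.2 ≠ 0) :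
    s = lastVertex n s := by
  obtain ⟨i, j⟩ := s
  have h1 := j.isLt
  have h2 : j.val ≠ 0 := fun h => hs (Fin.ext h)
  have h3 : n i = 1 := hn
  have : j = Fin.last _ := Fin.ext (by rw [Fin.val_last]; omega)
  rw [this]; rfl

theorem lastVertex_snd_ne_zero {s : (i : Fin r) × Fin (n i + 1)} (hn : n s.1 = 1) :
    (lastVertex n s).2 ≠ 0 := fun h => by
  have := congrArg Fin.val h
  simp only [lastVertex, Fin.val_last, Fin.val_zero] at this
  omega

theorem eq_of_snd_eq_zero {s s' : (i : Fin r) × Fin (n i + 1)} (h : s.1 = s'.1) (hs : s.2 = 0)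
    (hs' : s'.2 = 0) : s = s' := by
  obtain ⟨i, j⟩ := s
  obtain ⟨i', j'⟩ := s'
  obtain rfl : i = i' := h
  rw [show j = 0 from hs, show j' = 0 from hs']

theorem eq_of_snd_ne_zero {s s' : (i : Fin r) × Fin (n i + 1)} (hn : n s.1 = 1) (h : s.1 = s'.1)
    (hs : s.2 ≠ 0) (hs' : s'.2 ≠ 0) : s = s' := by
  rw [eq_lastVertex hn hs, eq_lastVertex (h ▸ hn) hs']
  obtain ⟨i, j⟩ := s
  obtain ⟨i', j'⟩ := s'
  obtain rfl : i = i' := h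
  rfl

theorem single_sub_single_eq_segVec {a : (i : Fin r) × Fin (n i + 1)} (hn : n a.1 = 1)
    (ha : a.2 = 0) : Pi.single (lastVertex n a) 1 - Pi.single a 1 = segVec n a.1 := by
  ext s
  have hl := lastVertex_snd_ne_zero hn
  simp only [Pi.sub_apply, Pi.single_apply, segVec]
  by_cases h1 : s.1 = a.1
  · by_cases h2 : s.2 = 0
    · have h3 : s ≠ lastVertex n a := fun h => hl (by rw [← h]; exact h2)
      rw [if_neg h3, if_pos (eq_of_snd_eq_zero h1 h2 ha), if_pos h1, if_pos h2, zero_sub]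
    · have h3 : s ≠ a := fun h => h2 (by rw [h]; exact ha)
      rw [if_pos (eq_of_snd_ne_zero (s' := lastVertex n a) (h1 ▸ hn) h1 h2 hl), if_neg h3,
        if_pos h1, if_neg h2, sub_zero]
  · have h3 : s ≠ lastVertex n a := fun h => h1 (by rw [h]; rfl)
    have h4 : s ≠ a := fun h => h1 (by rw [h])
    simp [h1, h3, h4]

theorem single_eq_smul_add {s : (i : Fin r) × Fin (n i + 1)} (hn : n s.1 = 1) :
    Pi.single s 1 = (1 / 2 : ℝ) • (blockIndicator n s.1 +
      (if s.2 = 0 then -1 else 1 : ℝ) • segVec n s.1) := by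
  ext s'
  simp only [Pi.smul_apply, Pi.add_apply, Pi.single_apply, smul_eq_mul, segVec, blockIndicator]
  by_cases h1 : s'.1 = s.1
  · by_cases h2 : s.2 = 0 <;> by_cases h3 : s'.2 = 0
    · simp only [h2, h3, eq_of_snd_eq_zero h1 h3 h2]
      norm_num
    · have : s' ≠ s := fun h => h3 (by rw [h]; exact h2)
      simp [h1, h2, h3, this]
    · have : s' ≠ s := fun h => h2 (by rw [← h]; exact h3)
      simp [h1, h2, h3, this]
    · rw [if_pos (eq_of_snd_ne_zero (h1 ▸ hn) h1 h3 h2), if_pos h1, if_pos h1, if_neg h2,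
        if_neg h3]
      norm_num
  · have : s' ≠ s := fun h => h1 (by rw [h])
    simp [h1, this]

theorem coneVec_zero {s : (i : Fin r) × Fin (n i + 1)} (hs : s.2 = 0) :
    coneVec n 0 s.1 = Pi.single s 1 := by
  ext s'
  simp only [coneVec, Pi.single_apply]
  by_cases h1 : s'.1 = s.1
  · by_cases h2 : s'.2 = 0
    · rw [if_pos h1, if_pos h2, if_pos (eq_of_snd_eq_zero h1 h2 hs)]
    · have : s' ≠ s := fun h => h2 (by rw [h]; exact hs)
      simp [h2, this]
  · have : s' ≠ s := fun h => h1 (by rw [h])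
    simp [h1, this]

theorem coneVec_pos {ε : ℝ} (hε : 0 < ε) {i : Fin r} {s : (i : Fin r) × Fin (n i + 1)}
    (hs : s.1 = i) : 0 < coneVec n ε i s := by
  rw [coneVec, if_pos hs]
  split_ifs
  exacts [one_pos, hε]

theorem exists_notMem_rootsOn {W A J : Finset ((i : Fin r) × Fin (n i + 1))} {i : Fin r}
    (hn : n i = 1) (hJ : MeetsBlocks Sigma.fst J) (hA : ⟨i, 0⟩ ∈ A)
    (hW : (⟨i, 0⟩ : (i : Fin r) × Fin (n i + 1)) ∉ W) :
    ∃ s ∈ J, s.1 = i ∧ s ∉ rootsOn W A (lastVertex n) J := by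
  by_cases h0 : (⟨i, 0⟩ : (i : Fin r) × Fin (n i + 1)) ∈ J
  · exact ⟨_, h0, rfl, fun h => hW (mem_rootsOn.1 h).2.1⟩
  · obtain ⟨s, hsJ, rfl⟩ := hJ i
    refine ⟨s, hsJ, rfl, fun h => h0 ((mem_rootsOn.1 h).2.2 _ hA ?_)⟩
    have hs : s.2 ≠ 0 := fun hs => h0 (by rw [← hs]; exact hsJ)
    exact (eq_lastVertex hn hs).symm

theorem card_rootsOn_add_le {W A J : Finset ((i : Fin r) × Fin (n i + 1))} {q : ℕ} (hq : q ≤ r)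
    (h : ∀ i : Fin r, i.val < q → ∃ s ∈ J, s.1 = i ∧ s ∉ rootsOn W A (lastVertex n) J) :
    (rootsOn W A (lastVertex n) J).card + q ≤ J.card := by
  choose τ hτJ hτ hτR using fun i : Fin q => h (Fin.castLE hq i) i.isLt
  have hsub : rootsOn W A (lastVertex n) J ⊆ J := fun s hs => (mem_rootsOn.1 hs).1
  have hinj : Function.Injective τ := fun i i' hii =>
    Fin.castLE_injective hq ((hτ i).symm.trans ((congrArg Sigma.fst hii).trans (hτ i')))
  have himg : Finset.univ.image τ ⊆ J \ rootsOn W A (lastVertex n) J := fun s hs => by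
    obtain ⟨i, -, rfl⟩ := Finset.mem_image.1 hs
    exact Finset.mem_sdiff.2 ⟨hτJ i, hτR i⟩
  have := Finset.card_le_card himg
  rw [Finset.card_image_of_injective _ hinj, Finset.card_univ, Fintype.card_fin] at this
  have := Finset.card_sdiff_add_card_eq_card hsub
  omega

/-- A polynomial of small degree which is `1` on block `i` and `0` on the other blocks
meeting `K`. -/
theorem exists_blockPolynomial (K : Finset ((i : Fin r) × Fin (n i + 1))) (i : Fin r) :
    ∃ g : Polynomial ℝ, g.degree < K.card ∧
      ∀ s ∈ K, g.eval (linePoint n s) = if s.1 = i then 1 else 0 :=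
  ⟨Lagrange.interpolate K (linePoint n) fun s => if s.1 = i then 1 else 0,
    Lagrange.degree_interpolate_lt _ (linePoint_injective n).injOn,
    fun _ hs => Lagrange.eval_interpolate_at_node _ (linePoint_injective n).injOn hs⟩

end Families

section Cases

variable {r k q d : ℕ} {n : Fin r → ℕ}

theorem exists_isPPSN_of_sum_le (hd : d ≤ ∑ i, n i) (hd' : ∑ i, n i ≤ d) :
    ∃ P : Set (Fin d → ℝ), IsPPSN k n P ∧ polyDim P = d := by
  classical
  refine exists_isPPSN_of_submodule n hd ⊤ ?_
    (isSignedTriangular_blockIndicator n).toIsTriangular (fun _ => Submodule.mem_top)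
    fun J _ _ => ⟨fun s => if s ∈ J then 0 else 1, Submodule.mem_top, fun s hs => if_pos hs,
      fun s hs => by simp [hs]⟩
  rw [finrank_top, Module.finrank_fintype_fun_eq_card, Fintype.card_sigma]
  simp only [Fintype.card_fin, Finset.sum_add_distrib, Finset.sum_const, Finset.card_univ,
    smul_eq_mul, mul_one]
  omega

theorem exists_isPPSN_of_lt {t : ℕ} (hseg : ∀ i : Fin r, i.val < q → n i = 1) (hqd : q ≤ d)
    (hd : d ≤ ∑ i, n i) (hqt : q ≤ t) (htr : t < r)
    (hsum : ∑ i ∈ Finset.univ.filter (fun i : Fin r => i.val < t), n i ≤ d)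
    (hk : 2 * (k + r) ≤ d + t + q) :
    ∃ P : Set (Fin d → ℝ), IsPPSN k n P ∧ polyDim P = d := by
  obtain ⟨D, hD⟩ : ∃ D, D + q = d + t := ⟨d + t - q, by omega⟩
  let W : Finset ((i : Fin r) × Fin (n i + 1)) :=
    Finset.univ.filter fun s => ¬(s.2 = 0 ∧ (s.1.val < q ∨ t < s.1.val))
  let A : Finset ((i : Fin r) × Fin (n i + 1)) :=
    Finset.univ.filter fun s => s.2 = 0 ∧ s.1.val < q
  have hmemW : ∀ s, s ∈ W ↔ ¬(s.2 = 0 ∧ (s.1.val < q ∨ t < s.1.val)) := fun s => by simp [W]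
  have hmemA : ∀ s, s ∈ A ↔ s.2 = 0 ∧ s.1.val < q := fun s => by simp [A]
  let b : ℝ → Fin (D + 1) ⊕ {i : Fin r // i.val < q} ⊕ {i : Fin r // t < i.val} →
      ((i : Fin r) × Fin (n i + 1)) → ℝ := fun ε =>
    Sum.elim (fun m => evalVec W (linePoint n) (Polynomial.X ^ m.val))
      (Sum.elim (fun i => segVec n i) fun i => coneVec n ε i)
  have hb : ∀ j s, Continuous fun ε => b ε j s := by
    rintro (m | i | i) s
    · exact continuous_const
    · exact continuous_const
    · simp only [b, Sum.elim_inr, coneVec]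
      split_ifs <;> fun_prop
  have hpow : ∀ ε, ∀ m < D + 1, evalVec W (linePoint n) (Polynomial.X ^ m) ∈
      Submodule.span ℝ (Set.range (b ε)) := fun ε m hm =>
    Submodule.subset_span ⟨Sum.inl ⟨m, hm⟩, rfl⟩
  have hsegmem : ∀ ε, ∀ i : Fin r, i.val < q → segVec n i ∈
      Submodule.span ℝ (Set.range (b ε)) := fun ε i hi =>
    Submodule.subset_span ⟨Sum.inr (Sum.inl ⟨i, hi⟩), rfl⟩
  have hcone : ∀ ε, ∀ i : Fin r, t < i.val → coneVec n ε i ∈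
      Submodule.span ℝ (Set.range (b ε)) := fun ε i hi =>
    Submodule.subset_span ⟨Sum.inr (Sum.inr ⟨i, hi⟩), rfl⟩
  have hcyc : IsCyclicSpace W A (lastVertex n) (linePoint n) (D + 1)
      (Submodule.span ℝ (Set.range (b 0))) := by
    refine ⟨linePoint_injective n, hpow 0, fun a ha => ?_, fun a ha => ?_, fun a ha a' ha' h => ?_,
      fun a ha => ?_, fun s hsW hsA => ?_⟩
    · rw [hmemA] at ha
      rw [hmemW]
      tauto
    · rw [hmemW]
      exact fun h => lastVertex_snd_ne_zero (hseg _ ((hmemA a).1 ha).2) h.1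
    · exact eq_of_snd_eq_zero (congrArg Sigma.fst h :) ((hmemA a).1 ha).1 ((hmemA a').1 ha').1
    · obtain ⟨ha0, haq⟩ := (hmemA a).1 ha
      rw [single_sub_single_eq_segVec (hseg _ haq) ha0]
      exact hsegmem 0 _ haq
    · rw [hmemW, not_not] at hsW
      rw [hmemA] at hsA
      rw [← coneVec_zero hsW.1]
      exact hcone 0 _ (by tauto)
  obtain ⟨ε, hε, hexp⟩ := hcyc.exists_pos_forall_vanishing hb
  let K := W.filter fun s => s.1.val < t
  have hKcard : K.card ≤ D := by
    have h1 : K.card + A.card =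
        (Finset.univ.filter fun s : (i : Fin r) × Fin (n i + 1) => s.1.val < t).card := by
      rw [← Finset.card_union_of_disjoint]
      · congr 1
        ext s
        simp only [K, Finset.mem_union, Finset.mem_filter, hmemW, hmemA, Finset.mem_univ]
        have : s.1.val < q → s.1.val < t := fun h => h.trans_le hqt
        have : s.1.val < t → ¬ t < s.1.val := fun h => h.le.not_gt
        tauto
      · refine Finset.disjoint_left.2 fun s hs hsA => ?_
        exact hcyc.notMem s hsA (Finset.mem_filter.1 hs).1
    have h2 : (Finset.univ.filter fun s : (i : Fin r) × Fin (n i + 1) => s.1.val < t).card =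
        ∑ i ∈ Finset.univ.filter (fun i : Fin r => i.val < t), (n i + 1) := by
      rw [show (Finset.univ.filter fun s : (i : Fin r) × Fin (n i + 1) => s.1.val < t) =
        (Finset.univ.filter fun i : Fin r => i.val < t).sigma fun _ => Finset.univ by ext; simp,
        Finset.card_sigma]
      simp
    have h3 : A.card = q := by
      rw [show A = (Finset.univ.filter fun i : Fin r => i.val < q).image
          fun i => (⟨i, 0⟩ : (i : Fin r) × Fin (n i + 1)) from ?_, Finset.card_image_of_injective,
        Fin.card_filter_val_lt]
      · omega
      · exact fun i j h => congrArg Sigma.fst h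
      · ext s
        simp only [hmemA, Finset.mem_image, Finset.mem_filter, Finset.mem_univ, true_and]
        constructor
        · rintro ⟨h0, hq⟩
          exact ⟨s.1, hq, by rw [← h0]⟩
        · rintro ⟨i, hi, rfl⟩
          exact ⟨rfl, hi⟩
    rw [h2, Finset.sum_add_distrib, Finset.sum_const, smul_eq_mul, mul_one,
      Fin.card_filter_val_lt] at h1
    omega
  have hmemK : ∀ s, s ∈ K ↔ s ∈ W ∧ s.1.val < t := fun s => Finset.mem_filter
  let z : Polynomial ℝ := ∏ x ∈ K, (Polynomial.X - Polynomial.C (linePoint n x))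
  have hz : z.natDegree < D + 1 := by
    rw [Polynomial.natDegree_prod_of_monic _ _ fun x _ => Polynomial.monic_X_sub_C _]
    simp only [Polynomial.natDegree_X_sub_C, Finset.sum_const, smul_eq_mul, mul_one]
    omega
  choose g hgdeg hg using exists_blockPolynomial K
  have hgnat : ∀ i, (g i).natDegree < D + 1 := fun i => by
    have := Polynomial.natDegree_le_of_degree_le (hgdeg i).le
    omega
  let ℓ : Fin r → ((i : Fin r) × Fin (n i + 1)) → ℝ := fun i =>
    if t < i.val then coneVec n ε i
    else if i.val = t then evalVec W (linePoint n) z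
    else if i.val < q then (2 : ℝ) • evalVec W (linePoint n) (g i) - segVec n i
    else evalVec W (linePoint n) (g i)
  have hgval : ∀ i s, s.1.val < t → evalVec W (linePoint n) (g i) s =
      if s ∈ W then if s.1 = i then 1 else 0 else 0 := fun i s hs => by
    rw [evalVec_apply]
    by_cases hW : s ∈ W
    · rw [if_pos hW, if_pos hW, hg i s ((hmemK s).2 ⟨hW, hs⟩)]
    · rw [if_neg hW, if_neg hW]
  have hℓ : IsTriangular Sigma.fst ℓ := by
    constructor
    · intro i s hs
      have hs' : s.1.val < i.val := hs
      simp only [ℓ]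
      split_ifs with h1 h2 h3
      · exact if_neg hs.ne
      · rw [evalVec_apply]
        split_ifs with hW
        · rw [Polynomial.eval_prod]
          exact Finset.prod_eq_zero ((hmemK s).2 ⟨hW, by omega⟩) (by simp)
        · rfl
      · simp [hgval i s (by omega), segVec, hs.ne]
      · simp [hgval i s (by omega), hs.ne]
    · rintro i s rfl
      simp only [ℓ]
      split_ifs with h1 h2 h3
      · exact coneVec_pos hε rfl
      · rw [evalVec_apply, if_pos ((hmemW s).2 (by omega)), Polynomial.eval_prod]
        refine Finset.prod_pos fun x hx => ?_
        rw [Polynomial.eval_sub, Polynomial.eval_X, Polynomial.eval_C, sub_pos]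
        exact linePoint_lt n (Fin.lt_def.2 (h2.symm ▸ ((hmemK x).1 hx).2))
      · rw [Pi.sub_apply, Pi.smul_apply, hgval _ s (by omega), segVec, if_pos rfl, if_pos rfl]
        by_cases h0 : s.2 = 0
        · rw [if_neg fun hW => (hmemW s).1 hW ⟨h0, Or.inl h3⟩, if_pos h0]
          norm_num
        · rw [if_pos ((hmemW s).2 fun h => h0 h.1), if_neg h0]
          norm_num
      · rw [hgval _ s (by omega), if_pos ((hmemW s).2 (by omega)), if_pos rfl]
        exact one_pos
  refine exists_isPPSN_of_submodule n hd (Submodule.span ℝ (Set.range (b ε))) ?_ hℓ (fun i => ?_)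
    fun J hJ hcard => hexp J ?_
  · refine (finrank_range_le_card (b ε)).trans ?_
    have h1 : Fintype.card {i : Fin r // t < i.val} + (t + 1) = r := by
      have := Fintype.card_subtype_compl fun i : Fin r => t < i.val
      rw [Fintype.card_fin, Fintype.card_subtype fun i : Fin r => ¬ t < i.val,
        show (Finset.univ.filter fun i : Fin r => ¬ t < i.val) =
          Finset.univ.filter fun i : Fin r => i.val < t + 1 by ext; simp,
        Fin.card_filter_val_lt] at this
      omega
    rw [Fintype.card_sum, Fintype.card_sum, Fintype.card_fin,
      Fintype.card_subtype fun i : Fin r => i.val < q, Fin.card_filter_val_lt]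
    omega
  · simp only [ℓ]
    split_ifs with h1 h2 h3
    · exact hcone ε i h1
    · exact evalVec_mem (hpow ε) hz
    · exact Submodule.sub_mem _ (Submodule.smul_mem _ _ (evalVec_mem (hpow ε) (hgnat i)))
        (hsegmem ε i h3)
    · exact evalVec_mem (hpow ε) (hgnat i)
  · have := card_rootsOn_add_le (W := W) (A := A) (J := J) (q := q) (by omega) fun i hi =>
      exists_notMem_rootsOn (hseg i hi) hJ ((hmemA _).2 ⟨rfl, hi⟩)
        fun h => (hmemW _).1 h ⟨rfl, Or.inl hi⟩
    omega

theorem exists_isPPSN_of_lt_card_segments (hseg : ∀ i : Fin r, i.val < q → n i = 1)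
    (hqr : q ≤ r) (hdq : d < q) (hd : d ≤ ∑ i, n i) (hk : 2 * (k + r) + 2 ≤ d + 2 * q) :
    ∃ P : Set (Fin d → ℝ), IsPPSN k n P ∧ polyDim P = d := by
  obtain ⟨N, rfl⟩ : ∃ N, d = N + 1 := ⟨d - 1, by omega⟩
  let e : Fin r := ⟨q - 1, by omega⟩
  have he : ∀ i : Fin r, i.val + 1 = q → i = e := fun i hi => Fin.ext (by simp only [e]; omega)
  let W : Finset ((i : Fin r) × Fin (n i + 1)) :=
    Finset.univ.filter fun s => s.2 ≠ 0 ∧ s.1.val + 1 ≠ q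
  let A : Finset ((i : Fin r) × Fin (n i + 1)) :=
    Finset.univ.filter fun s => s.2 = 0 ∧ s.1.val + 1 < q
  have hmemW : ∀ s, s ∈ W ↔ s.2 ≠ 0 ∧ s.1.val + 1 ≠ q := fun s => by simp [W]
  have hmemA : ∀ s, s ∈ A ↔ s.2 = 0 ∧ s.1.val + 1 < q := fun s => by simp [A]
  let ψ : Fin r → ((i : Fin r) × Fin (n i + 1)) → ℝ := fun i s =>
    if i.val ≤ N then 0
    else if i.val = N + 1 then evalVec W (linePoint n) (Polynomial.X ^ N) s
    else if s.1.val + 1 = i.val then 1 else 0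
  let b : ℝ → Fin N ⊕ {i : Fin r // i.val < q} ⊕ {i : Fin r // q ≤ i.val} ⊕ Unit →
      ((i : Fin r) × Fin (n i + 1)) → ℝ := fun ε =>
    Sum.elim (fun m => evalVec W (linePoint n) (Polynomial.X ^ m.val))
      (Sum.elim (fun i => segVec n i - ε • ψ i)
        (Sum.elim (fun i => coneVec n ε i) fun _ => blockIndicator n e))
  have hb : ∀ j s, Continuous fun ε => b ε j s := by
    rintro (m | i | i | _) s
    · exact continuous_const
    · simp only [b, Sum.elim_inr, Sum.elim_inl, Pi.sub_apply, Pi.smul_apply, smul_eq_mul]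
      fun_prop
    · simp only [b, Sum.elim_inr, Sum.elim_inl, coneVec]
      split_ifs <;> fun_prop
    · exact continuous_const
  have hpow : ∀ ε, ∀ m < N, evalVec W (linePoint n) (Polynomial.X ^ m) ∈
      Submodule.span ℝ (Set.range (b ε)) := fun ε m hm =>
    Submodule.subset_span ⟨Sum.inl ⟨m, hm⟩, rfl⟩
  have hsegmem : ∀ ε, ∀ i : Fin r, i.val < q → segVec n i - ε • ψ i ∈
      Submodule.span ℝ (Set.range (b ε)) := fun ε i hi =>
    Submodule.subset_span ⟨Sum.inr (Sum.inl ⟨i, hi⟩), rfl⟩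
  have hseg0 : ∀ i : Fin r, i.val < q → segVec n i ∈
      Submodule.span ℝ (Set.range (b 0)) := fun i hi => by
    simpa using hsegmem 0 i hi
  have hcone : ∀ ε, ∀ i : Fin r, q ≤ i.val → coneVec n ε i ∈
      Submodule.span ℝ (Set.range (b ε)) := fun ε i hi =>
    Submodule.subset_span ⟨Sum.inr (Sum.inr (Sum.inl ⟨i, hi⟩)), rfl⟩
  have hind : ∀ ε, blockIndicator n e ∈ Submodule.span ℝ (Set.range (b ε)) := fun ε =>
    Submodule.subset_span ⟨Sum.inr (Sum.inr (Sum.inr ())), rfl⟩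
  have hcyc : IsCyclicSpace W A (lastVertex n) (linePoint n) N
      (Submodule.span ℝ (Set.range (b 0))) := by
    refine ⟨linePoint_injective n, hpow 0, fun a ha => ?_, fun a ha => ?_, fun a ha a' ha' h => ?_,
      fun a ha => ?_, fun s hsW hsA => ?_⟩
    · rw [hmemW]
      exact fun h => h.1 ((hmemA a).1 ha).1
    · have ha' := ((hmemA a).1 ha).2
      exact (hmemW _).2 ⟨lastVertex_snd_ne_zero (hseg _ (by omega)), ha'.ne⟩
    · exact eq_of_snd_eq_zero (congrArg Sigma.fst h :) ((hmemA a).1 ha).1 ((hmemA a').1 ha').1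
    · obtain ⟨ha0, haq⟩ := (hmemA a).1 ha
      rw [single_sub_single_eq_segVec (hseg _ (by omega)) ha0]
      exact hseg0 _ (by omega)
    · rw [hmemW] at hsW
      rw [hmemA] at hsA
      by_cases hsq : s.1.val + 1 = q
      · rw [single_eq_smul_add (hseg _ (by omega))]
        refine Submodule.smul_mem _ _ (Submodule.add_mem _ ?_
          (Submodule.smul_mem _ _ (hseg0 _ (by omega))))
        rw [he _ hsq]
        exact hind 0
      · have hs0 : s.2 = 0 := by tauto
        rw [← coneVec_zero hs0]
        exact hcone 0 _ (by_contra fun h => hsA ⟨hs0, by omega⟩)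
  obtain ⟨ε, hε, hexp⟩ := hcyc.exists_pos_forall_vanishing hb
  let f : Fin r := ⟨N + 1, by omega⟩
  let K := W.filter fun s => s.1.val < N + 1
  have hmemK : ∀ s, s ∈ K ↔ s ∈ W ∧ s.1.val < N + 1 := fun s => Finset.mem_filter
  have hKcard : K.card ≤ N + 1 := by
    have hsub : K ⊆ (Finset.univ.filter fun i : Fin r => i.val < N + 1).image
        fun i => (⟨i, Fin.last _⟩ : (i : Fin r) × Fin (n i + 1)) := fun s hs => by
      obtain ⟨hsW, hsN⟩ := (hmemK s).1 hs
      refine Finset.mem_image.2 ⟨s.1, by simpa using hsN, ?_⟩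
      exact (eq_lastVertex (hseg _ (by omega)) ((hmemW s).1 hsW).1).symm
    refine (Finset.card_le_card hsub).trans (Finset.card_image_le.trans ?_)
    rw [Fin.card_filter_val_lt]
    exact min_le_right _ _
  choose g hgdeg hg using exists_blockPolynomial K
  have hgnat : ∀ i, (g i).natDegree < N + 1 := fun i => by
    have h1 := (hgdeg i).trans_le (Nat.cast_le.2 hKcard)
    by_cases h0 : g i = 0
    · simp [h0]
    · exact (Polynomial.natDegree_lt_iff_degree_lt h0).2 h1
  have hgval : ∀ i s, s.1.val < N + 1 → evalVec W (linePoint n) (g i) s =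
      if s ∈ W then if s.1 = i then 1 else 0 else 0 := fun i s hs => by
    rw [evalVec_apply]
    by_cases hW : s ∈ W
    · rw [if_pos hW, if_pos hW, hg i s ((hmemK s).2 ⟨hW, hs⟩)]
    · rw [if_neg hW, if_neg hW]
  have hℓ : ∀ i, ∃ v ∈ Submodule.span ℝ (Set.range (b ε)),
      (∀ s, s.1 < i → v s = 0) ∧ ∀ s, s.1 = i → 0 < v s := by
    intro i
    rcases le_or_gt q i.val with hiq | hiq
    · exact ⟨_, hcone ε i hiq, fun s hs => if_neg hs.ne, fun s hs => coneVec_pos hε hs⟩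
    rcases eq_or_ne (i.val + 1) q with hie | hie
    · rw [he i hie]
      exact ⟨_, hind ε, fun s hs => if_neg hs.ne, fun s hs => by simp [blockIndicator, hs]⟩
    rcases lt_or_ge N i.val with hiN | hiN
    · let j : Fin r := ⟨i.val + 1, by omega⟩
      have hψ : ∀ s, ψ j s = if s.1 = i then 1 else 0 := fun s => by
        simp only [ψ, j, Fin.ext_iff, Nat.add_right_cancel_iff]
        rw [if_neg (by omega), if_neg (by omega)]
      refine ⟨_, Submodule.neg_mem _ (hsegmem ε j (by simp only [j]; omega)),
        fun s hs => ?_, fun s hs => ?_⟩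
      · have hsj : s.1 ≠ j := fun h => by simp [h, j, Fin.lt_def] at hs
        simp [segVec, hψ, hs.ne, hsj]
      · have hij : i ≠ j := fun h => by simp [j, Fin.ext_iff] at h
        simpa [segVec, hψ, hs, hij] using hε
    · have hψi : ψ i = 0 := funext fun s => if_pos hiN
      have hψf : ψ f = evalVec W (linePoint n) (Polynomial.X ^ N) := funext fun s => by
        simp [ψ, f]
      have hmem : ε • evalVec W (linePoint n) (g i) - (g i).coeff N • segVec n f ∈
          Submodule.span ℝ (Set.range (b ε)) := by
        have : ε • evalVec W (linePoint n) (g i) - (g i).coeff N • segVec n f =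
            ε • (∑ m ∈ Finset.range N, (g i).coeff m • evalVec W (linePoint n) (Polynomial.X ^ m)) -
              (g i).coeff N • (segVec n f - ε • ψ f) := by
          rw [evalVec_eq_sum W _ (hgnat i), Finset.sum_range_succ, hψf]
          module
        rw [this]
        exact Submodule.sub_mem _ (Submodule.smul_mem _ _ (Submodule.sum_mem _ fun m hm =>
          Submodule.smul_mem _ _ (hpow ε m (Finset.mem_range.1 hm))))
          (Submodule.smul_mem _ _ (hsegmem ε f hdq))
      have hmem' : segVec n i ∈ Submodule.span ℝ (Set.range (b ε)) := by
        simpa [hψi] using hsegmem ε i hiq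
      have hne : ∀ j ≤ i, j ≠ f := fun j hj h => by
        simp only [h, f, Fin.le_def] at hj
        omega
      refine ⟨_, Submodule.sub_mem _ (Submodule.smul_mem _ 2 hmem) (Submodule.smul_mem _ ε hmem'),
        fun s hs => ?_, fun s hs => ?_⟩
      · have : s.1.val < i.val := hs
        simp [hgval i s (by omega), hne s.1 hs.le, segVec, hs.ne]
      · have : s.1.val = i.val := congrArg Fin.val hs
        simp only [Pi.sub_apply, Pi.smul_apply, hgval i s (by omega), segVec, hs,
          hne i le_rfl, if_true, if_false, smul_eq_mul]
        by_cases h0 : s.2 = 0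
        · rw [if_neg fun hW => ((hmemW s).1 hW).1 h0, if_pos h0]
          linarith
        · rw [if_pos ((hmemW s).2 ⟨h0, by omega⟩), if_neg h0]
          linarith
  choose ℓ hmem hzero hpos using hℓ
  refine exists_isPPSN_of_submodule n hd (Submodule.span ℝ (Set.range (b ε))) ?_
    ⟨hzero, hpos⟩ hmem fun J hJ hcard => hexp J ?_
  · refine (finrank_range_le_card (b ε)).trans ?_
    have h1 := Fintype.card_subtype_compl fun i : Fin r => i.val < q
    simp only [not_lt] at h1
    rw [Fintype.card_sum, Fintype.card_sum, Fintype.card_sum, h1, Fintype.card_fin,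
      Fintype.card_fin, Fintype.card_subtype fun i : Fin r => i.val < q, Fin.card_filter_val_lt,
      Fintype.card_unit]
    omega
  · have := card_rootsOn_add_le (W := W) (A := A) (J := J) hqr fun i hi => by
      by_cases hie : i.val + 1 = q
      · obtain ⟨s, hsJ, hs⟩ := hJ i
        exact ⟨s, hsJ, hs, fun h => ((hmemW s).1 (mem_rootsOn.1 h).2.1).2 (hs ▸ hie)⟩
      · exact exists_notMem_rootsOn (hseg i hi) hJ ((hmemA _).2 ⟨rfl, by simp only; omega⟩)
          fun h => ((hmemW _).1 h).1 rfl
    omega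

end Cases

/-- Proposition `defp-ppsn`. With `n_1 = ⋯ = n_s = 1 < n_{s+1} ≤ ⋯ ≤ n_r`:
(1) for `0 ≤ d ≤ s-1` there is a `d`-dimensional `(k,n̄)`-PPSN polytope provided
`k ≤ ⌊d/2⌋ - r + s - 1`; (2) for `s ≤ d ≤ Σ n_i` there is a `d`-dimensional `(k,n̄)`-PPSN
polytope provided `k ≤ ⌊(d+t-s)/2⌋ - r + s`, where `t ∈ {s,…,r}` is maximal with
`Σ_{i≤t} n_i ≤ d`. -/
theorem statement9 (k r s : ℕ) (hr : 1 ≤ r) (hs : s ≤ r) (n : Fin r → ℕ)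
    (hseg : ∀ i : Fin r, i.val < s → n i = 1)
    (hbig : ∀ i : Fin r, s ≤ i.val → 2 ≤ n i)
    (hmono : ∀ i j : Fin r, i ≤ j → n i ≤ n j) :
    (∀ d : ℕ, d + 1 ≤ s →
      (k : ℤ) ≤ (d : ℤ) / 2 - (r : ℤ) + (s : ℤ) - 1 →
      ∃ P : Set (Fin d → ℝ), IsPPSN k n P ∧ polyDim P = d) ∧
    (∀ d : ℕ, s ≤ d → d ≤ ∑ i, n i →
      ∀ t : ℕ, s ≤ t → t ≤ r →
        (∑ i ∈ Finset.univ.filter (fun i : Fin r => i.val < t), n i ≤ d) →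
        (∀ t', t' ≤ r →
          (∑ i ∈ Finset.univ.filter (fun i : Fin r => i.val < t'), n i ≤ d) → t' ≤ t) →
        (k : ℤ) ≤ ((d : ℤ) + (t : ℤ) - (s : ℤ)) / 2 - (r : ℤ) + (s : ℤ) →
        ∃ P : Set (Fin d → ℝ), IsPPSN k n P ∧ polyDim P = d) := by
  refine ⟨fun d hd hk => ?_, fun d hsd hdn t hst htr hsum _ hk => ?_⟩
  · refine exists_isPPSN_of_lt_card_segments hseg hs hd ?_ (by omega)
    have hn : ∀ i, 1 ≤ n i := fun i => by
      rcases lt_or_ge i.val s with hi | hi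
      · exact (hseg i hi).ge
      · exact one_le_two.trans (hbig i hi)
    have := Finset.card_nsmul_le_sum Finset.univ n 1 fun i _ => hn i
    rw [Finset.card_univ, Fintype.card_fin, smul_eq_mul, mul_one] at this
    exact (by omega : d ≤ r).trans this
  · rcases htr.lt_or_eq with htr | rfl
    · exact exists_isPPSN_of_lt hseg hsd hdn hst htr hsum (by omega)
    · refine exists_isPPSN_of_sum_le hdn ?_
      simpa using hsum
end
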